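/- arXiv:1212.6735 — 2 statements merged into one kernel-verified Lean document; each statement's English description precedes it below -/
import Mathlib

section
/- Every edge-coloured graph G on n vertices with minimum colour degree δ^c(G) ≥ 2n/3 contains a properly coloured 2-factor (a spanning subgraph that is a vertex-disjoint union of properly coloured cycles). -/
open SimpleGraph

/-- A list of vertices forms a properly coloured walk: consecutive vertices are
adjacent and consecutive edges receive different colours. -/
def IsPCWalk {V : Type*} (G : SimpleGraph V) (c : V → V → ℕ) : List V → Prop
  | a :: b :: d :: rest => G.Adj a b ∧ c a b ≠ c b d ∧ IsPCWalk G c (b :: d :: rest)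
  | [a, b] => G.Adj a b
  | _ => True

/-- A properly coloured path: distinct vertices forming a properly coloured walk. -/
def IsPCPath {V : Type*} (G : SimpleGraph V) (c : V → V → ℕ) (l : List V) : Prop :=
  l.Nodup ∧ IsPCWalk G c l

/-- A properly coloured cycle, given as a list of (distinct) vertices of length ≥ 3;
closing the cycle by appending the first two vertices ensures all adjacencies and
colour conditions, including around the wrap-around vertex. -/
def IsPCCycle {V : Type*} (G : SimpleGraph V) (c : V → V → ℕ) (l : List V) : Prop :=
  3 ≤ l.length ∧ l.Nodup ∧ IsPCWalk G c (l ++ l.take 2)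

/-- The colour degree of `v`: the number of distinct colours on edges at `v`. -/
noncomputable def colourDeg {V : Type*} (G : SimpleGraph V) (c : V → V → ℕ) (v : V) : ℕ :=
  ((c v) '' {w | G.Adj v w}).ncard

/-- `colourDeg1 G c v a`: the number of edges at `v` whose colour differs from `a`.
`δ₁^c(G) ≥ k` is then `∀ v a, k ≤ colourDeg1 G c v a`. -/
noncomputable def colourDeg1 {V : Type*} (G : SimpleGraph V) (c : V → V → ℕ) (v : V) (a : ℕ) : ℕ :=
  {w | G.Adj v w ∧ c v w ≠ a}.ncard

lemma isPCWalk_of_getElem {V : Type*} (G : SimpleGraph V) (c : V → V → ℕ) :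
    ∀ l : List V, (∀ i (h : i + 1 < l.length), G.Adj l[i] l[i + 1]) →
      (∀ i (h : i + 2 < l.length), c l[i] l[i + 1] ≠ c l[i + 1] l[i + 2]) → IsPCWalk G c l
  | [], _, _ => by simp [IsPCWalk]
  | [_], _, _ => by simp [IsPCWalk]
  | [a, b], h₁, _ => by simpa [IsPCWalk] using h₁ 0 (by simp)
  | a :: b :: d :: rest, h₁, h₂ => by
    refine ⟨by simpa using h₁ 0 (by simp), by simpa using h₂ 0 (by simp), ?_⟩
    refine isPCWalk_of_getElem G c (b :: d :: rest) (fun i h => ?_) (fun i h => ?_)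
    · exact h₁ (i + 1) (by simpa using h)
    · exact h₂ (i + 1) (by simpa using h)

/-- A cyclic sequence of distinct vertices of a subgraph that is properly coloured at each vertex
is a properly coloured cycle. -/
lemma isPCCycle_of_cyclic {V : Type*} (G F : SimpleGraph V) (c : V → V → ℕ)
    (hc : ∀ u v, c u v = c v u) (hFG : F ≤ G)
    (hF : ∀ b a d, F.Adj b a → F.Adj b d → a ≠ d → c b a ≠ c b d)
    (l : List V) (hl : l.Nodup) (h3 : 3 ≤ l.length)
    (hadj : ∀ i (h : i < l.length),
      F.Adj l[i] (l[(i + 1) % l.length]'(Nat.mod_lt _ (by omega)))) :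
    IsPCCycle G c l := by
  refine ⟨h3, hl, ?_⟩
  have key : ∀ i (h : i < (l ++ l.take 2).length),
      (l ++ l.take 2)[i] = l[i % l.length]'(Nat.mod_lt _ (by omega)) := by
    intro i h
    rw [List.getElem_append]
    split_ifs with h'
    · simp [Nat.mod_eq_of_lt h']
    · have hi : i < l.length + 2 := by
        rw [List.length_append, List.length_take] at h
        omega
      have : i % l.length = i - l.length := by
        rw [Nat.mod_eq_sub_mod (by omega), Nat.mod_eq_of_lt (by omega)]
      simp [this]
  have hstep : ∀ i, F.Adj (l[i % l.length]'(Nat.mod_lt _ (by omega)))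
      (l[(i + 1) % l.length]'(Nat.mod_lt _ (by omega))) := by
    intro i
    have := hadj (i % l.length) (Nat.mod_lt _ (by omega))
    simpa [Nat.mod_add_mod] using this
  refine isPCWalk_of_getElem G c _ (fun i h => ?_) (fun i h => ?_)
  · rw [key, key]
    exact hFG (hstep i)
  · rw [key, key, key, hc]
    refine hF _ _ _ (hstep i).symm (hstep (i + 1)) fun h => ?_
    have h' := (List.Nodup.getElem_inj_iff hl).1 h
    have : i ≡ i + 2 [MOD l.length] := h'
    have := (Nat.modEq_iff_dvd' (by omega)).1 this
    have := Nat.le_of_dvd (by omega) this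
    omega

/-- A 2-regular subgraph that is properly coloured at each vertex splits into properly coloured
cycles. -/
lemma exists_pcCycles_of_isCycles {V : Type*} [Fintype V] (G F : SimpleGraph V) (c : V → V → ℕ)
    (hc : ∀ u v, c u v = c v u) (hFG : F ≤ G)
    (hF : ∀ b a d, F.Adj b a → F.Adj b d → a ≠ d → c b a ≠ c b d)
    (h2 : ∀ v, (F.neighborSet v).ncard = 2) :
    ∃ S : Finset (List V),
      (∀ l ∈ S, IsPCCycle G c l) ∧
      (∀ l ∈ S, ∀ l' ∈ S, l ≠ l' → ∀ v, v ∈ l → v ∉ l') ∧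
      (∀ v : V, ∃ l ∈ S, v ∈ l) := by
  classical
  have hcyc : F.IsCycles := fun v _ => h2 v
  have hex : ∀ K : F.ConnectedComponent, ∃ l : List V, IsPCCycle G c l ∧ ∀ v, v ∈ l ↔ v ∈ K.supp := by
    intro K
    obtain ⟨v, hv⟩ := K.nonempty_supp
    have hn : (F.neighborSet v).Nonempty := by
      rw [← Set.ncard_pos, h2]
      norm_num
    obtain ⟨p, hp, hpK⟩ := hcyc.exists_cycle_toSubgraph_verts_eq_connectedComponentSupp hv hn
    have hlen := hp.three_le_length
    have hl : p.support.tail.length = p.length := by simp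
    have hget : ∀ i (h : i < p.support.tail.length), p.support.tail[i] = p.getVert (i + 1) := by
      intro i h
      rw [p.getVert_eq_support_getElem (by omega)]
      simp
    refine ⟨p.support.tail, isPCCycle_of_cyclic G F c hc hFG hF _ hp.support_nodup (by omega) ?_, ?_⟩
    · intro i h
      rw [hget, hget]
      rcases Nat.lt_or_ge (i + 1) p.length with h' | h'
      · have : (i + 1) % p.support.tail.length = i + 1 := Nat.mod_eq_of_lt (by omega)
        rw [this]
        exact p.adj_getVert_succ (by omega)
      · have h1 : i + 1 = p.length := by omega
        have : (i + 1) % p.support.tail.length = 0 := by rw [hl, h1, Nat.mod_self]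
        rw [this, h1, p.getVert_length]
        have := p.adj_getVert_succ (i := 0) (by omega)
        simpa using this
    · intro w
      rw [← hpK, SimpleGraph.Walk.mem_verts_toSubgraph]
      refine ⟨List.mem_of_mem_tail, fun hw => ?_⟩
      rw [← SimpleGraph.Walk.cons_tail_support] at hw
      rcases List.mem_cons.1 hw with rfl | hw
      · exact SimpleGraph.Walk.end_mem_tail_support hp.not_nil
      · exact hw
  choose f hf hfK using hex
  refine ⟨Finset.univ.image f, ?_, ?_, ?_⟩
  · simp only [Finset.mem_image]
    rintro _ ⟨K, -, rfl⟩
    exact hf K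
  · simp only [Finset.mem_image]
    rintro _ ⟨K, -, rfl⟩ _ ⟨K', -, rfl⟩ hne v hv hv'
    rw [hfK] at hv hv'
    exact hne (by rw [← SimpleGraph.ConnectedComponent.eq_of_common_vertex hv hv'])
  · intro v
    exact ⟨f (F.connectedComponentMk v), Finset.mem_image_of_mem _ (Finset.mem_univ _),
      (hfK _ _).2 rfl⟩

section Arithmetic

lemma false_of_card_le {α u w r b κ E D ν k g : ℕ} (hn : 3 * ν ≤ α + u + w) (hw : w = b + r)
    (hwν : w ≤ ν) (hEu : u ≤ E) (hk : k ≤ g) (hD : D + u ≤ E + κ)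
    (hgain : 2 + 2 * α + g + E ≤ k + κ + 2 * b + r)
    (htour : 2 * (κ * (w + κ)) ≤ 2 * (κ * ν) + 2 * D + κ * (κ - 1)) : False := by
  obtain ⟨h, rfl⟩ := Nat.exists_eq_add_of_le hwν
  obtain ⟨e, rfl⟩ := Nat.exists_eq_add_of_le hEu
  have h1 : 2 + e + 3 * h ≤ κ := by omega
  obtain ⟨m, rfl⟩ : ∃ m, κ = m + 1 := ⟨κ - 1, by omega⟩
  rw [Nat.add_sub_cancel] at htour
  nlinarith [Nat.mul_le_mul_left (m + 1) h1, Nat.zero_le (m * h), Nat.zero_le (m * e)]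

lemma eq_of_lt_card {α u w r b κ E D ν k g t : ℕ} (hn : 3 * ν ≤ α + u + w) (hw : w = b + r)
    (hwν : w = ν + t) (ht : 1 ≤ t) (hν : 2 ≤ ν) (hEu : u ≤ E)
    (hk : (k : ℚ) ≤ g - b * (t / 2) - r * (t / (t + 1))) (hD : D + u ≤ E + κ)
    (hgain : 2 + 2 * α + g + E ≤ k + κ + 2 * b + r)
    (htour : 2 * (κ * (w + κ)) ≤ 2 * (κ * ν) + 2 * D + κ * (κ - 1)) :
    t = 2 ∧ ν = 2 ∧ α = 0 ∧ u = 2 ∧ b = 4 ∧ r = 0 ∧ E = 2 := by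
  obtain ⟨e, rfl⟩ := Nat.exists_eq_add_of_le hEu
  subst hwν
  have hκ : 2 * κ * t + κ * κ ≤ 2 * e + κ := by
    rcases Nat.eq_zero_or_pos κ with rfl | hpos
    · simp
    obtain ⟨m, rfl⟩ : ∃ m, κ = m + 1 := ⟨κ - 1, by omega⟩
    rw [Nat.add_sub_cancel] at htour
    nlinarith
  have hκe : κ ≤ e := by
    rcases Nat.eq_zero_or_pos κ with rfl | hpos
    · simp
    nlinarith
  have hkc : 2 * (t + 1) * k + b * t * (t + 1) + 2 * r * t ≤ 2 * (t + 1) * g := by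
    have h0 : (0 : ℚ) < t + 1 := by positivity
    have h1 : 2 * ((t : ℚ) + 1) * k ≤ 2 * (t + 1) * (g - b * (t / 2) - r * (t / (t + 1))) :=
      mul_le_mul_of_nonneg_left hk (by positivity)
    have h2 : 2 * ((t : ℚ) + 1) * (g - b * (t / 2) - r * (t / (t + 1)))
        = 2 * (t + 1) * g - b * t * (t + 1) - 2 * r * t := by
      field_simp
    rw [h2] at h1
    have h3 : 2 * ((t : ℚ) + 1) * k + b * t * (t + 1) + 2 * r * t ≤ 2 * (t + 1) * g := by linarith
    exact_mod_cast h3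
  have hk3 : 2 + 2 * α + g + u ≤ k + 2 * b + r := by omega
  have h3 : (2 * (t + 1)) * (2 + 2 * α + u) + b * t * (t + 1) + 2 * r * t ≤
      2 * (t + 1) * (2 * b + r) := by
    linarith [Nat.mul_le_mul_left (2 * (t + 1)) hk3]
  have h4 : (2 * (t + 1)) * (2 + α + r) + b * t * (t + 1) + 2 * r * t ≤
      2 * (t + 1) * (3 * t) := by
    have h5 : 2 * (b + r) ≤ α + u + 3 * t := by omega
    linarith [Nat.mul_le_mul_left (2 * (t + 1)) h5]
  rcases Nat.lt_or_ge t 4 with h | h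
  · interval_cases t
    · omega
    · have : κ = 0 := by
        by_contra h0
        have : 1 ≤ κ := by omega
        have h6 : r = 0 ∧ b = 4 ∧ α = 0 ∧ u = 2 := by omega
        have : 5 * κ ≤ 2 * e + κ := by nlinarith
        omega
      omega
    · omega
  · exfalso
    have h5 : b * (4 * (t + 1)) ≤ b * (t * (t + 1)) :=
      Nat.mul_le_mul_left _ (Nat.mul_le_mul_right _ h)
    have h6 : 2 * (t + 1) ≤ r := by nlinarith
    linarith [Nat.mul_le_mul_left (t + 1) h6, Nat.mul_le_mul_left t h6, Nat.zero_le (α * t),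
      Nat.zero_le (b * t * (t + 1)), Nat.zero_le (t * t)]

end Arithmetic

section Counting

/-- Given finite sets indexed by `S` and a further set `B`, there is a subfamily disjoint from `B`
and pairwise disjoint such that every other member costs at least one element of the union. -/
lemma exists_disjoint_subfamily {ι γ : Type*} [DecidableEq ι] [DecidableEq γ] (h : ι → Finset γ)
    (S : Finset ι) (B : Finset γ) :
    ∃ I ⊆ S, (∀ i ∈ I, Disjoint (h i) B) ∧
      (∀ i ∈ I, ∀ j ∈ I, i ≠ j → Disjoint (h i) (h j)) ∧
      (B ∪ S.biUnion h).card + S.card ≤ B.card + ∑ i ∈ S, (h i).card + I.card := by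
  induction S using Finset.induction_on generalizing B with
  | empty => exact ⟨∅, by simp⟩
  | insert q S hq ih =>
    obtain ⟨I, hIS, hIB, hII, hcard⟩ := ih (B ∪ h q)
    have hU : B ∪ (insert q S).biUnion h = B ∪ h q ∪ S.biUnion h := by
      rw [Finset.biUnion_insert, Finset.union_assoc]
    rw [hU, Finset.card_insert_of_notMem hq, Finset.sum_insert hq]
    by_cases hd : Disjoint (h q) B
    · refine ⟨insert q I, Finset.insert_subset_insert _ hIS, ?_, ?_, ?_⟩
      · intro i hi
        rcases Finset.mem_insert.1 hi with rfl | hi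
        · exact hd
        · exact (Finset.disjoint_union_right.1 (hIB i hi)).1
      · intro i hi j hj hij
        rcases Finset.mem_insert.1 hi with rfl | hiI <;> rcases Finset.mem_insert.1 hj with rfl | hjI
        · exact absurd rfl hij
        · exact (Finset.disjoint_union_right.1 (hIB j hjI)).2.symm
        · exact (Finset.disjoint_union_right.1 (hIB i hiI)).2
        · exact hII i hiI j hjI hij
      · rw [Finset.card_insert_of_notMem fun hqI => hq (hIS hqI)]
        have := Finset.card_union_le B (h q)
        omega
    · refine ⟨I, hIS.trans (Finset.subset_insert _ _), ?_, hII, ?_⟩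
      · exact fun i hi => (Finset.disjoint_union_right.1 (hIB i hi)).1
      · have h1 := Finset.card_union_add_card_inter B (h q)
        have h2 : 0 < (B ∩ h q).card := by
          rw [Finset.card_pos, Finset.nonempty_iff_ne_empty]
          intro h0
          exact hd (Finset.disjoint_iff_inter_eq_empty.2 h0).symm
        omega

/-- An asymmetric relation on `k` elements has at most `k(k-1)/2` pairs. -/
lemma two_mul_sum_card_filter_le {ι : Type*} [DecidableEq ι] (I : Finset ι) (r : ι → ι → Prop)
    [∀ i j, Decidable (r i j)] (hr : ∀ i ∈ I, ∀ j ∈ I, r i j → ¬ r j i) :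
    2 * ∑ i ∈ I, (I.filter (r i)).card ≤ I.card * (I.card - 1) := by
  have hswap : ∑ i ∈ I, (I.filter (r i)).card = ∑ i ∈ I, (I.filter fun j => r j i).card :=
    Finset.sum_card_bipartiteAbove_eq_sum_card_bipartiteBelow r
  rw [two_mul]
  nth_rewrite 2 [hswap]
  rw [← Finset.sum_add_distrib, ← smul_eq_mul]
  refine Finset.sum_le_card_nsmul _ _ _ fun i hi => ?_
  rw [← Finset.card_union_of_disjoint, ← Finset.card_erase_of_mem hi]
  · refine Finset.card_le_card fun j hj => ?_
    simp only [Finset.mem_union, Finset.mem_filter] at hj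
    refine Finset.mem_erase.2 ⟨?_, by tauto⟩
    rintro rfl
    have := hr j hi j hi
    tauto
  · rw [Finset.disjoint_filter]
    exact fun j hj => hr i hi j hj

/-- If every element of `K` receives total weight at least one, and `k` receives at least `t`,
then `K` has at most as many elements as the total weight, with a gain of `t - 1`. -/
lemma card_add_le_sum_weight {ι γ : Type*} [DecidableEq γ] (P : Finset ι) (f : ι → γ) (w : ι → ℚ)
    (hw : ∀ i ∈ P, 0 ≤ w i) (K : Finset γ) (hK : ∀ k ∈ K, 1 ≤ ∑ i ∈ P with f i = k, w i)
    (k : γ) (hk : k ∈ K) (t : ℚ) (ht : t ≤ ∑ i ∈ P with f i = k, w i) :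
    (K.card : ℚ) + (t - 1) ≤ ∑ i ∈ P, w i := by
  have h1 : ∑ k ∈ K, ∑ i ∈ P with f i = k, w i ≤ ∑ i ∈ P, w i := by
    rw [Finset.sum_fiberwise_eq_sum_filter]
    exact Finset.sum_le_sum_of_subset_of_nonneg (Finset.filter_subset _ _) fun i hi _ => hw i hi
  have h2 : (((K.erase k).card : ℕ) : ℚ) ≤ ∑ k ∈ K.erase k, ∑ i ∈ P with f i = k, w i := by
    simpa using Finset.card_nsmul_le_sum (K.erase k) _ 1 fun j hj => hK j (Finset.mem_of_mem_erase hj)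
  rw [← Finset.add_sum_erase _ _ hk] at h1
  have h3 : ((K.erase k).card : ℚ) + 1 = K.card := by
    exact_mod_cast Finset.card_erase_add_one hk
  linarith

end Counting

section LiveSystem

variable {V γ : Type*}

open Classical in
/-- The colours on the edges from `v` to `W`. -/
noncomputable def coloursTo (G : SimpleGraph V) (c : V → V → ℕ) (W : Finset V) (v : V) :
    Finset ℕ :=
  (W.filter (G.Adj v)).image (c v)

lemma mem_coloursTo {G : SimpleGraph V} {c : V → V → ℕ} {W : Finset V} {v : V} {a : ℕ} :
    a ∈ coloursTo G c W v ↔ ∃ u ∈ W, G.Adj v u ∧ c v u = a := by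
  simp [coloursTo, and_assoc]

lemma le_card_coloursTo [Fintype V] {G : SimpleGraph V} {c : V → V → ℕ} {W : Finset V} {ν : ℕ}
    (hν : ∀ v, Fintype.card V ≤ (coloursTo G c Finset.univ v).card + ν) (v : V) :
    W.card ≤ (coloursTo G c W v).card + ν := by
  classical
  have hsub : coloursTo G c Finset.univ v ⊆ coloursTo G c W v ∪ Wᶜ.image (c v) := by
    intro a ha
    obtain ⟨p, -, hadj, rfl⟩ := mem_coloursTo.1 ha
    by_cases hp : p ∈ W
    · exact Finset.mem_union_left _ (mem_coloursTo.2 ⟨p, hp, hadj, rfl⟩)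
    · exact Finset.mem_union_right _ (Finset.mem_image_of_mem _ (Finset.mem_compl.2 hp))
  have h1 := (Finset.card_le_card hsub).trans (Finset.card_union_le _ _)
  have h2 := Finset.card_image_le (f := c v) (s := Wᶜ)
  have h3 := Finset.card_compl_add_card W
  have h4 := hν v
  omega

/-- Live colours at every vertex of an edge-coloured graph, with a labelling of the pairs
(vertex, live colour) that agrees at the two ends of an edge whose colour is live at both, and is
constant at each vertex that is not loose. -/
structure LiveSystem [Fintype V] (G : SimpleGraph V) (c : V → V → ℕ) (γ : Type*) where
  live : V → Finset ℕ
  loose : V → Prop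
  comp : V → ℕ → γ
  live_subset : ∀ v, live v ⊆ coloursTo G c Finset.univ v
  comp_eq : ∀ u v, G.Adj u v → c u v ∈ live u → c u v ∈ live v → comp u (c u v) = comp v (c u v)
  comp_const : ∀ v, ¬ loose v → ∀ a ∈ live v, ∀ b ∈ live v, comp v a = comp v b

namespace LiveSystem

variable [Fintype V] {G : SimpleGraph V} {c : V → V → ℕ} (s : LiveSystem G c γ)

open Classical in
/-- Live colours that suffice to realise all labels at `v`: all of them if `v` is loose, the least
one otherwise. -/
noncomputable def units (v : V) : Finset ℕ :=
  if s.loose v then s.live v else (s.live v).filter fun a => ∀ b ∈ s.live v, a ≤ b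

/-- The labels at `v`. -/
noncomputable def labels [DecidableEq γ] (v : V) : Finset γ := (s.live v).image (s.comp v)

lemma units_of_loose {v : V} (h : s.loose v) : s.units v = s.live v := by simp [units, h]

lemma exists_units_eq_singleton {v : V} (h : ¬ s.loose v) (hne : (s.live v).Nonempty) :
    ∃ a ∈ s.live v, s.units v = {a} := by
  refine ⟨(s.live v).min' hne, Finset.min'_mem _ _, ?_⟩
  ext b
  simp only [units, h, if_false, Finset.mem_filter, Finset.mem_singleton]
  constructor
  · rintro ⟨hb, hle⟩
    exact le_antisymm (hle _ (Finset.min'_mem _ _)) (Finset.min'_le _ _ hb)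
  · rintro rfl
    exact ⟨Finset.min'_mem _ _, fun b hb => Finset.min'_le _ _ hb⟩

lemma exists_mem_units {v : V} {a : ℕ} (ha : a ∈ s.live v) :
    ∃ b ∈ s.units v, s.comp v b = s.comp v a ∧ (s.loose v → b = a) := by
  by_cases h : s.loose v
  · exact ⟨a, by rwa [s.units_of_loose h], rfl, fun _ => rfl⟩
  · obtain ⟨b, hb, hu⟩ := s.exists_units_eq_singleton h ⟨a, ha⟩
    exact ⟨b, by simp [hu], s.comp_const v h b hb a ha, fun h' => absurd h' h⟩

lemma units_subset (v : V) : s.units v ⊆ s.live v := by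
  unfold units
  split_ifs
  · exact subset_rfl
  · exact Finset.filter_subset _ _

lemma labels_eq_image_units [DecidableEq γ] (v : V) : s.labels v = (s.units v).image (s.comp v) := by
  refine subset_antisymm (fun k hk => ?_) (Finset.image_subset_image (s.units_subset v))
  obtain ⟨a, ha, rfl⟩ := Finset.mem_image.1 hk
  obtain ⟨b, hb, hab, -⟩ := s.exists_mem_units ha
  exact Finset.mem_image.2 ⟨b, hb, hab⟩

lemma card_labels_le [DecidableEq γ] (v : V) : (s.labels v).card ≤ (s.units v).card := by
  rw [labels_eq_image_units]
  exact Finset.card_image_le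

open Classical in
/-- The weight of the pair `p` when the labels are counted over `W`. -/
noncomputable def weight (W : Finset V) (t : ℕ) (p : Σ _ : V, ℕ) : ℚ :=
  if s.loose p.1 then if p.2 ∈ coloursTo G c W p.1 then 1 / 2 else 1 else 1 / (t + 1)

lemma weight_nonneg (W : Finset V) (t : ℕ) (p : Σ _ : V, ℕ) : 0 ≤ s.weight W t p := by
  unfold weight
  split_ifs <;> positivity

lemma inv_le_weight (W : Finset V) {t : ℕ} (ht : 1 ≤ t) (p : Σ _ : V, ℕ) :
    1 / ((t : ℚ) + 1) ≤ s.weight W t p := by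
  have h1 : (1 : ℚ) ≤ t := by exact_mod_cast ht
  have h2 : 1 / ((t : ℚ) + 1) ≤ 1 / 2 := one_div_le_one_div_of_le (by norm_num) (by linarith)
  unfold weight
  split_ifs <;> linarith

/-- The total weight of the units at vertices of `W` with a given label. -/
noncomputable def fiberWeight [DecidableEq γ] (W : Finset V) (t : ℕ) (k : γ) : ℚ :=
  ∑ p ∈ W.sigma s.units with s.comp p.1 p.2 = k, s.weight W t p

lemma sum_weight_le_fiberWeight [DecidableEq γ] (W : Finset V) (t : ℕ) (k : γ) (Q : Finset (Σ _ : V, ℕ))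
    (hQ : ∀ p ∈ Q, p.1 ∈ W ∧ p.2 ∈ s.units p.1 ∧ s.comp p.1 p.2 = k) :
    ∑ p ∈ Q, s.weight W t p ≤ s.fiberWeight W t k := by
  refine Finset.sum_le_sum_of_subset_of_nonneg (fun p hp => ?_) fun p _ _ => s.weight_nonneg W t p
  obtain ⟨h1, h2, h3⟩ := hQ p hp
  simp [h1, h2, h3]

lemma one_le_fiberWeight_of_not_loose [DecidableEq γ] {W : Finset V} {t : ℕ} (ht : 1 ≤ t)
    (hW : ∀ v ∈ W, s.live v = coloursTo G c Finset.univ v)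
    (hc : ∀ u v, c u v = c v u)
    (hto : ∀ v ∈ W, t ≤ (coloursTo G c W v).card) {v : V} (hv : v ∈ W) (hl : ¬ s.loose v)
    {a : ℕ} (ha : a ∈ s.live v) : 1 ≤ s.fiberWeight W t (s.comp v a) := by
  classical
  set N := insert v (W.filter (G.Adj v)) with hN
  have hex : ∀ u ∈ N, ∃ b ∈ s.units u, s.comp u b = s.comp v a := by
    intro u hu
    rcases Finset.mem_insert.1 hu with rfl | hu
    · obtain ⟨b, hb, h, -⟩ := s.exists_mem_units ha
      exact ⟨b, hb, h⟩
    · obtain ⟨huW, hadj⟩ := Finset.mem_filter.1 hu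
      have h1 : c v u ∈ s.live v := by
        rw [hW v hv]
        exact mem_coloursTo.2 ⟨u, Finset.mem_univ _, hadj, rfl⟩
      have h2 : c v u ∈ s.live u := by
        rw [hW u huW]
        exact mem_coloursTo.2 ⟨v, Finset.mem_univ _, hadj.symm, hc _ _⟩
      obtain ⟨b, hb, h, -⟩ := s.exists_mem_units h2
      exact ⟨b, hb, by rw [h, ← s.comp_eq v u hadj h1 h2, s.comp_const v hl _ h1 _ ha]⟩
  choose! b hb hbk using hex
  have hcard : t + 1 ≤ N.card := by
    rw [hN, Finset.card_insert_of_notMem (by simp)]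
    have := (hto v hv).trans Finset.card_image_le
    omega
  have hinj : Set.InjOn (fun u => (⟨u, b u⟩ : Σ _ : V, ℕ)) N := fun u _ u' _ h => by
    simpa using congrArg Sigma.fst h
  have h := s.sum_weight_le_fiberWeight W t (s.comp v a) (N.image fun u => ⟨u, b u⟩) (by
    simp only [Finset.mem_image]
    rintro _ ⟨u, hu, rfl⟩
    refine ⟨?_, hb u hu, hbk u hu⟩
    rcases Finset.mem_insert.1 hu with rfl | hu
    · exact hv
    · exact (Finset.mem_filter.1 hu).1)
  rw [Finset.sum_image hinj] at h
  refine le_trans ?_ h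
  have h2 := Finset.card_nsmul_le_sum N (fun u => s.weight W t ⟨u, b u⟩) (1 / ((t : ℚ) + 1))
    fun u _ => s.inv_le_weight W ht _
  refine le_trans ?_ h2
  rw [nsmul_eq_mul, mul_one_div, le_div_iff₀ (by positivity), one_mul]
  exact_mod_cast hcard

lemma one_le_fiberWeight [DecidableEq γ] {W : Finset V} {t : ℕ} (ht : 1 ≤ t)
    (hW : ∀ v ∈ W, s.live v = coloursTo G c Finset.univ v)
    (hc : ∀ u v, c u v = c v u)
    (hto : ∀ v ∈ W, t ≤ (coloursTo G c W v).card) {v : V} (hv : v ∈ W)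
    {a : ℕ} (ha : a ∈ s.live v) : 1 ≤ s.fiberWeight W t (s.comp v a) := by
  classical
  by_cases hl : s.loose v
  swap
  · exact s.one_le_fiberWeight_of_not_loose ht hW hc hto hv hl ha
  have hau : a ∈ s.units v := by rwa [s.units_of_loose hl]
  by_cases hin : a ∈ coloursTo G c W v
  swap
  · refine le_trans ?_ (s.sum_weight_le_fiberWeight W t _ {⟨v, a⟩} (by simp [hv, hau]))
    simp [weight, hl, hin]
  obtain ⟨u, hu, hadj, rfl⟩ := mem_coloursTo.1 hin
  have ha' : c v u ∈ s.live u := by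
    rw [hW u hu]
    exact mem_coloursTo.2 ⟨v, Finset.mem_univ _, hadj.symm, hc _ _⟩
  rw [s.comp_eq v u hadj ha ha']
  by_cases hl' : s.loose u
  swap
  · exact s.one_le_fiberWeight_of_not_loose ht hW hc hto hu hl' ha'
  have hau' : c v u ∈ s.units u := by rwa [s.units_of_loose hl']
  refine le_trans ?_ (s.sum_weight_le_fiberWeight W t _ {⟨v, c v u⟩, ⟨u, c v u⟩} ?_)
  · have hin' : c v u ∈ coloursTo G c W u := mem_coloursTo.2 ⟨v, hv, hadj.symm, hc _ _⟩
    rw [Finset.sum_pair (by simpa using fun h => absurd h hadj.ne)]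
    simp only [weight, hl, hl', hin, hin', if_true]
    norm_num
  · simp only [Finset.mem_insert, Finset.mem_singleton]
    rintro _ (rfl | rfl)
    · exact ⟨hv, hau, s.comp_eq v u hadj ha ha'⟩
    · exact ⟨hu, hau', rfl⟩

open Classical in
lemma sum_weight_le {W : Finset V} {t : ℕ}
    (hW : ∀ v ∈ W, s.live v = coloursTo G c Finset.univ v)
    (hne : ∀ v ∈ W, (s.live v).Nonempty)
    (hto : ∀ v ∈ W, t ≤ (coloursTo G c W v).card) :
    ∑ p ∈ W.sigma s.units, s.weight W t p ≤ ∑ v ∈ W, ((s.units v).card : ℚ)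
      - (W.filter s.loose).card * (t / 2) - (W.filter fun v => ¬ s.loose v).card * (t / (t + 1)) := by
  have h : ∀ v ∈ W, ∑ a ∈ s.units v, s.weight W t ⟨v, a⟩ ≤ ((s.units v).card : ℚ)
      - (if s.loose v then (t : ℚ) / 2 else t / (t + 1)) := by
    intro v hv
    by_cases hl : s.loose v
    · have hsub : coloursTo G c W v ⊆ s.units v := by
        rw [s.units_of_loose hl, hW v hv]
        exact Finset.image_subset_image (Finset.filter_subset_filter _ (Finset.subset_univ _))
      have h1 : ∑ a ∈ s.units v, s.weight W t ⟨v, a⟩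
          = ∑ a ∈ s.units v, ((1 : ℚ) - if a ∈ coloursTo G c W v then 1 / 2 else 0) := by
        refine Finset.sum_congr rfl fun a _ => ?_
        simp only [weight, hl, if_true]
        split_ifs <;> norm_num
      rw [h1, Finset.sum_sub_distrib, ← Finset.sum_filter, Finset.filter_mem_eq_inter,
        Finset.inter_eq_right.2 hsub]
      have h2 : (t : ℚ) ≤ (coloursTo G c W v).card := by exact_mod_cast hto v hv
      simp only [hl, if_true, Finset.sum_const, nsmul_eq_mul]
      linarith
    · obtain ⟨a, -, ha⟩ := s.exists_units_eq_singleton hl (hne v hv)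
      have : (0 : ℚ) < t + 1 := by positivity
      simp only [ha, hl, weight, Finset.sum_singleton, if_false, Finset.card_singleton]
      apply le_of_eq
      field_simp
      push_cast
      ring
  rw [Finset.sum_sigma]
  refine (Finset.sum_le_sum h).trans (le_of_eq ?_)
  rw [Finset.sum_sub_distrib, Finset.sum_ite]
  simp only [Finset.sum_const, nsmul_eq_mul]
  ring

open Classical in
/-- Counting labels over a set of vertices at which all colours are live. -/
lemma card_biUnion_labels_add_le [DecidableEq γ] {W : Finset V} {t : ℕ} (ht : 1 ≤ t)
    (hW : ∀ v ∈ W, s.live v = coloursTo G c Finset.univ v)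
    (hne : ∀ v ∈ W, (s.live v).Nonempty)
    (hc : ∀ u v, c u v = c v u)
    (hto : ∀ v ∈ W, t ≤ (coloursTo G c W v).card) (k : γ) (hk : k ∈ W.biUnion s.labels) (x : ℚ)
    (hx : x ≤ s.fiberWeight W t k) :
    ((W.biUnion s.labels).card : ℚ) + (x - 1) ≤ ∑ v ∈ W, ((s.units v).card : ℚ)
      - (W.filter s.loose).card * (t / 2)
      - (W.filter fun v => ¬ s.loose v).card * (t / (t + 1)) := by
  have hK : ∀ j ∈ W.biUnion s.labels, 1 ≤ s.fiberWeight W t j := by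
    intro j hj
    obtain ⟨v, hv, hj⟩ := Finset.mem_biUnion.1 hj
    obtain ⟨a, ha, rfl⟩ := Finset.mem_image.1 hj
    exact s.one_le_fiberWeight ht hW hc hto hv ha
  exact (card_add_le_sum_weight (W.sigma s.units) (fun p => s.comp p.1 p.2) (s.weight W t)
    (fun p _ => s.weight_nonneg W t p) (W.biUnion s.labels) hK k hk x hx).trans
    (s.sum_weight_le hW hne hto)

/-- The colours at `v` that are not live. -/
noncomputable def dead (v : V) : Finset ℕ := coloursTo G c Finset.univ v \ s.live v

lemma card_dead_add (v : V) :
    (s.dead v).card + (s.live v).card = (coloursTo G c Finset.univ v).card :=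
  Finset.card_sdiff_add_card_eq_card (s.live_subset v)

/-- Vertices outside `W` with pairwise disjoint label sets, disjoint from those of `W`, send
few live edges to each other. -/
lemma two_mul_card_mul_le [DecidableEq γ] {W I : Finset V} {ν : ℕ} (hc : ∀ u v, c u v = c v u)
    (hW : ∀ v ∈ W, s.live v = coloursTo G c Finset.univ v)
    (hν : ∀ v, Fintype.card V ≤ (coloursTo G c Finset.univ v).card + ν)
    (hWI : Disjoint W I)
    (hIW : ∀ q ∈ I, Disjoint (s.labels q) (W.biUnion s.labels))
    (hII : ∀ p ∈ I, ∀ q ∈ I, p ≠ q → Disjoint (s.labels p) (s.labels q)) :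
    2 * (I.card * (W.card + I.card)) ≤
      2 * (I.card * ν) + 2 * ∑ q ∈ I, (s.dead q).card + I.card * (I.card - 1) := by
  classical
  have hdisj : ∀ p q, G.Adj p q → c p q ∈ s.live p → c p q ∈ s.live q →
      ¬ Disjoint (s.labels p) (s.labels q) := by
    intro p q hadj hp hq hd
    refine Finset.disjoint_left.1 hd (Finset.mem_image_of_mem _ hp) ?_
    rw [s.comp_eq p q hadj hp hq]
    exact Finset.mem_image_of_mem _ hq
  let r : V → V → Prop := fun q p => G.Adj q p ∧ c q p ∈ s.live q
  have hr := two_mul_sum_card_filter_le I r fun p hp q hq hpq hqp =>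
    hdisj p q hpq.1 hpq.2 (hc q p ▸ hqp.2) (hII p hp q hq hpq.1.ne)
  have hq : ∀ q ∈ I, W.card + I.card ≤ ν + (s.dead q).card + (I.filter (r q)).card := by
    intro q hq
    have hsub : s.live q ⊆ ((W ∪ I)ᶜ ∪ I.filter (r q)).image (c q) := by
      intro a ha
      obtain ⟨p, -, hadj, rfl⟩ := mem_coloursTo.1 (s.live_subset q ha)
      refine Finset.mem_image_of_mem _ ?_
      rw [Finset.mem_union, Finset.mem_compl, Finset.mem_union, Finset.mem_filter]
      have hpW : p ∉ W := by
        intro hpW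
        refine hdisj q p hadj ha ?_ ((hIW q hq).mono_right (Finset.subset_biUnion_of_mem _ hpW))
        rw [hW p hpW]
        exact mem_coloursTo.2 ⟨q, Finset.mem_univ _, hadj.symm, hc _ _⟩
      by_cases hpI : p ∈ I
      · exact Or.inr ⟨hpI, hadj, ha⟩
      · exact Or.inl (by tauto)
    have h1 := (Finset.card_le_card hsub).trans (Finset.card_image_le.trans (Finset.card_union_le _ _))
    have h2 := Finset.card_compl_add_card (W ∪ I)
    rw [Finset.card_union_of_disjoint hWI] at h2
    have h3 := s.card_dead_add q
    have h4 := hν q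
    omega
  have hsum := Finset.sum_le_sum hq
  simp only [Finset.sum_add_distrib, Finset.sum_const, smul_eq_mul] at hsum
  rw [← mul_add] at hsum
  omega

lemma half_le_weight (W : Finset V) (t : ℕ) {p : Σ _ : V, ℕ} (hp : s.loose p.1) :
    1 / 2 ≤ s.weight W t p := by
  unfold weight
  split_ifs <;> norm_num

/-- If at most one neighbour of `y` lies outside `W` and `y` has three live colours, then two of
them appear on edges to `W`. -/
lemma exists_two_live_colours_to [DecidableEq V] {W : Finset V} {y : V} (hy : y ∉ W) (hcard : Wᶜ.card ≤ 2)
    (hlive : 3 ≤ (s.live y).card) :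
    ∃ a ∈ s.live y, ∃ b ∈ s.live y, a ≠ b ∧ a ∈ coloursTo G c W y ∧ b ∈ coloursTo G c W y := by
  have hsub : s.live y ⊆ s.live y ∩ coloursTo G c W y ∪ (Wᶜ.erase y).image (c y) := by
    intro a ha
    obtain ⟨p, -, hadj, rfl⟩ := mem_coloursTo.1 (s.live_subset y ha)
    by_cases hp : p ∈ W
    · exact Finset.mem_union_left _ (Finset.mem_inter.2 ⟨ha, mem_coloursTo.2 ⟨p, hp, hadj, rfl⟩⟩)
    · refine Finset.mem_union_right _ (Finset.mem_image_of_mem _ ?_)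
      exact Finset.mem_erase.2 ⟨hadj.ne', Finset.mem_compl.2 hp⟩
  have h1 := (Finset.card_le_card hsub).trans (Finset.card_union_le _ _)
  have h2 := Finset.card_image_le (f := c y) (s := Wᶜ.erase y)
  rw [Finset.card_erase_of_mem (Finset.mem_compl.2 hy)] at h2
  obtain ⟨a, ha, b, hb, hab⟩ := Finset.one_lt_card.1
    (show 1 < (s.live y ∩ coloursTo G c W y).card by omega)
  rw [Finset.mem_inter] at ha hb
  exact ⟨a, ha.1, b, hb.1, hab, ha.2, hb.2⟩

lemma exists_unit_of_mem_coloursTo {W : Finset V} (hc : ∀ u v, c u v = c v u)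
    (hW : ∀ v ∈ W, s.live v = coloursTo G c Finset.univ v) {y : V} {a : ℕ} (ha : a ∈ s.live y)
    (haW : a ∈ coloursTo G c W y) :
    ∃ v ∈ W, a ∈ s.live v ∧ s.comp v a = s.comp y a := by
  obtain ⟨v, hv, hadj, rfl⟩ := mem_coloursTo.1 haW
  have hav : c y v ∈ s.live v := by
    rw [hW v hv]
    exact mem_coloursTo.2 ⟨y, Finset.mem_univ _, hadj.symm, hc _ _⟩
  exact ⟨v, hv, hav, (s.comp_eq y v hadj ha hav).symm⟩

lemma three_halves_le_fiberWeight [DecidableEq γ] {W : Finset V} (t : ℕ)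
    (hc : ∀ u v, c u v = c v u) (hW : ∀ v ∈ W, s.live v = coloursTo G c Finset.univ v)
    (hl : ∀ v ∈ W, s.loose v) {v w : V} (hv : v ∈ W) (hw : w ∈ W) {a b : ℕ} (ha : a ∈ s.live v)
    (hb : b ∈ s.live w) (hab : a ≠ b) (h : s.comp v a = s.comp w b) :
    3 / 2 ≤ s.fiberWeight W t (s.comp v a) := by
  classical
  have hau : a ∈ s.units v := by rwa [s.units_of_loose (hl v hv)]
  have hbu : b ∈ s.units w := by rwa [s.units_of_loose (hl w hw)]
  have hwb := s.half_le_weight W t (p := ⟨w, b⟩) (hl w hw)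
  by_cases hin : a ∈ coloursTo G c W v
  · obtain ⟨u, hu, hadj, hua⟩ := mem_coloursTo.1 hin
    subst hua
    have hau' : c v u ∈ s.live u := by
      rw [hW u hu]
      exact mem_coloursTo.2 ⟨v, Finset.mem_univ _, hadj.symm, hc _ _⟩
    have hau'' : c v u ∈ s.units u := by rwa [s.units_of_loose (hl u hu)]
    refine le_trans ?_ (s.sum_weight_le_fiberWeight W t _ {⟨v, c v u⟩, ⟨u, c v u⟩, ⟨w, b⟩} ?_)
    · rw [Finset.sum_insert, Finset.sum_pair]
      · have h1 := s.half_le_weight W t (p := ⟨v, c v u⟩) (hl v hv)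
        have h2 := s.half_le_weight W t (p := ⟨u, c v u⟩) (hl u hu)
        linarith
      · simp [hab]
      · simp [hab, hadj.ne]
    · simp only [Finset.mem_insert, Finset.mem_singleton]
      rintro _ (rfl | rfl | rfl)
      · exact ⟨hv, hau, rfl⟩
      · exact ⟨hu, hau'', (s.comp_eq v u hadj ha hau').symm⟩
      · exact ⟨hw, hbu, h.symm⟩
  · refine le_trans ?_ (s.sum_weight_le_fiberWeight W t _ {⟨v, a⟩, ⟨w, b⟩} ?_)
    · rw [Finset.sum_pair (by simp [hab])]
      have h1 : s.weight W t ⟨v, a⟩ = 1 := by simp [weight, hl v hv, hin]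
      linarith
    · simp only [Finset.mem_insert, Finset.mem_singleton]
      rintro _ (rfl | rfl)
      · exact ⟨hv, hau, rfl⟩
      · exact ⟨hw, hbu, h.symm⟩

lemma card_biUnion_union_labels_add_six_le [DecidableEq V] [DecidableEq γ] {W : Finset V}
    (hc : ∀ u v, c u v = c v u) (hW : ∀ v ∈ W, s.live v = coloursTo G c Finset.univ v)
    (hne : ∀ v ∈ W, (s.live v).Nonempty) (hl : ∀ v ∈ W, s.loose v)
    (hto : ∀ v ∈ W, 2 ≤ (coloursTo G c W v).card) (hWcard : W.card = 4)
    {y : V} (hy : y ∉ W) (hcompl : Wᶜ.card ≤ 2) (hlive : 3 ≤ (s.live y).card) :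
    (W.biUnion s.labels ∪ s.labels y).card + 6 ≤
      ∑ v ∈ W, (s.units v).card + (s.units y).card := by
  obtain ⟨a, ha, b, hb, hab, haW, hbW⟩ := s.exists_two_live_colours_to hy hcompl hlive
  obtain ⟨v, hv, hav, hva⟩ := s.exists_unit_of_mem_coloursTo hc hW ha haW
  obtain ⟨w, hw, hbw, hwb⟩ := s.exists_unit_of_mem_coloursTo hc hW hb hbW
  have hka : s.comp y a ∈ W.biUnion s.labels :=
    Finset.mem_biUnion.2 ⟨v, hv, hva ▸ Finset.mem_image_of_mem _ hav⟩
  have hkb : s.comp y b ∈ W.biUnion s.labels :=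
    Finset.mem_biUnion.2 ⟨w, hw, hwb ▸ Finset.mem_image_of_mem _ hbw⟩
  have hbound := s.card_biUnion_labels_add_le one_le_two hW hne hc hto _ hka
  have hl' : ∀ v ∈ W, ¬ ¬ s.loose v := fun v hv => not_not_intro (hl v hv)
  classical
  rw [Finset.filter_true_of_mem hl, Finset.filter_false_of_mem hl', hWcard] at hbound
  by_cases hly : s.loose y
  · have h1 := hbound 1 (hva ▸ s.one_le_fiberWeight one_le_two hW hc hto hv hav)
    have h2 : (W.biUnion s.labels).card + 4 ≤ ∑ v ∈ W, (s.units v).card := by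
      norm_num at h1
      have : ((W.biUnion s.labels).card : ℚ) + 4 ≤ ∑ v ∈ W, ((s.units v).card : ℚ) := by linarith
      exact_mod_cast this
    have hsub : W.biUnion s.labels ∪ s.labels y ⊆
        W.biUnion s.labels ∪ (((s.live y).erase a).erase b).image (s.comp y) := by
      refine Finset.union_subset Finset.subset_union_left fun k hk => ?_
      obtain ⟨d, hd, rfl⟩ := Finset.mem_image.1 hk
      by_cases hda : d = a
      · exact Finset.mem_union_left _ (hda ▸ hka)
      by_cases hdb : d = b
      · exact Finset.mem_union_left _ (hdb ▸ hkb)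
      exact Finset.mem_union_right _ (Finset.mem_image_of_mem _ (by simp [hda, hdb, hd]))
    have h3 := (Finset.card_le_card hsub).trans (Finset.card_union_le _ _)
    have h4 := Finset.card_image_le (f := s.comp y) (s := ((s.live y).erase a).erase b)
    rw [Finset.card_erase_of_mem (Finset.mem_erase.2 ⟨hab.symm, hb⟩),
      Finset.card_erase_of_mem ha] at h4
    rw [s.units_of_loose hly]
    omega
  · have hwt := s.three_halves_le_fiberWeight 2 hc hW hl hv hw hav hbw hab
      (by rw [hva, hwb, s.comp_const y hly a ha b hb])
    have h1 := hbound (3 / 2) (hva ▸ hwt)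
    have h2 : (W.biUnion s.labels).card + 5 ≤ ∑ v ∈ W, (s.units v).card := by
      norm_num at h1
      have : ((W.biUnion s.labels).card : ℚ) + 4 < ∑ v ∈ W, ((s.units v).card : ℚ) := by linarith
      have : (W.biUnion s.labels).card + 4 < ∑ v ∈ W, (s.units v).card := by exact_mod_cast this
      omega
    have hsub : s.labels y ⊆ W.biUnion s.labels := by
      intro k hk
      obtain ⟨d, hd, rfl⟩ := Finset.mem_image.1 hk
      rwa [s.comp_const y hly d hd a ha]
    obtain ⟨d, -, hd⟩ := s.exists_units_eq_singleton hly ⟨a, ha⟩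
    rw [Finset.union_eq_left.2 hsub, hd, Finset.card_singleton]
    omega

lemma card_biUnion_labels_add_seven_le [DecidableEq γ] {W U : Finset V}
    (hc : ∀ u v, c u v = c v u) (hW : ∀ v ∈ W, s.live v = coloursTo G c Finset.univ v)
    (hne : ∀ v ∈ W, (s.live v).Nonempty) (hl : ∀ v ∈ W, s.loose v)
    (hto : ∀ v ∈ W, 2 ≤ (coloursTo G c W v).card) (hWcard : W.card = 4)
    (hWU : ∀ v, v ∉ W ↔ v ∈ U) (hU : U.card = 2) (hlive : ∀ y ∈ U, 3 ≤ (s.live y).card) :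
    (W.biUnion s.labels ∪ U.biUnion s.labels).card + 7 ≤
      ∑ v ∈ W, (s.units v).card + ∑ v ∈ U, (s.units v).card := by
  classical
  have hcompl : Wᶜ.card ≤ 2 := by
    rw [← hU]
    exact Finset.card_le_card fun v hv => (hWU v).1 (Finset.mem_compl.1 hv)
  obtain ⟨y, z, hyz, rfl⟩ := Finset.card_eq_two.1 hU
  have h1 := s.card_biUnion_union_labels_add_six_le hc hW hne hl hto hWcard
    ((hWU y).2 (by simp)) hcompl (hlive y (by simp))
  obtain ⟨a, ha, -, -, -, haW, -⟩ :=
    s.exists_two_live_colours_to ((hWU z).2 (by simp)) hcompl (hlive z (by simp))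
  obtain ⟨v, hv, hav, hva⟩ := s.exists_unit_of_mem_coloursTo hc hW ha haW
  have hk : s.comp z a ∈ (W.biUnion s.labels ∪ s.labels y) ∩ s.labels z := by
    refine Finset.mem_inter.2 ⟨Finset.mem_union_left _ ?_, Finset.mem_image_of_mem _ ha⟩
    exact Finset.mem_biUnion.2 ⟨v, hv, hva ▸ Finset.mem_image_of_mem _ hav⟩
  have h2 := Finset.card_pos.2 ⟨_, hk⟩
  have h3 := Finset.card_union_add_card_inter (W.biUnion s.labels ∪ s.labels y) (s.labels z)
  have h4 := s.card_labels_le z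
  rw [Finset.sum_pair hyz, Finset.biUnion_insert, Finset.singleton_biUnion, ← Finset.union_assoc]
  omega

open Classical in
/-- The number of forbidden vertices that the gadget at `v` has to contain, less the number of
isolated dummies it can produce. -/
noncomputable def cost (v : V) : ℕ :=
  if s.live v = ∅ then 2
  else (if s.loose v then (coloursTo G c Finset.univ v).card - 2 else 0) + (s.dead v).card

theorem card_biUnion_labels_le [DecidableEq γ] (hc : ∀ u v, c u v = c v u) {ν : ℕ} (h2 : 2 ≤ ν)
    (h3 : 3 * ν ≤ Fintype.card V)
    (hν : ∀ v, Fintype.card V ≤ (coloursTo G c Finset.univ v).card + ν) :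
    (Finset.univ.biUnion s.labels).card ≤ 1 + ∑ v, s.cost v := by
  classical
  by_contra! hK
  set A : Finset V := Finset.univ.filter fun v => s.live v = ∅ with hA
  set W : Finset V := Finset.univ.filter fun v => s.live v ≠ ∅ ∧ s.dead v = ∅ with hWdef
  set U : Finset V := Finset.univ.filter fun v => s.live v ≠ ∅ ∧ s.dead v ≠ ∅ with hUdef
  have hmA : ∀ v, v ∈ A ↔ s.live v = ∅ := by simp [hA]
  have hmW : ∀ v, v ∈ W ↔ s.live v ≠ ∅ ∧ s.dead v = ∅ := by simp [hWdef]
  have hmU : ∀ v, v ∈ U ↔ s.live v ≠ ∅ ∧ s.dead v ≠ ∅ := by simp [hUdef]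
  have hdWU : Disjoint W U := Finset.disjoint_left.2 fun v hw hu => ((hmU v).1 hu).2 ((hmW v).1 hw).2
  have hdA : Disjoint A (W ∪ U) := by
    refine Finset.disjoint_left.2 fun v ha hv => ?_
    rw [Finset.mem_union, hmW, hmU] at hv
    have := (hmA v).1 ha
    tauto
  have huniv : (Finset.univ : Finset V) = A ∪ (W ∪ U) := by
    ext v
    simp only [Finset.mem_univ, Finset.mem_union, hmA, hmW, hmU, true_iff]
    tauto
  have hsumU : ∀ f : V → ℕ, ∑ v, f v = ∑ v ∈ A, f v + (∑ v ∈ W, f v + ∑ v ∈ U, f v) := by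
    intro f
    rw [huniv, Finset.sum_union hdA, Finset.sum_union hdWU]
  have hn : Fintype.card V = A.card + (W.card + U.card) := by
    rw [← Finset.card_univ, huniv, Finset.card_union_of_disjoint hdA,
      Finset.card_union_of_disjoint hdWU]
  have hfull : ∀ v ∈ W, s.live v = coloursTo G c Finset.univ v := fun v hv =>
    (s.live_subset v).antisymm (Finset.sdiff_eq_empty_iff_subset.1 ((hmW v).1 hv).2)
  have hneW : ∀ v ∈ W, (s.live v).Nonempty := fun v hv =>
    Finset.nonempty_iff_ne_empty.2 ((hmW v).1 hv).1
  have hneU : ∀ v ∈ U, (s.live v).Nonempty := fun v hv =>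
    Finset.nonempty_iff_ne_empty.2 ((hmU v).1 hv).1
  have hdeadU : ∀ v ∈ U, 1 ≤ (s.dead v).card := fun v hv =>
    Finset.card_pos.2 (Finset.nonempty_iff_ne_empty.2 ((hmU v).1 hv).2)
  have hlab : Finset.univ.biUnion s.labels = W.biUnion s.labels ∪ U.biUnion s.labels := by
    have : A.biUnion s.labels = ∅ := by
      refine Finset.eq_empty_of_forall_notMem fun k hk => ?_
      obtain ⟨v, hv, hk⟩ := Finset.mem_biUnion.1 hk
      rw [labels, (hmA v).1 hv, Finset.image_empty] at hk
      exact Finset.notMem_empty k hk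
    rw [huniv, Finset.union_biUnion, Finset.union_biUnion, this, Finset.empty_union]
  have hunits : ∀ v, (s.live v).Nonempty →
      (s.units v).card = if s.loose v then (s.live v).card else 1 := by
    intro v hv
    split_ifs with hl
    · rw [s.units_of_loose hl]
    · obtain ⟨a, -, ha⟩ := s.exists_units_eq_singleton hl hv
      rw [ha, Finset.card_singleton]
  have hcost : ∀ v, (s.live v).Nonempty → s.cost v + (if s.loose v then 2 else 1) =
      (s.units v).card + (if s.loose v then 2 * (s.dead v).card else (s.dead v).card) := by
    intro v hv
    have h1 := s.card_dead_add v
    have h2 := hν v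
    rw [hunits v hv, cost, if_neg hv.ne_empty]
    split_ifs <;> omega
  have hcostA : ∑ v ∈ A, s.cost v = 2 * A.card := by
    rw [Finset.sum_congr rfl fun v hv => by rw [cost, if_pos ((hmA v).1 hv)], Finset.sum_const,
      smul_eq_mul, mul_comm]
  have hcostW : ∑ v ∈ W, (s.units v).card = ∑ v ∈ W, s.cost v +
      (2 * (W.filter s.loose).card + (W.filter fun v => ¬ s.loose v).card) := by
    have : ∑ v ∈ W, (s.units v).card = ∑ v ∈ W, (s.cost v + if s.loose v then 2 else 1) := by
      refine Finset.sum_congr rfl fun v hv => ?_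
      rw [hcost v (hneW v hv), ((hmW v).1 hv).2]
      simp
    rw [this, Finset.sum_add_distrib, Finset.sum_ite]
    simp [mul_comm]
  have hcostU : ∑ v ∈ U, (s.labels v).card + ∑ v ∈ U, (s.dead v).card
      ≤ ∑ v ∈ U, s.cost v + U.card := by
    rw [Finset.card_eq_sum_ones, ← Finset.sum_add_distrib, ← Finset.sum_add_distrib]
    refine Finset.sum_le_sum fun v hv => ?_
    have h1 := hcost v (hneU v hv)
    have h2 := hdeadU v hv
    have h3 := s.card_labels_le v
    split_ifs at h1 <;> omega
  have hUE : U.card ≤ ∑ v ∈ U, (s.dead v).card := by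
    rw [Finset.card_eq_sum_ones]
    exact Finset.sum_le_sum hdeadU
  have hkW : (W.biUnion s.labels).card ≤ ∑ v ∈ W, (s.units v).card :=
    Finset.card_biUnion_le.trans (Finset.sum_le_sum fun v _ => s.card_labels_le v)
  have hsplit := Finset.card_filter_add_card_filter_not (s := W) s.loose
  obtain ⟨I, hIU, hIW, hII, hIcard⟩ :=
    exists_disjoint_subfamily s.labels U (W.biUnion s.labels)
  rw [← hlab] at hIcard
  rw [hsumU, hcostA] at hK
  have hDI : ∑ v ∈ I, (s.dead v).card + U.card ≤ ∑ v ∈ U, (s.dead v).card + I.card := by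
    have h1 := Finset.sum_sdiff hIU (f := fun v => (s.dead v).card)
    have h2 : (U \ I).card ≤ ∑ v ∈ U \ I, (s.dead v).card := by
      rw [Finset.card_eq_sum_ones]
      exact Finset.sum_le_sum fun v hv => hdeadU v (Finset.mem_sdiff.1 hv).1
    have h4 := Finset.card_sdiff_add_card_eq_card hIU
    omega
  have htour := s.two_mul_card_mul_le hc hfull hν (hdWU.mono_right hIU) hIW hII
  have hgain : 2 + 2 * A.card + ∑ v ∈ W, (s.units v).card + ∑ v ∈ U, (s.dead v).card ≤
      (W.biUnion s.labels).card + I.card + 2 * (W.filter s.loose).card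
        + (W.filter fun v => ¬ s.loose v).card := by
    omega
  rcases Nat.lt_or_ge ν W.card with hlt | hge
  swap
  · exact false_of_card_le (by omega) hsplit.symm hge hUE hkW hDI hgain htour
  obtain ⟨t, ht⟩ := Nat.exists_eq_add_of_le hlt.le
  have hto : ∀ v ∈ W, t ≤ (coloursTo G c W v).card := fun v _ => by
    have := le_card_coloursTo (W := W) hν v
    omega
  obtain ⟨v, hv⟩ : W.Nonempty := Finset.card_pos.1 (by omega)
  obtain ⟨a, ha⟩ := hneW v hv
  have hbound := s.card_biUnion_labels_add_le (by omega) hfull hneW hc hto (s.comp v a)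
    (Finset.mem_biUnion.2 ⟨v, hv, Finset.mem_image_of_mem _ ha⟩) 1
    (s.one_le_fiberWeight (by omega) hfull hc hto hv ha)
  rw [sub_self, add_zero] at hbound
  obtain ⟨rfl, rfl, hA0, hU2, hb, hr, hE⟩ := eq_of_lt_card (by omega) hsplit.symm ht (by omega) h2 hUE
    (by exact_mod_cast hbound) hDI hgain htour
  have hdead1 : ∀ v ∈ U, (s.dead v).card = 1 := by
    have := (Finset.sum_eq_sum_iff_of_le hdeadU).1 (by rw [hE, ← Finset.card_eq_sum_ones, hU2])
    exact fun v hv => (this v hv).symm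
  have hloose : ∀ v ∈ W, s.loose v := by
    intro v hv
    by_contra hl
    rw [Finset.card_eq_zero, Finset.filter_eq_empty_iff] at hr
    exact hr hv hl
  have hseven := s.card_biUnion_labels_add_seven_le (U := U) hc hfull hneW hloose hto (by omega)
    (fun v => by
      have h1 := Finset.mem_univ v
      rw [huniv, Finset.mem_union, Finset.mem_union, Finset.card_eq_zero.1 hA0] at h1
      have h2 : v ∈ W → v ∉ U := fun h => Finset.disjoint_left.1 hdWU h
      have h3 := Finset.notMem_empty v
      tauto) hU2 (fun y hy => by
      have h1 := hdead1 y hy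
      have h2 := hν y
      have h3 := s.card_dead_add y
      omega)
  have hcostU' : ∑ v ∈ U, s.cost v = ∑ v ∈ U, (s.units v).card := by
    refine Finset.sum_congr rfl fun v hv => ?_
    have h1 := hcost v (hneU v hv)
    have h2 := hdead1 v hv
    split_ifs at h1 <;> omega
  rw [← hlab] at hseven
  omega

end LiveSystem

end LiveSystem

section Gadget

variable {V : Type*} [Fintype V]

/-- Vertices of the gadget graph: a copy of `v` for each colour at `v`, and two fewer dummies. -/
abbrev GadgetVertex (G : SimpleGraph V) (c : V → V → ℕ) : Type _ :=
  (Σ v : V, {a // a ∈ coloursTo G c Finset.univ v}) ⊕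
    (Σ v : V, Fin ((coloursTo G c Finset.univ v).card - 2))

/-- The gadget graph, whose perfect matchings correspond to properly coloured 2-factors. -/
def gadget (G : SimpleGraph V) (c : V → V → ℕ) (hc : ∀ u v, c u v = c v u) :
    SimpleGraph (GadgetVertex G c) where
  Adj
    | .inl p, .inl q => G.Adj p.1 q.1 ∧ c p.1 q.1 = p.2 ∧ c p.1 q.1 = q.2
    | .inl p, .inr q => p.1 = q.1
    | .inr p, .inl q => p.1 = q.1
    | .inr _, .inr _ => False
  symm := ⟨by
    rintro (p | p) (q | q) h
    · exact ⟨h.1.symm, hc q.1 p.1 ▸ h.2.2, hc q.1 p.1 ▸ h.2.1⟩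
    · exact Eq.symm h
    · exact Eq.symm h
    · exact h⟩
  loopless := ⟨by
    rintro (p | p) h
    · exact h.1.ne rfl
    · exact h⟩

variable {G : SimpleGraph V} {c : V → V → ℕ} {hc : ∀ u v, c u v = c v u}

/-- The edges of `G` used by a subgraph of the gadget graph. -/
def gadgetEdges (M : (gadget G c hc).Subgraph) : SimpleGraph V where
  Adj u v := ∃ p q, M.Adj (.inl p) (.inl q) ∧ p.1 = u ∧ q.1 = v
  symm := ⟨by
    rintro u v ⟨p, q, h, hp, hq⟩
    exact ⟨q, p, h.symm, hq, hp⟩⟩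
  loopless := ⟨by
    rintro u ⟨p, q, h, hp, hq⟩
    exact (M.adj_sub h).1.ne (hp.trans hq.symm)⟩

lemma gadgetEdges_adj_iff {M : (gadget G c hc).Subgraph} {u v : V} :
    (gadgetEdges M).Adj u v ↔ ∃ a b, M.Adj (.inl ⟨u, a⟩) (.inl ⟨v, b⟩) := by
  constructor
  · rintro ⟨⟨_, a⟩, ⟨_, b⟩, h, rfl, rfl⟩
    exact ⟨a, b, h⟩
  · rintro ⟨a, b, h⟩
    exact ⟨_, _, h, rfl, rfl⟩

lemma gadgetEdges_le (M : (gadget G c hc).Subgraph) : gadgetEdges M ≤ G := by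
  intro u v h
  obtain ⟨a, b, h⟩ := gadgetEdges_adj_iff.1 h
  exact (M.adj_sub h).1

lemma gadgetEdges_proper {M : (gadget G c hc).Subgraph} (hM : M.IsPerfectMatching) (b a d : V)
    (ha : (gadgetEdges M).Adj b a) (hd : (gadgetEdges M).Adj b d) (had : a ≠ d) :
    c b a ≠ c b d := by
  intro h
  obtain ⟨x, y, hxy⟩ := gadgetEdges_adj_iff.1 ha
  obtain ⟨x', y', hxy'⟩ := gadgetEdges_adj_iff.1 hd
  have h1 : c b a = x := (M.adj_sub hxy).2.1
  have h2 : c b d = x' := (M.adj_sub hxy').2.1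
  obtain rfl : x = x' := Subtype.ext (by rw [← h1, ← h2, h])
  have := (Subgraph.isPerfectMatching_iff.1 hM _).unique hxy hxy'
  exact had (congrArg Sigma.fst (Sum.inl_injective this))

lemma ncard_neighborSet_gadgetEdges {M : (gadget G c hc).Subgraph} (hM : M.IsPerfectMatching)
    (v : V) (hv : 2 ≤ (coloursTo G c Finset.univ v).card) :
    ((gadgetEdges M).neighborSet v).ncard = 2 := by
  classical
  rw [Subgraph.isPerfectMatching_iff] at hM
  have hdummy : ∀ i : Fin ((coloursTo G c Finset.univ v).card - 2),
      ∃ a : {a // a ∈ coloursTo G c Finset.univ v}, M.Adj (.inr ⟨v, i⟩) (.inl ⟨v, a⟩) := by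
    intro i
    obtain ⟨x, hx, -⟩ := hM (.inr ⟨v, i⟩)
    obtain ⟨u, a⟩ | y := x
    · obtain rfl : v = u := M.adj_sub hx
      exact ⟨a, hx⟩
    · exact (M.adj_sub hx).elim
  choose f hf using hdummy
  have hfinj : Function.Injective f := by
    intro i j hij
    have := (hM (.inl ⟨v, f i⟩)).unique (hf i).symm (hij ▸ (hf j).symm)
    simpa using this
  have hreal : ∀ a : {a // a ∈ coloursTo G c Finset.univ v}, a ∉ Finset.univ.image f →
      ∃ u b, M.Adj (.inl ⟨v, a⟩) (.inl ⟨u, b⟩) := by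
    intro a ha
    obtain ⟨x, hx, -⟩ := hM (.inl ⟨v, a⟩)
    obtain ⟨u, b⟩ | ⟨u, i⟩ := x
    · exact ⟨u, b, hx⟩
    · obtain rfl : v = u := M.adj_sub hx
      refine absurd (Finset.mem_image.2 ⟨i, Finset.mem_univ _, ?_⟩) ha
      have := (hM (.inr ⟨v, i⟩)).unique (hf i) hx.symm
      simpa using this
  have : Nonempty V := ⟨v⟩
  choose! g hg using hreal
  have himage : (gadgetEdges M).neighborSet v = g '' ((Finset.univ.image f)ᶜ : Finset _) := by
    ext u
    rw [mem_neighborSet, gadgetEdges_adj_iff]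
    constructor
    · rintro ⟨a, b, h⟩
      have ha : a ∉ Finset.univ.image f := by
        intro ha
        obtain ⟨i, -, rfl⟩ := Finset.mem_image.1 ha
        have := (hM _).unique h (hf i).symm
        simp at this
      obtain ⟨b', hb'⟩ := hg a ha
      have := congrArg Sigma.fst (Sum.inl_injective ((hM _).unique hb' h))
      exact ⟨a, by simpa using ha, this⟩
    · rintro ⟨a, ha, rfl⟩
      obtain ⟨b, hb⟩ := hg a (by simpa using ha)
      exact ⟨a, b, hb⟩
  rw [himage, Set.InjOn.ncard_image, Set.ncard_coe_finset, Finset.card_compl,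
    Finset.card_image_of_injective _ hfinj]
  · simp only [Fintype.card_coe, Finset.card_univ, Fintype.card_fin]
    omega
  · intro a ha a' ha' h
    obtain ⟨b, hb⟩ := hg a (by simpa using ha)
    obtain ⟨b', hb'⟩ := hg a' (by simpa using ha')
    have h1 : c v (g a) = a := (M.adj_sub hb).2.1
    have h2 : c v (g a') = a' := (M.adj_sub hb').2.1
    exact Subtype.ext (by rw [← h1, ← h2, h])

lemma exists_pcCycles_of_isPerfectMatching {M : (gadget G c hc).Subgraph}
    (hM : M.IsPerfectMatching) (h2 : ∀ v, 2 ≤ (coloursTo G c Finset.univ v).card) :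
    ∃ S : Finset (List V),
      (∀ l ∈ S, IsPCCycle G c l) ∧
      (∀ l ∈ S, ∀ l' ∈ S, l ≠ l' → ∀ v, v ∈ l → v ∉ l') ∧
      (∀ v : V, ∃ l ∈ S, v ∈ l) :=
  exists_pcCycles_of_isCycles G (gadgetEdges M) c hc (gadgetEdges_le M) (gadgetEdges_proper hM)
    fun v => ncard_neighborSet_gadgetEdges hM v (h2 v)

open Classical in
/-- The component of a vertex that survives the deletion of `T`. -/
noncomputable def componentOf (T : Set (GadgetVertex G c)) (x : GadgetVertex G c) :
    Option ((⊤ : (gadget G c hc).Subgraph).deleteVerts T).coe.ConnectedComponent :=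
  if h : x ∉ T then some (connectedComponentMk _ ⟨x, trivial, h⟩) else none

lemma componentOf_eq_of_adj {T : Set (GadgetVertex G c)} {x y : GadgetVertex G c}
    (h : (gadget G c hc).Adj x y) (hx : x ∉ T) (hy : y ∉ T) :
    componentOf (hc := hc) T x = componentOf T y := by
  rw [componentOf, componentOf, dif_pos hx, dif_pos hy]
  refine congrArg some (ConnectedComponent.sound (Adj.reachable ?_))
  rw [Subgraph.coe_adj, Subgraph.deleteVerts_adj]
  exact ⟨trivial, hx, trivial, hy, h⟩

open Classical in
/-- The live colours and component labels left by deleting `T` from the gadget graph. -/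
noncomputable def liveSystemOfDelete (hc : ∀ u v, c u v = c v u) (T : Set (GadgetVertex G c)) :
    LiveSystem G c
      (Option ((⊤ : (gadget G c hc).Subgraph).deleteVerts T).coe.ConnectedComponent) where
  live v := (coloursTo G c Finset.univ v).filter fun a => ∃ h, .inl ⟨v, a, h⟩ ∉ T
  loose v := ∀ i, .inr ⟨v, i⟩ ∈ T
  comp v a := if h : a ∈ coloursTo G c Finset.univ v then componentOf T (.inl ⟨v, a, h⟩) else none
  live_subset v := Finset.filter_subset _ _
  comp_eq u v huv hu hv := by
    obtain ⟨-, hu, huT⟩ := Finset.mem_filter.1 hu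
    obtain ⟨-, hv, hvT⟩ := Finset.mem_filter.1 hv
    rw [dif_pos hu, dif_pos hv]
    exact componentOf_eq_of_adj ⟨huv, rfl, rfl⟩ huT hvT
  comp_const v hl a ha b hb := by
    push Not at hl
    obtain ⟨i, hi⟩ := hl
    obtain ⟨-, ha, haT⟩ := Finset.mem_filter.1 ha
    obtain ⟨-, hb, hbT⟩ := Finset.mem_filter.1 hb
    rw [dif_pos ha, dif_pos hb]
    have h1 : (gadget G c hc).Adj (.inl ⟨v, a, ha⟩) (.inr ⟨v, i⟩) := rfl
    have h2 : (gadget G c hc).Adj (.inl ⟨v, b, hb⟩) (.inr ⟨v, i⟩) := rfl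
    rw [componentOf_eq_of_adj h1 haT hi, componentOf_eq_of_adj h2 hbT hi]

lemma mem_live_liveSystemOfDelete {T : Set (GadgetVertex G c)} {v : V} {a : ℕ} :
    a ∈ (liveSystemOfDelete hc T).live v ↔ ∃ h, .inl ⟨v, a, h⟩ ∉ T := by
  simp only [liveSystemOfDelete, Finset.mem_filter, and_iff_right_iff_imp]
  rintro ⟨h, -⟩
  exact h

open Classical in
/-- The dummies at `v` that are not deleted. -/
noncomputable def liveDummies (T : Set (GadgetVertex G c)) (v : V) :
    Finset (Fin ((coloursTo G c Finset.univ v).card - 2)) :=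
  Finset.univ.filter fun i => .inr ⟨v, i⟩ ∉ T

open Classical in
/-- Every component meets a live colour or is an isolated dummy. -/
lemma card_connectedComponent_deleteVerts_le (T : Set (GadgetVertex G c)) :
    Nat.card ((⊤ : (gadget G c hc).Subgraph).deleteVerts T).coe.ConnectedComponent ≤
      (Finset.univ.biUnion (liveSystemOfDelete hc T).labels).card +
        ∑ v with (liveSystemOfDelete hc T).live v = ∅, (liveDummies T v).card := by
  set s := liveSystemOfDelete hc T with hs
  let D : Finset (GadgetVertex G c) :=
    ((Finset.univ.filter fun v => s.live v = ∅).sigma (liveDummies T)).map Function.Embedding.inr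
  have hD : D.card = ∑ v with s.live v = ∅, (liveDummies T v).card := by
    rw [Finset.card_map, Finset.card_sigma]
  rw [← hD]
  have hsub : (Finset.univ : Finset
        ((⊤ : (gadget G c hc).Subgraph).deleteVerts T).coe.ConnectedComponent).image some ⊆
      Finset.univ.biUnion s.labels ∪ D.image (componentOf T) := by
    intro k hk
    obtain ⟨K, -, rfl⟩ := Finset.mem_image.1 hk
    induction K using ConnectedComponent.ind with | _ x
    obtain ⟨x, hx⟩ := x
    have hxT : x ∉ T := hx.2
    have hlabel : ∀ (v : V) (a : ℕ) (h : a ∈ coloursTo G c Finset.univ v),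
        (.inl ⟨v, a, h⟩ : GadgetVertex G c) ∉ T →
        componentOf T (.inl ⟨v, a, h⟩) ∈ Finset.univ.biUnion s.labels := by
      intro v a h haT
      refine Finset.mem_biUnion.2 ⟨v, Finset.mem_univ _, Finset.mem_image.2 ⟨a, ?_, ?_⟩⟩
      · exact mem_live_liveSystemOfDelete.2 ⟨h, haT⟩
      · exact dif_pos h
    have hk : some (connectedComponentMk _ ⟨x, hx⟩) = componentOf (hc := hc) T x := by
      rw [componentOf, dif_pos hxT]
    rw [hk]
    obtain ⟨v, a, h⟩ | ⟨v, i⟩ := x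
    · exact Finset.mem_union_left _ (hlabel v a h hxT)
    · by_cases hv : s.live v = ∅
      · refine Finset.mem_union_right _ (Finset.mem_image_of_mem _ ?_)
        simp [D, hv, liveDummies, hxT]
      · obtain ⟨a, ha⟩ := Finset.nonempty_iff_ne_empty.2 hv
        obtain ⟨h, haT⟩ := mem_live_liveSystemOfDelete.1 ha
        have hadj : (gadget G c hc).Adj (.inr ⟨v, i⟩) (.inl ⟨v, a, h⟩) := rfl
        rw [componentOf_eq_of_adj hadj hxT haT]
        exact Finset.mem_union_left _ (hlabel v a h haT)
  have h1 := Finset.card_le_card hsub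
  rw [Finset.card_image_of_injective _ (Option.some_injective _), Finset.card_univ] at h1
  rw [Nat.card_eq_fintype_card]
  exact h1.trans ((Finset.card_union_le _ _).trans (by gcongr; exact Finset.card_image_le))

lemma ncard_add_sum_card_liveDummies (T : Set (GadgetVertex G c)) :
    T.ncard + ∑ v, (liveDummies T v).card =
      ∑ v, (((liveSystemOfDelete hc T).dead v).card + ((coloursTo G c Finset.univ v).card - 2)) := by
  classical
  set s := liveSystemOfDelete hc T with hs
  have h1 : ∀ v, (s.dead v).card =
      (Finset.univ.filter fun a => (.inl ⟨v, a⟩ : GadgetVertex G c) ∈ T).card := by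
    intro v
    rw [← Finset.card_map (Function.Embedding.subtype _)]
    congr 1
    ext a
    simp only [LiveSystem.dead, Finset.mem_sdiff, hs, mem_live_liveSystemOfDelete, Finset.mem_map,
      Finset.mem_filter, Finset.mem_univ, true_and, Function.Embedding.subtype_apply]
    constructor
    · rintro ⟨ha, h⟩
      push Not at h
      exact ⟨⟨a, ha⟩, h ha, rfl⟩
    · rintro ⟨⟨a, ha⟩, h, rfl⟩
      exact ⟨ha, fun ⟨_, h'⟩ => h' h⟩
  have h2 : ∀ v, (Finset.univ.filter fun i => (.inr ⟨v, i⟩ : GadgetVertex G c) ∈ T).card +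
      (liveDummies T v).card = (coloursTo G c Finset.univ v).card - 2 := by
    intro v
    rw [liveDummies, Finset.card_filter_add_card_filter_not, Finset.card_univ, Fintype.card_fin]
  have h3 : T.ncard =
      ∑ v, (Finset.univ.filter fun a => (.inl ⟨v, a⟩ : GadgetVertex G c) ∈ T).card +
      ∑ v, (Finset.univ.filter fun i => (.inr ⟨v, i⟩ : GadgetVertex G c) ∈ T).card := by
    rw [Set.ncard_eq_toFinset_card', ← Finset.card_sigma, ← Finset.card_sigma,
      ← Finset.card_disjSum]
    congr 1
    ext (x | x) <;> simp
  rw [h3, Finset.sum_add_distrib, Finset.sum_congr rfl fun v _ => h1 v,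
    ← Finset.sum_congr rfl fun v _ => h2 v, Finset.sum_add_distrib]
  ring

lemma even_card_gadgetVertex (h2 : ∀ v, 2 ≤ (coloursTo G c Finset.univ v).card) :
    Even (Nat.card (GadgetVertex G c)) := by
  classical
  rw [Nat.card_eq_fintype_card, Fintype.card_sum, Fintype.card_sigma, Fintype.card_sigma,
    ← Finset.sum_add_distrib]
  refine Finset.even_sum _ fun v _ => ?_
  have := h2 v
  rw [Fintype.card_coe, Fintype.card_fin, Nat.even_iff]
  omega

theorem exists_isPerfectMatching_gadget (hc : ∀ u v, c u v = c v u) {ν : ℕ} (hν2 : 2 ≤ ν)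
    (h3 : 3 * ν ≤ Fintype.card V)
    (hν : ∀ v, Fintype.card V ≤ (coloursTo G c Finset.univ v).card + ν) :
    ∃ M : (gadget G c hc).Subgraph, M.IsPerfectMatching := by
  classical
  have h2 : ∀ v, 2 ≤ (coloursTo G c Finset.univ v).card := fun v => by
    have := hν v
    omega
  refine tutte.2 fun T hT => ?_
  rw [IsTutteViolator] at hT
  have hodd := odd_ncard_oddComponents ((⊤ : (gadget G c hc).Subgraph).deleteVerts T).coe
  have hcard : Nat.card ((⊤ : (gadget G c hc).Subgraph).deleteVerts T).verts + T.ncard =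
      Nat.card (GadgetVertex G c) := by
    rw [Nat.card_coe_set_eq, Subgraph.deleteVerts_verts, Subgraph.verts_top, ← Set.compl_eq_univ_sdiff,
      add_comm, Set.ncard_add_ncard_compl]
  have heven := even_card_gadgetVertex h2
  have hle := (Set.ncard_le_card ((⊤ : (gadget G c hc).Subgraph).deleteVerts T).coe.oddComponents).trans
    (card_connectedComponent_deleteVerts_le T)
  have hlabels := (liveSystemOfDelete hc T).card_biUnion_labels_le hc hν2 h3 hν
  have hT' := ncard_add_sum_card_liveDummies (hc := hc) T
  have hcost : ∀ v, (liveSystemOfDelete hc T).cost v + (liveDummies T v).card +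
      (if (liveSystemOfDelete hc T).live v = ∅ then (liveDummies T v).card else 0) ≤
      ((liveSystemOfDelete hc T).dead v).card + ((coloursTo G c Finset.univ v).card - 2) := by
    intro v
    have h4 := (liveSystemOfDelete hc T).card_dead_add v
    have h5 := Finset.card_le_univ (liveDummies T v)
    rw [Fintype.card_fin] at h5
    have h6 := h2 v
    rw [LiveSystem.cost]
    split_ifs with hl hloose
    · rw [hl, Finset.card_empty] at h4
      omega
    · have hT : ∀ i, .inr ⟨v, i⟩ ∈ T := hloose
      have : liveDummies T v = ∅ := by
        simpa [liveDummies] using hT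
      rw [this, Finset.card_empty]
      omega
    · omega
  have hsum := Finset.sum_le_sum fun v (_ : v ∈ Finset.univ) => hcost v
  rw [Finset.sum_add_distrib, Finset.sum_add_distrib, ← Finset.sum_filter] at hsum
  have hexact : ((⊤ : (gadget G c hc).Subgraph).deleteVerts T).coe.oddComponents.ncard
      = T.ncard + 1 := by omega
  rw [hexact, Nat.odd_iff, Nat.odd_iff] at hodd
  rw [Nat.even_iff] at heven
  omega

end Gadget

lemma card_coloursTo_univ {V : Type*} [Fintype V] (G : SimpleGraph V) (c : V → V → ℕ) (v : V) :
    (coloursTo G c Finset.univ v).card = colourDeg G c v := by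
  classical
  rw [colourDeg, ← Set.ncard_coe_finset]
  congr 1
  ext a
  simp [coloursTo]

/-- If every vertex sees as many colours as there are other vertices, any ordering of the vertices
is a properly coloured Hamilton cycle. -/
lemma exists_pcCycles_of_card_le {V : Type*} [Fintype V] (G : SimpleGraph V) (c : V → V → ℕ)
    (hc : ∀ u v, c u v = c v u) (h3 : 3 ≤ Fintype.card V)
    (h : ∀ v, Fintype.card V ≤ (coloursTo G c Finset.univ v).card + 1) :
    ∃ S : Finset (List V),
      (∀ l ∈ S, IsPCCycle G c l) ∧
      (∀ l ∈ S, ∀ l' ∈ S, l ≠ l' → ∀ v, v ∈ l → v ∉ l') ∧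
      (∀ v : V, ∃ l ∈ S, v ∈ l) := by
  classical
  have hnbr : ∀ v, Finset.univ.filter (G.Adj v) = Finset.univ.erase v ∧
      Set.InjOn (c v) (Finset.univ.filter (G.Adj v)) := by
    intro v
    have hsub : Finset.univ.filter (G.Adj v) ⊆ Finset.univ.erase v := fun u hu =>
      Finset.mem_erase.2 ⟨(Finset.mem_filter.1 hu).2.ne', Finset.mem_univ _⟩
    have h1 := h v
    have h2 : (coloursTo G c Finset.univ v).card ≤ (Finset.univ.filter (G.Adj v)).card := by
      rw [coloursTo]
      convert Finset.card_image_le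
    have h4 := Finset.card_le_card hsub
    have h5 := Finset.card_erase_add_one (Finset.mem_univ v)
    rw [Finset.card_univ] at h5
    refine ⟨Finset.eq_of_subset_of_card_le hsub (by omega), Finset.card_image_iff.1 ?_⟩
    have h6 : ((Finset.univ.filter (G.Adj v)).image (c v)).card =
        (coloursTo G c Finset.univ v).card := by
      rw [coloursTo]
    omega
  have hadj : ∀ u v, u ≠ v → G.Adj u v := by
    intro u v huv
    have : v ∈ Finset.univ.filter (G.Adj u) := by
      rw [(hnbr u).1]
      exact Finset.mem_erase.2 ⟨huv.symm, Finset.mem_univ _⟩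
    exact (Finset.mem_filter.1 this).2
  have hlen : (Finset.univ : Finset V).toList.length = Fintype.card V := by simp
  refine ⟨{Finset.univ.toList}, ?_, ?_, fun v => ⟨_, Finset.mem_singleton_self _, by simp⟩⟩
  · intro l hl
    rw [Finset.mem_singleton] at hl
    subst hl
    refine isPCCycle_of_cyclic G G c hc le_rfl ?_ _ (Finset.nodup_toList _) (by omega) ?_
    · intro b a d ha hd had hcol
      exact had ((hnbr b).2 (by simpa using ha) (by simpa using hd) hcol)
    · intro i hi
      refine hadj _ _ fun heq => ?_
      have h1 := (List.Nodup.getElem_inj_iff (Finset.nodup_toList _)).1 heq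
      rcases Nat.lt_or_ge (i + 1) (Finset.univ : Finset V).toList.length with h2 | h2
      · rw [Nat.mod_eq_of_lt h2] at h1
        omega
      · rw [show i + 1 = (Finset.univ : Finset V).toList.length by omega, Nat.mod_self] at h1
        omega
  · intro l hl l' hl' hne
    rw [Finset.mem_singleton] at hl hl'
    exact absurd (hl.trans hl'.symm) hne

/-- Every edge-coloured graph on `n` vertices with minimum colour
degree at least `2n/3` contains a properly coloured 2-factor. -/
theorem stmt0 {V : Type*} [Fintype V] (G : SimpleGraph V) (c : V → V → ℕ)
    (hc : ∀ u v, c u v = c v u)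
    (hδ : ∀ v : V, (2 * (Fintype.card V : ℝ)) / 3 ≤ colourDeg G c v) :
    ∃ S : Finset (List V),
      (∀ l ∈ S, IsPCCycle G c l) ∧
      (∀ l ∈ S, ∀ l' ∈ S, l ≠ l' → ∀ v, v ∈ l → v ∉ l') ∧
      (∀ v : V, ∃ l ∈ S, v ∈ l) := by
  classical
  rcases isEmpty_or_nonempty V with hV | ⟨⟨v₀⟩⟩
  · exact ⟨∅, by simp, by simp, fun v => hV.elim v⟩
  have hdeg : ∀ v, 2 * Fintype.card V ≤ 3 * (coloursTo G c Finset.univ v).card := by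
    intro v
    have h := hδ v
    rw [← card_coloursTo_univ, div_le_iff₀ (by norm_num)] at h
    have h' : 2 * Fintype.card V ≤ (coloursTo G c Finset.univ v).card * 3 := by exact_mod_cast h
    omega
  rcases Nat.lt_or_ge (Fintype.card V) 6 with hn | hn
  · have hlt : (coloursTo G c Finset.univ v₀).card < Fintype.card V := by
      rw [card_coloursTo_univ, colourDeg]
      refine (Set.ncard_image_le (Set.toFinite _)).trans_lt ?_
      rw [← Nat.card_eq_fintype_card, ← Set.ncard_univ]
      refine Set.ncard_lt_ncard (Set.ssubset_univ_iff.2 fun h => ?_)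
      have : v₀ ∈ {w | G.Adj v₀ w} := h ▸ Set.mem_univ v₀
      exact this.ne rfl
    have h₀ := hdeg v₀
    have hpos := Fintype.card_pos_iff.2 ⟨v₀⟩
    refine exists_pcCycles_of_card_le G c hc (by omega) fun v => ?_
    have := hdeg v
    omega
  · obtain ⟨M, hM⟩ := exists_isPerfectMatching_gadget (G := G) (ν := Fintype.card V / 3) hc (by omega)
      (by omega) fun v => by
        have := hdeg v
        omega
    exact exists_pcCycles_of_isPerfectMatching hM fun v => by
      have := hdeg v
      omega
end

section
/- For every ε > 0 there exists n₀ such that every edge-coloured graph G on n ≥ n₀ vertices with δ^c(G) ≥ (2/3 + ε)n contains a properly coloured cycle of length ℓ for every 3 ≤ ℓ ≤ n. -/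
open SimpleGraph

section Walks
variable {V : Type*} {G : SimpleGraph V} {c : V → V → ℕ}

lemma IsPCWalk.tail {a : V} {l : List V} (h : IsPCWalk G c (a :: l)) : IsPCWalk G c l := by
  match l, h with
  | [], _ => trivial
  | [_], _ => trivial
  | _ :: _ :: _, h => exact h.2.2

lemma IsPCWalk.of_append_right {l m : List V} (h : IsPCWalk G c (l ++ m)) :
    IsPCWalk G c m := by
  induction l with
  | nil => exact h
  | cons a l ih => exact ih h.tail

lemma IsPCWalk.of_append_left {l m : List V} (h : IsPCWalk G c (l ++ m)) :
    IsPCWalk G c l := by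
  induction l with
  | nil => trivial
  | cons a l ih =>
    match l, ih, h with
    | [], _, _ => trivial
    | [b], _, h =>
      cases m with
      | nil => exact h
      | cons d m => exact h.1
    | b :: d :: l, ih, h => exact ⟨h.1, h.2.1, ih h.2.2⟩

lemma IsPCWalk.glue {l m : List V} {a b : V} (h₁ : IsPCWalk G c (l ++ [a, b]))
    (h₂ : IsPCWalk G c (a :: b :: m)) : IsPCWalk G c (l ++ a :: b :: m) := by
  induction l with
  | nil => exact h₂
  | cons x l ih =>
    match l, ih, h₁ with
    | [], _, h => exact ⟨h.1, h.2.1, h₂⟩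
    | [y], ih, h => exact ⟨h.1, h.2.1, ih h.2.2⟩
    | y :: z :: l, ih, h => exact ⟨h.1, h.2.1, ih h.2.2⟩

/-- The vertices at the two ends of a path together with their neighbours on it; for a
single vertex all four entries are that vertex. -/
def HasEnds (P : List V) (i : V × V × V × V) : Prop :=
  P = [i.1] ∧ i = (i.1, i.1, i.1, i.1) ∨
    ∃ r s, P = i.1 :: i.2.1 :: r ∧ P = s ++ [i.2.2.2, i.2.2.1] ∧ i.1 ≠ i.2.2.1

lemma exists_hasEnds {P : List V} (hP : P ≠ []) (hn : P.Nodup) : ∃ i, HasEnds P i := by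
  match P, hP, hn with
  | [x], _, _ => exact ⟨(x, x, x, x), Or.inl ⟨rfl, rfl⟩⟩
  | x :: x' :: r, _, hn =>
    rcases List.eq_nil_or_concat (x :: x' :: r) with h | ⟨s, y, h⟩
    · simp at h
    rcases List.eq_nil_or_concat s with rfl | ⟨s, y', rfl⟩
    · simp at h
    refine ⟨(x, x', y, y'), Or.inr ⟨r, s, rfl, by simpa using h, ?_⟩⟩
    rintro (rfl : x = y)
    cases s with
    | nil =>
      simp at h
      simp [h] at hn
    | cons b s =>
      simp at h
      simp [h] at hn

/-- `z₁z₂z₃z₄` is a properly coloured path. -/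
def IsFourPath (G : SimpleGraph V) (c : V → V → ℕ) (z : V × V × V × V) : Prop :=
  [z.1, z.2.1, z.2.2.1, z.2.2.2].Nodup ∧ IsPCWalk G c [z.1, z.2.1, z.2.2.1, z.2.2.2]

/-- A path with end data `(x, x', y, y')` can be inserted in the middle of `z₁z₂z₃z₄`. -/
def IsAbsorber (G : SimpleGraph V) (c : V → V → ℕ) (i z : V × V × V × V) : Prop :=
  G.Adj z.2.1 i.1 ∧ c z.1 z.2.1 ≠ c z.2.1 i.1 ∧ c z.2.1 i.1 ≠ c i.1 i.2.1 ∧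
  G.Adj i.2.2.1 z.2.2.1 ∧ c i.2.2.2 i.2.2.1 ≠ c i.2.2.1 z.2.2.1 ∧
  c i.2.2.1 z.2.2.1 ≠ c z.2.2.1 z.2.2.2 ∧ (i.1 = i.2.2.1 → c z.2.1 i.1 ≠ c i.2.2.1 z.2.2.1)

lemma isPCWalk_insert {P : List V} {i z : V × V × V × V} (hP : IsPCWalk G c P)
    (hi : HasEnds P i) (hz : IsFourPath G c z) (h : IsAbsorber G c i z) :
    IsPCWalk G c (z.1 :: z.2.1 :: (P ++ [z.2.2.1, z.2.2.2])) := by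
  obtain ⟨x, x', y, y'⟩ := i
  obtain ⟨z₁, z₂, z₃, z₄⟩ := z
  obtain ⟨-, hz⟩ := hz
  obtain ⟨h1, h2, h3, h4, h5, h6, h7⟩ := h
  simp only at *
  rcases hi with ⟨rfl, hi⟩ | ⟨r, s, hr, hs, hne⟩
  · simp only [Prod.mk.injEq] at hi
    obtain ⟨-, rfl, rfl, rfl⟩ := hi
    exact ⟨hz.1, h2, h1, h7 rfl, h4, h6, hz.2.2.2.2⟩
  · simp only at hr hs hne
    have hw : IsPCWalk G c (z₁ :: z₂ :: P) := by
      subst hr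
      exact ⟨hz.1, h2, h1, h3, hP⟩
    have hy : G.Adj y' y := by
      rw [hs] at hP
      exact hP.of_append_right
    have := IsPCWalk.glue (l := z₁ :: z₂ :: s) (a := y') (b := y) (m := [z₃, z₄])
      (by simpa [hs] using hw) ⟨hy, h5, h4, h6, hz.2.2.2.2⟩
    simpa [hs] using this

lemma isPCWalk_absorb {L R P : List V} {i z : V × V × V × V}
    (hW : IsPCWalk G c (L ++ [z.1, z.2.1, z.2.2.1, z.2.2.2] ++ R)) (hP : IsPCWalk G c P)
    (hi : HasEnds P i) (hz : IsFourPath G c z) (h : IsAbsorber G c i z) :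
    IsPCWalk G c (L ++ (z.1 :: z.2.1 :: (P ++ [z.2.2.1, z.2.2.2])) ++ R) := by
  have h1 : IsPCWalk G c (L ++ [z.1, z.2.1]) := by
    have : L ++ [z.1, z.2.1, z.2.2.1, z.2.2.2] ++ R =
      (L ++ [z.1, z.2.1]) ++ ([z.2.2.1, z.2.2.2] ++ R) := by simp
    rw [this] at hW
    exact hW.of_append_left
  have h2 : IsPCWalk G c (z.2.2.1 :: z.2.2.2 :: R) := by
    have : L ++ [z.1, z.2.1, z.2.2.1, z.2.2.2] ++ R =
      (L ++ [z.1, z.2.1]) ++ (z.2.2.1 :: z.2.2.2 :: R) := by simp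
    rw [this] at hW
    exact hW.of_append_right
  have h3 := h1.glue (isPCWalk_insert hP hi hz h)
  have h4 := IsPCWalk.glue (l := L ++ z.1 :: z.2.1 :: P) (by simpa using h3) h2
  simpa using h4

lemma infix_of_disjoint {l L Z R : List V} (h : l <:+: L ++ Z ++ R) (hl : l ≠ [])
    (hZ : Z ≠ []) (hd : l.Disjoint Z) : l <:+: L ∨ l <:+: R := by
  obtain ⟨s, t, h⟩ := h
  rw [List.append_assoc, List.append_assoc, List.append_eq_append_iff] at h
  obtain ⟨z, Z, rfl⟩ := List.exists_cons_of_ne_nil hZ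
  rcases h with ⟨a, rfl, h⟩ | ⟨a, rfl, h⟩
  · rw [List.append_eq_append_iff] at h
    rcases h with ⟨b, rfl, h⟩ | ⟨b, rfl, h⟩
    · exact Or.inl ⟨s, b, by simp⟩
    · cases b with
      | nil => exact Or.inl ⟨s, [], by simp⟩
      | cons b bs =>
        simp at h
        exact absurd (show z ∈ z :: Z by simp) (hd (by simp [h.1]))
  · rw [List.append_eq_append_iff] at h
    rcases h with ⟨b, rfl, h⟩ | ⟨b, h, hh⟩
    · exact Or.inr ⟨b, t, by simp [h]⟩
    · cases b with
      | nil => exact Or.inr ⟨[], t, by simpa using hh⟩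
      | cons b bs =>
        obtain ⟨x, l, rfl⟩ := List.exists_cons_of_ne_nil hl
        have hx : x = b := by
          simp at hh
          exact hh.1
        exact absurd (show b ∈ z :: Z by rw [h]; simp) (hd (by simp [hx]))

end Walks

section Exchange
open scoped Classical
open Finset

variable {V : Type*}

/-- `Near F k a b`: from `a` one reaches `b` by at most `k` steps of the relation `F`. -/
def Near (F : Finset (V × V)) : ℕ → V → V → Prop
  | 0, a, b => a = b
  | k + 1, a, b => a = b ∨ ∃ v, (a, v) ∈ F ∧ Near F k v b

lemma Near.refl (F : Finset (V × V)) (k : ℕ) (a : V) : Near F k a a := by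
  cases k with
  | zero => rfl
  | succ k => exact Or.inl rfl

lemma Near.mono {F F' : Finset (V × V)} (hF : F ⊆ F') {k k' : ℕ} (hk : k ≤ k') {a b : V}
    (h : Near F k a b) : Near F' k' a b := by
  induction k generalizing k' a with
  | zero => cases h; exact Near.refl _ _ _
  | succ k ih =>
    obtain ⟨k', rfl⟩ : ∃ j, k' = j + 1 := ⟨k' - 1, by omega⟩
    rcases h with rfl | ⟨v, hv, h⟩
    · exact Near.refl _ _ _
    · exact Or.inr ⟨v, hF hv, ih (by omega) h⟩

lemma Near.trans {F : Finset (V × V)} {k l : ℕ} {a b d : V} (h : Near F k a b)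
    (h' : Near F l b d) : Near F (k + l) a d := by
  induction k generalizing a with
  | zero => cases h; simpa using h'
  | succ k ih =>
    rcases h with rfl | ⟨v, hv, h⟩
    · exact h'.mono subset_rfl (by omega)
    · rw [Nat.succ_add_eq_add_succ]
      exact Or.inr ⟨v, hv, ih h⟩

lemma Near.single {F : Finset (V × V)} {a b : V} (h : (a, b) ∈ F) : Near F 1 a b :=
  Or.inr ⟨b, h, rfl⟩

lemma Near.symm {F : Finset (V × V)} (hF : ∀ u w, (u, w) ∈ F → (w, u) ∈ F) {k : ℕ} {a b : V}
    (h : Near F k a b) : Near F k b a := by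
  induction k generalizing a with
  | zero => exact Eq.symm h
  | succ k ih =>
    rcases h with rfl | ⟨v, hv, h⟩
    · exact Near.refl _ _ _
    · exact (ih h).trans (Near.single (hF _ _ hv))

lemma Near.of_add_edge {F F' : Finset (V × V)} {x y : V}
    (hF : ∀ u w, (u, w) ∈ F' → (u, w) ∈ F ∨ (u = x ∧ w = y) ∨ (u = y ∧ w = x))
    {k : ℕ} {a b : V} (h : Near F' k a b) :
    Near F k a b ∨ (∃ i j, i + j + 1 ≤ k ∧ Near F i a x ∧ Near F j y b) ∨
      ∃ i j, i + j + 1 ≤ k ∧ Near F i a y ∧ Near F j x b := by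
  induction k generalizing a with
  | zero => exact Or.inl h
  | succ k ih =>
    rcases h with rfl | ⟨v, hv, h⟩
    · exact Or.inl (Near.refl _ _ _)
    rcases hF _ _ hv with hv | ⟨rfl, rfl⟩ | ⟨rfl, rfl⟩
    · rcases ih h with h | ⟨i, j, hij, hi, hj⟩ | ⟨i, j, hij, hi, hj⟩
      · exact Or.inl (Or.inr ⟨v, hv, h⟩)
      · exact Or.inr (Or.inl ⟨i + 1, j, by omega, Or.inr ⟨v, hv, hi⟩, hj⟩)
      · exact Or.inr (Or.inr ⟨i + 1, j, by omega, Or.inr ⟨v, hv, hi⟩, hj⟩)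
    · rcases ih h with h | ⟨i, j, hij, hi, hj⟩ | ⟨i, j, hij, hi, hj⟩
      · exact Or.inr (Or.inl ⟨0, k, by omega, rfl, h⟩)
      · exact Or.inr (Or.inl ⟨0, j, by omega, rfl, hj⟩)
      · exact Or.inl (hj.mono subset_rfl (by omega))
    · rcases ih h with h | ⟨i, j, hij, hi, hj⟩ | ⟨i, j, hij, hi, hj⟩
      · exact Or.inr (Or.inr ⟨0, k, by omega, rfl, h⟩)
      · exact Or.inl (hj.mono subset_rfl (by omega))
      · exact Or.inr (Or.inr ⟨0, j, by omega, rfl, hj⟩)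

variable [Fintype V]

noncomputable def nbrs (F : Finset (V × V)) (v : V) : Finset V := univ.filter fun w => (v, w) ∈ F

@[simp] lemma mem_nbrs {F : Finset (V × V)} {v w : V} : w ∈ nbrs F v ↔ (v, w) ∈ F := by
  simp [nbrs]

lemma card_near_le {F : Finset (V × V)} (hF : ∀ v, (nbrs F v).card ≤ 2) (k : ℕ) (a : V) :
    (univ.filter fun b => Near F k a b).card ≤ 3 ^ k := by
  induction k generalizing a with
  | zero =>
    refine card_le_one.2 fun x hx y hy => ?_
    rw [mem_filter] at hx hy
    exact (show a = x from hx.2).symm.trans hy.2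
  | succ k ih =>
    have hsub : (univ.filter fun b => Near F (k + 1) a b) ⊆
        {a} ∪ (nbrs F a).biUnion fun v => univ.filter fun b => Near F k v b := by
      intro b hb
      rw [mem_filter] at hb
      rcases hb.2 with rfl | ⟨v, hv, h⟩
      · simp
      · simp only [mem_union, mem_biUnion, mem_filter, mem_univ, true_and, mem_nbrs]
        exact Or.inr ⟨v, hv, h⟩
    have h1 := card_le_card hsub
    have h2 := card_union_le {a} ((nbrs F a).biUnion fun v => univ.filter fun b => Near F k v b)
    have h3 := card_biUnion_le_card_mul (nbrs F a)
      (fun v => univ.filter fun b => Near F k v b) _ fun v _ => ih v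
    have h4 : (nbrs F a).card * 3 ^ k ≤ 2 * 3 ^ k := Nat.mul_le_mul_right _ (hF a)
    have h5 : 1 ≤ 3 ^ k := Nat.one_le_pow _ _ (by norm_num)
    rw [card_singleton] at h2
    rw [pow_succ]
    omega

lemma card_eq_sum_nbrs (F : Finset (V × V)) : F.card = ∑ v, (nbrs F v).card := by
  rw [card_eq_sum_card_fiberwise (f := Prod.fst) (t := univ) (by simp)]
  refine sum_congr rfl fun v _ => ?_
  refine card_bij (fun e _ => e.2) ?_ ?_ ?_
  · rintro ⟨a, b⟩ h
    simp at h
    obtain ⟨h, rfl⟩ := h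
    simpa using h
  · rintro ⟨a, b⟩ h ⟨a', b'⟩ h' hh
    simp at h h' hh
    simp [h.2, h'.2, hh]
  · intro b hb
    exact ⟨(v, b), by simpa using hb, rfl⟩

/-- A properly coloured subgraph of maximum degree at most two without short cycles, given as
the symmetric set of its ordered edges. -/
structure IsPCLinkage (G : SimpleGraph V) (c : V → V → ℕ) (L : ℕ) (F : Finset (V × V)) :
    Prop where
  symm : ∀ u w, (u, w) ∈ F → (w, u) ∈ F
  adj : ∀ u w, (u, w) ∈ F → G.Adj u w
  inj : ∀ v u w, (v, u) ∈ F → (v, w) ∈ F → c v u = c v w → u = w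
  deg : ∀ v, (nbrs F v).card ≤ 2
  girth : ∀ u w, (u, w) ∈ F → ¬ Near (F \ {(u, w), (w, u)}) L u w

variable {G : SimpleGraph V} {c : V → V → ℕ} {L : ℕ} {F : Finset (V × V)}

lemma IsPCLinkage.mono {F' : Finset (V × V)} (hF : IsPCLinkage G c L F) (h : F' ⊆ F)
    (hs : ∀ u w, (u, w) ∈ F' → (w, u) ∈ F') : IsPCLinkage G c L F' where
  symm := hs
  adj u w hw := hF.adj u w (h hw)
  inj v u w hu hw := hF.inj v u w (h hu) (h hw)
  deg v := (card_le_card (fun w hw => by simpa using h (by simpa using hw))).trans (hF.deg v)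
  girth u w hw hn := hF.girth u w (h hw) (hn.mono (sdiff_subset_sdiff h subset_rfl) le_rfl)

lemma IsPCLinkage.ne (hF : IsPCLinkage G c L F) {u w : V} (h : (u, w) ∈ F) : u ≠ w :=
  (hF.adj u w h).ne

lemma IsPCLinkage.add {x y : V} (hc : ∀ u v, c u v = c v u) (hF : IsPCLinkage G c L F)
    (hxy : G.Adj x y)
    (hx : (nbrs F x).card ≤ 1) (hy : (nbrs F y).card ≤ 1)
    (hcx : ∀ v ∈ nbrs F x, c x v ≠ c x y) (hcy : ∀ v ∈ nbrs F y, c y v ≠ c x y)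
    (hn : ¬ Near F L x y) : IsPCLinkage G c L (F ∪ {(x, y), (y, x)}) where
  symm u w h := by
    simp only [mem_union, mem_insert, mem_singleton, Prod.mk.injEq] at h ⊢
    rcases h with h | h | h
    · exact Or.inl (hF.symm _ _ h)
    · tauto
    · tauto
  adj u w h := by
    simp only [mem_union, mem_insert, mem_singleton, Prod.mk.injEq] at h
    rcases h with h | ⟨rfl, rfl⟩ | ⟨rfl, rfl⟩
    · exact hF.adj _ _ h
    · exact hxy
    · exact hxy.symm
  inj v u w h h' := by
    simp only [mem_nbrs] at hcx hcy
    simp only [mem_union, mem_insert, mem_singleton, Prod.mk.injEq] at h h'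
    have hne := hxy.ne
    intro hcc
    rcases h with h | ⟨rfl, rfl⟩ | ⟨rfl, rfl⟩ <;> rcases h' with h' | ⟨h1, h2⟩ | ⟨h1, h2⟩
    · exact hF.inj _ _ _ h h' hcc
    · subst h1 h2; exact absurd hcc (hcx _ h)
    · subst h1 h2; exact absurd (hcc.trans (hc _ _)) (hcy _ h)
    · exact absurd hcc.symm (hcx _ h')
    · exact h2.symm
    · exact absurd h1 hne
    · exact absurd (hcc.symm.trans (hc _ _)) (hcy _ h')
    · exact absurd h1.symm hne
    · exact h2.symm
  deg v := by
    have hne := hxy.ne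
    have key : ∀ {a b : V}, (nbrs F a).card ≤ 1 →
        nbrs (F ∪ {(x, y), (y, x)}) a ⊆ insert b (nbrs F a) →
        (nbrs (F ∪ {(x, y), (y, x)}) a).card ≤ 2 := fun {a b} h h' =>
      (card_le_card h').trans ((card_insert_le _ _).trans (by omega))
    by_cases h1 : v = x
    · subst h1
      refine key (b := y) hx fun w hw => ?_
      simp [hne] at hw
      simp; tauto
    by_cases h2 : v = y
    · subst h2
      refine key (b := x) hy fun w hw => ?_
      simp [h1] at hw
      simp; tauto
    · refine (card_le_card fun w hw => ?_).trans (hF.deg v)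
      simpa [h1, h2] using hw
  girth u w h hN := by
    simp only [mem_union, mem_insert, mem_singleton, Prod.mk.injEq] at h
    rcases h with h | ⟨rfl, rfl⟩ | ⟨rfl, rfl⟩
    · have hsub : F \ {(u, w), (w, u)} ⊆ F := sdiff_subset
      rcases Near.of_add_edge (F := F \ {(u, w), (w, u)}) (x := x) (y := y) (by
        intro a b hab
        simp only [mem_sdiff, mem_union, mem_insert, mem_singleton, Prod.mk.injEq] at hab ⊢
        tauto) hN with h' | ⟨i, j, hij, hi, hj⟩ | ⟨i, j, hij, hi, hj⟩
      · exact hF.girth _ _ h h'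
      · refine hn (((((hi.mono hsub le_rfl).symm hF.symm).trans (Near.single h)).trans
          ((hj.mono hsub le_rfl).symm hF.symm)).mono subset_rfl (by omega))
      · refine hn ((((hj.mono hsub le_rfl).trans (Near.single (hF.symm _ _ h))).trans
          (hi.mono hsub le_rfl)).mono subset_rfl (by omega))
    · refine hn (hN.mono (fun e he => ?_) le_rfl)
      simp only [mem_sdiff, mem_union] at he
      tauto
    · refine hn ((hN.mono (fun e he => ?_) le_rfl).symm hF.symm)
      simp only [mem_sdiff, mem_union, mem_insert, mem_singleton] at he
      tauto

/-- `w` can receive a new edge of colour `γ`, either in a free place or by giving up an edge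
`wo` with `(o, w) ∈ S`. -/
def Accepts (c : V → V → ℕ) (F S : Finset (V × V)) (w : V) (γ : ℕ) : Prop :=
  ∃ o, (o = w ∧ (nbrs F w).card ≤ 1 ∨ (w, o) ∈ F ∧ (o, w) ∈ S) ∧
    ∀ v ∈ nbrs F w, v ≠ o → c w v ≠ γ

/-- The vertices that may be joined to `u` after `u` has given up its edge `uo` (nothing is
given up if `o = u`). -/
noncomputable def targets (G : SimpleGraph V) (c : V → V → ℕ) (F S : Finset (V × V)) (u o : V) :
    Finset V :=
  univ.filter fun w => G.Adj u w ∧ (∀ v ∈ nbrs F u, v ≠ o → c u v ≠ c u w) ∧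
    Accepts c F S w (c u w)

/-- The edges `(u, o)` such that giving up `uo` at `u` robustly leads to an augmentation in at
most `t` exchanges. -/
noncomputable def level (G : SimpleGraph V) (c : V → V → ℕ) (F : Finset (V × V)) (N : ℕ) :
    ℕ → Finset (V × V)
  | 0 => ∅
  | t + 1 => F.filter fun e => N ≤ (targets G c F (level G c F N t) e.1 e.2).card

lemma level_subset (N t : ℕ) : level G c F N t ⊆ F := by
  cases t with
  | zero => exact empty_subset _
  | succ t => exact filter_subset _ _

end Exchange

section Augment
open scoped Classical
open Finset

variable {V : Type*} [Fintype V] {G : SimpleGraph V} {c : V → V → ℕ} {L : ℕ}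
  {F₀ : Finset (V × V)}

lemma card_targets_lt_of_modified (hc : ∀ u v, c u v = c v u) (hF₀ : IsPCLinkage G c L F₀)
    (hmax : ∀ F, IsPCLinkage G c L F → F.card ≤ F₀.card) {M N : ℕ} (hN : 3 * M + 3 ^ L < N)
    (t : ℕ) : ∀ (F : Finset (V × V)) (Z : Finset V) (u o : V), IsPCLinkage G c L F →
      F.card = F₀.card → (∀ v ∉ Z, nbrs F v = nbrs F₀ v) → u ∈ Z →
      nbrs F u = (nbrs F₀ u).erase o → (nbrs F u).card ≤ 1 → Z.card + 3 * t ≤ M →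
      (targets G c F₀ (level G c F₀ N t) u o).card < N := by
  induction t using Nat.strong_induction_on with
  | _ t ih =>
  intro F Z u o hF hcard hZ hu hou hdu hM
  by_contra! hcon
  obtain ⟨w, hw, hwB⟩ : ∃ w ∈ targets G c F₀ (level G c F₀ N t) u o,
      w ∉ (Z ∪ Z.biUnion (nbrs F₀)) ∪ univ.filter fun b => Near F L u b := by
    refine exists_mem_notMem_of_card_lt_card (lt_of_lt_of_le ?_ hcon)
    have h1 := card_union_le (Z ∪ Z.biUnion (nbrs F₀)) (univ.filter fun b => Near F L u b)
    have h2 := card_union_le Z (Z.biUnion (nbrs F₀))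
    have h3 := card_biUnion_le_card_mul Z (nbrs F₀) 2 fun v _ => hF₀.deg v
    have h4 := card_near_le hF.deg L u
    omega
  simp only [mem_union, mem_biUnion, mem_nbrs, mem_filter, mem_univ, true_and, not_or,
    not_exists, not_and] at hwB
  obtain ⟨⟨hwZ, hwN⟩, hnear⟩ := hwB
  rw [targets, mem_filter] at hw
  obtain ⟨-, huw, hemit, o', hslot, hacc⟩ := hw
  have hnw : nbrs F w = nbrs F₀ w := hZ w hwZ
  have hne := huw.ne
  have hwu : (w, u) ∉ F := fun h => by
    rw [← mem_nbrs, hnw, mem_nbrs] at h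
    exact hwN u hu (hF₀.symm _ _ h)
  have huwF : (u, w) ∉ F := fun h => hwu (hF.symm _ _ h)
  have hcu : ∀ v ∈ nbrs F u, c u v ≠ c u w := fun v hv => by
    rw [hou, mem_erase] at hv
    exact hemit v hv.2 hv.1
  rcases hslot with ⟨rfl, hdw⟩ | ⟨hwo, hlev⟩
  · have hadd := hF.add hc huw hdu (by rwa [hnw]) hcu (fun v hv => by
      refine hacc v (hnw ▸ hv) ?_
      rintro rfl
      exact hF.ne (mem_nbrs.1 hv) rfl) hnear
    have hlt : F.card < (F ∪ {(u, o'), (o', u)}).card := by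
      refine card_lt_card ⟨subset_union_left, fun h => huwF (h ?_)⟩
      simp
    have := hmax _ hadd
    omega
  · obtain ⟨t, rfl⟩ : ∃ s, t = s + 1 := by
      cases t with
      | zero => simp [level] at hlev
      | succ t => exact ⟨t, rfl⟩
    rw [level, mem_filter] at hlev
    have hoZ : o' ∉ Z := fun h => hwN o' h hlev.1
    have hou' : o' ≠ u := fun h => hoZ (h ▸ hu)
    have hwoF : (w, o') ∈ F := by rw [← mem_nbrs, hnw, mem_nbrs]; exact hwo
    have howF : (o', w) ∈ F := hF.symm _ _ hwoF
    have hwo_ne := hF.ne hwoF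
    set F' := F \ {(w, o'), (o', w)} with hF'
    have hsub : F' ⊆ F := sdiff_subset
    have hF'l : IsPCLinkage G c L F' := hF.mono hsub fun a b hab => by
      simp only [hF', mem_sdiff, mem_insert, mem_singleton, Prod.mk.injEq] at hab ⊢
      exact ⟨hF.symm _ _ hab.1, by tauto⟩
    have hn' : ∀ v, nbrs F' v ⊆ nbrs F v := fun v x hx => by
      rw [mem_nbrs] at hx ⊢
      exact hsub hx
    have hn'w : nbrs F' w = (nbrs F₀ w).erase o' := by
      ext x
      rw [mem_erase, ← hnw, mem_nbrs, mem_nbrs]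
      simp only [hF', mem_sdiff, mem_insert, mem_singleton, Prod.mk.injEq]
      tauto
    have hdw : (nbrs F' w).card ≤ 1 := by
      rw [hn'w, card_erase_of_mem (by simpa using hwo)]
      have := hF₀.deg w
      omega
    have hadd := hF'l.add hc huw ((card_le_card (hn' u)).trans hdu) hdw
      (fun v hv => hcu v (hn' u hv)) (fun v hv => by
        rw [hn'w, mem_erase] at hv
        exact hacc v hv.2 hv.1) (fun h => hnear (h.mono hsub le_rfl))
    set F₁ := F' ∪ {(u, w), (w, u)} with hF₁
    have hcard' : F₁.card = F₀.card := by
      rw [hF₁, card_union_of_disjoint, card_pair (by simp [hne]), hF', card_sdiff_of_subset,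
        card_pair (by simp [hwo_ne]), hcard]
      · have h2 : ({(w, o'), (o', w)} : Finset (V × V)) ⊆ F := by
          intro e he
          simp only [mem_insert, mem_singleton] at he
          rcases he with rfl | rfl <;> assumption
        have := card_le_card h2
        rw [card_pair (by simp [hwo_ne])] at this
        omega
      · intro e he
        simp only [mem_insert, mem_singleton] at he
        rcases he with rfl | rfl <;> assumption
      · rw [disjoint_right]
        intro e he hh
        simp only [mem_insert, mem_singleton] at he
        rcases he with rfl | rfl
        · exact huwF (hsub hh)
        · exact hwu (hsub hh)
    have hno : nbrs F₁ o' = (nbrs F₀ o').erase w := by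
      ext x
      rw [mem_erase, ← hZ o' hoZ, mem_nbrs, mem_nbrs]
      simp only [hF₁, hF', mem_union, mem_sdiff, mem_insert, mem_singleton, Prod.mk.injEq]
      have := hwo_ne.symm
      tauto
    refine absurd (ih t (by omega) F₁ (Z ∪ {w, o'}) o' w hadd hcard' ?_ (by simp) hno ?_ ?_)
      (not_lt.2 hlev.2)
    · intro v hv
      simp only [mem_union, mem_insert, mem_singleton, not_or] at hv
      rw [← hZ v hv.1]
      have hvu : v ≠ u := fun h => hv.1 (h ▸ hu)
      ext x
      rw [mem_nbrs, mem_nbrs]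
      simp only [hF₁, hF', mem_union, mem_sdiff, mem_insert, mem_singleton, Prod.mk.injEq]
      tauto
    · rw [hno, card_erase_of_mem (by simpa using hlev.1)]
      have := hF₀.deg o'
      omega
    · have h1 := card_union_le Z {w, o'}
      have h2 := card_le_two (a := w) (b := o')
      omega

lemma card_targets_lt (hc : ∀ u v, c u v = c v u) (hF₀ : IsPCLinkage G c L F₀)
    (hmax : ∀ F, IsPCLinkage G c L F → F.card ≤ F₀.card) {T N : ℕ}
    (hN : 3 * (3 * T + 1) + 3 ^ L < N) {t : ℕ} (ht : t ≤ T) {u : V}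
    (hu : (nbrs F₀ u).card ≤ 1) : (targets G c F₀ (level G c F₀ N t) u u).card < N := by
  refine card_targets_lt_of_modified hc hF₀ hmax hN t F₀ {u} u u hF₀ rfl (fun _ _ => rfl)
    (by simp) ?_ hu (by simp; omega)
  rw [erase_eq_of_notMem]
  intro h
  exact hF₀.ne (mem_nbrs.1 h) rfl

end Augment

lemma deficiency_arith {n a b α β Θ K M ε : ℝ} (hn : 0 < n) (hα : 0 ≤ α) (hβ : 0 ≤ β)
    (hαa : α ≤ a) (hβb : β ≤ b) (han : a ≤ n) (hbn : b ≤ n) (hΘ : Θ ≤ (1 / 3 - ε) * n)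
    (hε : 0 < ε) (h1 : a * b ≤ K + Θ * (a + β)) (h2 : a * b ≤ K + Θ * (b + α))
    (h3 : a * b ≤ K + Θ * (α + β) + (a - α) * (b - β))
    (hM : 2 * n + M ≤ 2 * a - α + (2 * b - β)) (hKM : 3 * K < n * M) (hKn : 9 * K ≤ n ^ 2)
    (hKε : 3 * K < ε * n ^ 2) : False := by
  have hΘ' : Θ ≤ n / 3 := by nlinarith
  by_cases hb : 3 * b ≤ 2 * n
  · have : Θ * (b + α) ≤ n / 3 * (b + α) := mul_le_mul_of_nonneg_right hΘ' (by linarith)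
    nlinarith [mul_nonneg (sub_nonneg.2 hb) (sub_nonneg.2 han)]
  by_cases ha : 3 * a ≤ 2 * n
  · have : Θ * (a + β) ≤ n / 3 * (a + β) := mul_le_mul_of_nonneg_right hΘ' (by linarith)
    nlinarith [mul_nonneg (sub_nonneg.2 ha) (sub_nonneg.2 hbn)]
  push Not at ha hb
  have h4 : Θ * (a + β) ≤ n / 3 * (a + β) := mul_le_mul_of_nonneg_right hΘ' (by linarith)
  have h5 : n / 3 ≤ β := by
    have : a * (2 * n) ≤ a * (3 * b) := mul_le_mul_of_nonneg_left hb.le (by linarith)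
    have h6 : n * (n / 3) ≤ n * β := by nlinarith
    exact le_of_mul_le_mul_left h6 hn
  have h7 : Θ * (α + β) ≤ (1 / 3 - ε) * n * (α + β) :=
    mul_le_mul_of_nonneg_right hΘ (by linarith)
  have h8 : ε * n * (n / 3) ≤ ε * n * (α + β) :=
    mul_le_mul_of_nonneg_left (by linarith) (by positivity)
  nlinarith [mul_nonneg hβ (sub_nonneg.2 hαa), mul_nonneg hα (sub_nonneg.2 hβb),
    mul_nonneg hβ (sub_nonneg.2 ha.le), mul_nonneg hα (sub_nonneg.2 hb.le)]

section Counting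
open scoped Classical
open Finset

variable {V : Type*} [Fintype V] {G : SimpleGraph V} {c : V → V → ℕ}

lemma card_filter_le_mul_left (X : Finset V) (p : V → V → Prop) {Θ : ℕ}
    (h : ∀ u ∈ X, (univ.filter fun w => p u w).card ≤ Θ) :
    (univ.filter fun e : V × V => e.1 ∈ X ∧ p e.1 e.2).card ≤ X.card * Θ := by
  refine (card_le_card (t := X.biUnion fun u => (univ.filter fun w => p u w).image
    fun w => (u, w)) fun e he => ?_).trans (card_biUnion_le_card_mul _ _ _ fun u hu =>
      card_image_le.trans (h u hu))
  simp only [mem_filter, mem_univ, true_and] at he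
  simp only [mem_biUnion, mem_image, mem_filter, mem_univ, true_and]
  exact ⟨e.1, he.1, e.2, he.2, rfl⟩

lemma card_filter_le_mul_right (X : Finset V) (p : V → V → Prop) {Θ : ℕ}
    (h : ∀ w ∈ X, (univ.filter fun u => p w u).card ≤ Θ) :
    (univ.filter fun e : V × V => e.2 ∈ X ∧ p e.2 e.1).card ≤ X.card * Θ := by
  refine (card_le_card (t := X.biUnion fun w => (univ.filter fun u => p w u).image
    fun u => (u, w)) fun e he => ?_).trans (card_biUnion_le_card_mul _ _ _ fun u hu =>
      card_image_le.trans (h u hu))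
  simp only [mem_filter, mem_univ, true_and] at he
  simp only [mem_biUnion, mem_image, mem_filter, mem_univ, true_and]
  exact ⟨e.2, he.1, e.1, he.2, rfl⟩

lemma card_and_sum_of_le_two (f : V → ℕ) (hf : ∀ v, f v ≤ 2) :
    (univ.filter fun v => 1 ≤ f v).card =
      (univ.filter fun v => f v = 1).card + (univ.filter fun v => f v = 2).card ∧
    ∑ v, f v = (univ.filter fun v => f v = 1).card + 2 * (univ.filter fun v => f v = 2).card := by
  simp only [card_filter, ← sum_add_distrib, mul_sum]
  constructor <;> refine sum_congr rfl fun v _ => ?_ <;> have := hf v <;>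
    interval_cases f v <;> simp

/-- If the multiplicities `r` and `s` are large then there are many edges `uw` whose colour is
permitted at both ends, where multiplicity one forbids one colour and multiplicity zero
forbids all. -/
lemma false_of_few_permitted {ε : ℝ} (hε : 0 < ε) {Θ K : ℕ} {M : ℝ}
    (hΘ : ∀ u a, (univ.filter fun w => ¬ (G.Adj u w ∧ c u w ≠ a)).card ≤ Θ)
    (hΘε : (Θ : ℝ) ≤ (1 / 3 - ε) * Fintype.card V) (hV : 0 < Fintype.card V)
    (r s κ ν : V → ℕ) (hr : ∀ v, r v ≤ 2) (hs : ∀ v, s v ≤ 2)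
    (hK : (univ.filter fun e : V × V => 1 ≤ r e.1 ∧ 1 ≤ s e.2 ∧ G.Adj e.1 e.2 ∧
      (r e.1 = 1 → c e.1 e.2 ≠ κ e.1) ∧ (s e.2 = 1 → c e.2 e.1 ≠ ν e.2)).card ≤ K)
    (hM : 2 * (Fintype.card V : ℝ) + M ≤ (∑ v, r v : ℕ) + (∑ v, s v : ℕ))
    (hKM : 3 * (K : ℝ) < Fintype.card V * M) (hKn : 9 * (K : ℝ) ≤ (Fintype.card V : ℝ) ^ 2)
    (hKε : 3 * (K : ℝ) < ε * (Fintype.card V : ℝ) ^ 2) : False := by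
  set A := univ.filter fun v => 1 ≤ r v with hA
  set B := univ.filter fun v => 1 ≤ s v with hB
  set A₁ := univ.filter fun v => r v = 1 with hA₁
  set B₁ := univ.filter fun v => s v = 1 with hB₁
  set A₂ := univ.filter fun v => r v = 2 with hA₂
  set B₂ := univ.filter fun v => s v = 2 with hB₂
  obtain ⟨hAc, hrs⟩ := card_and_sum_of_le_two r hr
  obtain ⟨hBc, hss⟩ := card_and_sum_of_le_two s hs
  set P := univ.filter fun e : V × V => 1 ≤ r e.1 ∧ 1 ≤ s e.2 ∧ G.Adj e.1 e.2 ∧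
      (r e.1 = 1 → c e.1 e.2 ≠ κ e.1) ∧ (s e.2 = 1 → c e.2 e.1 ≠ ν e.2) with hP
  obtain ⟨p, hp⟩ : ∃ p : V → V → Prop, ∀ u w, p u w ↔ ¬ (G.Adj u w ∧ c u w ≠ κ u) :=
    ⟨_, fun _ _ => Iff.rfl⟩
  obtain ⟨q, hq⟩ : ∃ q : V → V → Prop, ∀ u w, q u w ↔ ¬ (G.Adj u w ∧ c u w ≠ ν u) :=
    ⟨_, fun _ _ => Iff.rfl⟩
  have left : ∀ X : Finset V, (univ.filter fun e : V × V => e.1 ∈ X ∧ p e.1 e.2).card ≤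
      X.card * Θ := fun X => card_filter_le_mul_left X p fun u _ => by
    simpa only [hp] using hΘ u (κ u)
  have right : ∀ X : Finset V, (univ.filter fun e : V × V => e.2 ∈ X ∧ q e.2 e.1).card ≤
      X.card * Θ := fun X => card_filter_le_mul_right X q fun u _ => by
    simpa only [hq] using hΘ u (ν u)
  have cover : ∀ (X Y : Finset V) (E : Finset (V × V)),
      (∀ u w, 1 ≤ r u → 1 ≤ s w → u ∉ X → w ∉ Y → (u, w) ∈ E) → A₁ ⊆ X → B₁ ⊆ Y →
      A.card * B.card ≤ K + X.card * Θ + Y.card * Θ + E.card := by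
    intro X Y E hE hX hY
    rw [← card_product]
    set X' := univ.filter fun e : V × V => e.1 ∈ X ∧ p e.1 e.2 with hX'
    set Y' := univ.filter fun e : V × V => e.2 ∈ Y ∧ q e.2 e.1 with hY'
    have hsub : A ×ˢ B ⊆ P ∪ X' ∪ Y' ∪ E := by
      rintro ⟨u, w⟩ he
      simp only [mem_product, hA, hB, mem_filter, mem_univ, true_and] at he
      by_cases h₁ : (u, w) ∈ X'
      · simp [h₁]
      by_cases h₂ : (u, w) ∈ Y'
      · simp [h₂]
      by_cases h₃ : u ∉ X ∧ w ∉ Y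
      · simp [hE u w he.1 he.2 h₃.1 h₃.2]
      have h₄ : (u, w) ∈ P := by
        simp only [hX', hY', mem_filter, mem_univ, true_and, hp, hq] at h₁ h₂
        replace h₁ := fun h => not_not.1 (not_and.1 h₁ h)
        replace h₂ := fun h => not_not.1 (not_and.1 h₂ h)
        simp only [hP, mem_filter, mem_univ, true_and]
        refine ⟨he.1, he.2, ?_, fun h => (h₁ (hX (by simp [hA₁, h]))).2,
          fun h => (h₂ (hY (by simp [hB₁, h]))).2⟩
        by_cases hu : u ∈ X
        · exact (h₁ hu).1
        · exact (h₂ (by tauto)).1.symm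
      simp [h₄]
    have h1 := card_le_card hsub
    have h2 := card_union_le (P ∪ X' ∪ Y') E
    have h3 := card_union_le (P ∪ X') Y'
    have h4 := card_union_le P X'
    have h5 : X'.card ≤ _ := left X
    have h6 : Y'.card ≤ _ := right Y
    omega
  have hA₁A : A₁ ⊆ A := fun v hv => by simp [hA₁] at hv; simp [hA, hv]
  have hB₁B : B₁ ⊆ B := fun v hv => by simp [hB₁] at hv; simp [hB, hv]
  have i1 := cover A B₁ ∅ (fun u w hu _ hX => absurd (by simpa [hA] using hu) hX) hA₁A
    subset_rfl
  have i2 := cover A₁ B ∅ (fun u w _ hw _ hY => absurd (by simpa [hB] using hw) hY)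
    subset_rfl hB₁B
  have i3 := cover A₁ B₁ (A₂ ×ˢ B₂) (fun u w hu hw hX hY => by
    simp only [hA₁, hB₁, mem_filter, mem_univ, true_and] at hX hY
    simp only [mem_product, hA₂, hB₂, mem_filter, mem_univ, true_and]
    have := hr u
    have := hs w
    omega) subset_rfl subset_rfl
  rw [card_product] at i3
  rw [card_empty] at i1 i2
  have hAn : A.card ≤ Fintype.card V := card_le_univ _
  have hBn : B.card ≤ Fintype.card V := card_le_univ _
  have i1' : (A.card * B.card : ℝ) ≤ K + A.card * Θ + B₁.card * Θ + 0 := by exact_mod_cast i1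
  have i2' : (A.card * B.card : ℝ) ≤ K + A₁.card * Θ + B.card * Θ + 0 := by exact_mod_cast i2
  have i3' : (A.card * B.card : ℝ) ≤ K + A₁.card * Θ + B₁.card * Θ + A₂.card * B₂.card := by
    exact_mod_cast i3
  have hAc' : (A.card : ℝ) = A₁.card + A₂.card := by exact_mod_cast hAc
  have hBc' : (B.card : ℝ) = B₁.card + B₂.card := by exact_mod_cast hBc
  rw [hrs, hss] at hM
  push_cast at hM
  refine deficiency_arith (n := Fintype.card V) (a := A.card) (b := B.card) (α := A₁.card)
    (β := B₁.card) (Θ := Θ) (K := K) (M := M) (ε := ε) (by exact_mod_cast hV) (by positivity)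
    (by positivity) (by exact_mod_cast card_le_card hA₁A) (by exact_mod_cast card_le_card hB₁B)
    (by exact_mod_cast hAn) (by exact_mod_cast hBn) hΘε hε (by linarith)
    (by linarith) ?_ (by linarith) hKM hKn hKε
  have e1 : (A.card : ℝ) - A₁.card = A₂.card := by linarith
  have e2 : (B.card : ℝ) - B₁.card = B₂.card := by linarith
  rw [e1, e2]
  linarith

end Counting

section Linkage
open scoped Classical
open Finset

variable {V : Type*} [Fintype V] {G : SimpleGraph V} {c : V → V → ℕ} {L : ℕ}
  {F D : Finset (V × V)}

/-- At `w` there is a free place (`o = w`) or the edge `wo` belongs to `D`. -/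
def IsSlot (F D : Finset (V × V)) (w o : V) : Prop :=
  o = w ∧ (nbrs F w).card ≤ 1 ∨ (w, o) ∈ D

/-- The number of free places at `w` plus the number of edges of `D` at `w`. -/
noncomputable def slotCount (F D : Finset (V × V)) (w : V) : ℕ :=
  (nbrs D w).card + (2 - (nbrs F w).card)

lemma nbrs_mono (hD : D ⊆ F) (w : V) : nbrs D w ⊆ nbrs F w := fun v hv => by
  simpa using hD (by simpa using hv)

lemma slotCount_le_two (hF : IsPCLinkage G c L F) (hD : D ⊆ F) (w : V) :
    slotCount F D w ≤ 2 := by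
  have h1 := card_le_card (nbrs_mono hD w)
  have h2 := hF.deg w
  unfold slotCount
  omega

lemma sum_slotCount (hF : IsPCLinkage G c L F) :
    ∑ v, slotCount F D v + F.card = D.card + 2 * Fintype.card V := by
  rw [card_eq_sum_nbrs F, card_eq_sum_nbrs D, mul_comm, ← smul_eq_mul (Fintype.card V),
    ← card_univ, ← sum_const, ← sum_add_distrib, ← sum_add_distrib]
  refine sum_congr rfl fun v _ => ?_
  have := hF.deg v
  unfold slotCount
  omega

lemma exists_isSlot {w : V} (h : 1 ≤ slotCount F D w) : ∃ o, IsSlot F D w o := by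
  by_cases hw : (nbrs F w).card ≤ 1
  · exact ⟨w, Or.inl ⟨rfl, hw⟩⟩
  · have : 0 < (nbrs D w).card := by
      unfold slotCount at h
      omega
    obtain ⟨o, ho⟩ := card_pos.1 this
    exact ⟨o, Or.inr (by simpa using ho)⟩

lemma exists_forbidden (hF : IsPCLinkage G c L F) (hD : D ⊆ F) (w : V) :
    ∃ κ, 1 ≤ slotCount F D w →
      ∀ γ ≠ κ, ∃ o, IsSlot F D w o ∧ ∀ v ∈ nbrs F w, v ≠ o → c w v ≠ γ := by
  by_cases h : 1 ≤ slotCount F D w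
  · obtain ⟨o, ho⟩ := exists_isSlot h
    have hcard : ((nbrs F w).erase o).card ≤ 1 := by
      rcases ho with ⟨-, hw⟩ | ho
      · exact (card_erase_le).trans hw
      · have h1 := card_erase_of_mem (show o ∈ nbrs F w by simpa using hD ho)
        have h2 := hF.deg w
        omega
    obtain ⟨κ, hκ⟩ : ∃ κ, ∀ v ∈ (nbrs F w).erase o, c w v = κ := by
      rcases ((nbrs F w).erase o).eq_empty_or_nonempty with h | ⟨x, hx⟩
      · exact ⟨0, by simp [h]⟩
      · exact ⟨c w x, fun v hv => by rw [card_le_one.1 hcard v hv x hx]⟩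
    exact ⟨κ, fun _ γ hγ => ⟨o, ho, fun v hv hvo hvγ =>
      hγ (by rw [← hvγ, hκ v (by simp [hvo, mem_nbrs.1 hv])])⟩⟩
  · exact ⟨0, fun h' => absurd h' h⟩

lemma exists_slot_of_two_le (hF : IsPCLinkage G c L F) (hD : D ⊆ F) {w : V}
    (h : 2 ≤ slotCount F D w) (γ : ℕ) :
    ∃ o, IsSlot F D w o ∧ ∀ v ∈ nbrs F w, v ≠ o → c w v ≠ γ := by
  by_cases hγ : ∃ v ∈ nbrs F w, c w v = γ
  · obtain ⟨o, ho, rfl⟩ := hγ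
    have heq : nbrs D w = nbrs F w := by
      refine eq_of_subset_of_card_le (nbrs_mono hD w) ?_
      have := hF.deg w
      unfold slotCount at h
      omega
    rw [← heq] at ho
    refine ⟨o, Or.inr (by simpa using ho), fun v hv hvo hvc => hvo ?_⟩
    exact hF.inj w v o (by simpa using hv) (hD (by simpa using ho)) hvc
  · push Not at hγ
    obtain ⟨o, ho⟩ := exists_isSlot (F := F) (D := D) (w := w) (by omega)
    exact ⟨o, ho, fun v hv _ => hγ v hv⟩

lemma exists_small_step {T B : ℕ} (hT : 0 < T) (a : ℕ → ℕ) (hB : ∀ t, a t ≤ B) :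
    ∃ t < T, T * a (t + 1) ≤ T * a t + B := by
  by_contra! h
  have : ∀ t ≤ T, t * (B + 1) ≤ T * a t := by
    intro t ht
    induction t with
    | zero => simp
    | succ t ih =>
      have := ih (by omega)
      have := h t (by omega)
      rw [Nat.succ_mul]
      omega
  have h1 := Nat.le_of_mul_le_mul_left (this T le_rfl) hT
  have h2 := hB T
  omega

theorem exists_linkage {ε μ : ℝ} (hε : 0 < ε) (hμ : 0 < μ) (L : ℕ) :
    ∃ n₀ : ℕ, ∀ (V : Type) [Fintype V] (G : SimpleGraph V) (c : V → V → ℕ),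
      (∀ u v, c u v = c v u) → n₀ ≤ Fintype.card V →
      (∀ u a, (2 / 3 + ε) * (Fintype.card V : ℝ) ≤
        (univ.filter fun w => G.Adj u w ∧ c u w ≠ a).card) →
      ∃ F, IsPCLinkage G c L F ∧ (2 - μ) * (Fintype.card V : ℝ) ≤ F.card := by
  obtain ⟨T, hT⟩ := exists_nat_gt (4 / μ)
  set N := 3 * (3 * T + 1) + 3 ^ L + 1 with hN
  obtain ⟨n₀, hn₀⟩ := exists_nat_gt (18 * N / μ + 27 * N + 9 * N / ε)
  refine ⟨n₀, fun V _ G c hc hn hdeg => ?_⟩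
  have hT0 : 0 < (T : ℝ) := lt_trans (by positivity) hT
  have hn' : 18 * N / μ + 27 * N + 9 * N / ε < (Fintype.card V : ℝ) :=
    hn₀.trans_le (by exact_mod_cast hn)
  have hN0 : (0 : ℝ) < N := by rw [hN]; positivity
  have hnμ : 18 * N < (Fintype.card V : ℝ) * μ := by
    rw [← div_lt_iff₀ hμ]
    have : 0 < 9 * N / ε := by positivity
    linarith
  have hnε : 9 * N < (Fintype.card V : ℝ) * ε := by
    rw [← div_lt_iff₀ hε]
    have : 0 < 18 * N / μ := by positivity
    linarith
  have hn27 : 27 * N < (Fintype.card V : ℝ) := by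
    have : 0 < 18 * N / μ := by positivity
    have : 0 < 9 * N / ε := by positivity
    linarith
  have hVpos : (0 : ℝ) < Fintype.card V := by linarith
  obtain ⟨F, hF, hmax⟩ := exists_max_image (univ.filter fun F => IsPCLinkage G c L F) card
    ⟨∅, by
      rw [mem_filter]
      exact ⟨mem_univ _, by simp, by simp, by simp, by simp [nbrs], by simp⟩⟩
  rw [mem_filter] at hF
  replace hF := hF.2
  replace hmax : ∀ F', IsPCLinkage G c L F' → F'.card ≤ F.card := fun F' h =>
    hmax F' (by simp [h])
  refine ⟨F, hF, ?_⟩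
  by_contra! hlt
  obtain ⟨t, htT, ht⟩ := exists_small_step (T := T) (B := F.card) (by exact_mod_cast hT0)
    (fun t => (level G c F N t).card) fun t => card_le_card (level_subset N t)
  set D := F \ level G c F N (t + 1) with hD
  set E := F.filter fun e => (e.2, e.1) ∈ level G c F N t with hE
  have hDF : D ⊆ F := sdiff_subset
  have hEF : E ⊆ F := filter_subset _ _
  have hEcard : E.card = (level G c F N t).card := by
    refine card_bij (fun e _ => (e.2, e.1)) ?_ ?_ ?_
    · intro e he
      exact (mem_filter.1 he).2
    · rintro ⟨a, b⟩ _ ⟨a', b'⟩ _ h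
      simp only [Prod.mk.injEq] at h
      simp [h]
    · rintro ⟨a, b⟩ h
      exact ⟨(b, a), by simpa [hE, h] using hF.symm _ _ (level_subset N t h), rfl⟩
  have hDcard := card_sdiff_add_card_eq_card (level_subset (G := G) (c := c) (F := F) N (t + 1))
  choose κ hκ using exists_forbidden hF hDF
  choose ν hν using exists_forbidden hF hEF
  have hrs := sum_slotCount (D := D) hF
  have hss := sum_slotCount (D := E) hF
  set n := Fintype.card V with hncard
  refine false_of_few_permitted (G := G) (c := c) hε (Θ := n - ⌈(2 / 3 + ε) * (n : ℝ)⌉₊)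
    (K := n * (3 * N)) (M := μ * n / 2)
    ?_ ?_ (by exact_mod_cast hVpos) (slotCount F D) (slotCount F E) κ ν
    (slotCount_le_two hF hDF) (slotCount_le_two hF hEF) ?_ ?_ ?_ ?_ ?_
  · intro u a
    have h1 := card_filter_add_card_filter_not (s := univ)
      (fun w => G.Adj u w ∧ c u w ≠ a)
    have h2 : ⌈(2 / 3 + ε) * (n : ℝ)⌉₊ ≤ _ := Nat.ceil_le.2 (hdeg u a)
    rw [card_univ] at h1
    omega
  · have hle := Nat.le_ceil ((2 / 3 + ε) * (n : ℝ))
    have hle' : ⌈(2 / 3 + ε) * (n : ℝ)⌉₊ ≤ n := by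
      obtain ⟨u⟩ : Nonempty V := Fintype.card_pos_iff.1 (by exact_mod_cast hVpos)
      exact (Nat.ceil_le.2 (hdeg u 0)).trans (card_le_univ _)
    rw [Nat.cast_sub hle']
    linarith
  · refine (card_le_card (t := univ.biUnion fun u => ((insert u (nbrs F u)).filter
      fun o => IsSlot F D u o).biUnion fun o =>
        (targets G c F (level G c F N t) u o).image fun w => (u, w)) ?_).trans
      ((card_biUnion_le_card_mul univ _ (3 * N) fun u _ =>
        (card_biUnion_le_card_mul _ _ N ?_).trans (Nat.mul_le_mul_right _ ?_)).trans
        (by rw [card_univ]))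
    · rintro ⟨u, w⟩ h
      simp only [mem_filter, mem_univ, true_and] at h
      obtain ⟨h1, h2, h3, h4, h5⟩ := h
      have hu : ∃ o, IsSlot F D u o ∧ ∀ v ∈ nbrs F u, v ≠ o → c u v ≠ c u w := by
        by_cases h : slotCount F D u = 1
        · exact hκ u h1 _ (h4 h)
        · exact exists_slot_of_two_le hF hDF (by omega) _
      have hw : ∃ o, IsSlot F E w o ∧ ∀ v ∈ nbrs F w, v ≠ o → c w v ≠ c w u := by
        by_cases h : slotCount F E w = 1
        · exact hν w h2 _ (h5 h)
        · exact exists_slot_of_two_le hF hEF (by omega) _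
      obtain ⟨o, ho, hfree⟩ := hu
      obtain ⟨p, hp, hfree'⟩ := hw
      simp only [mem_biUnion, mem_univ, true_and, mem_image, mem_filter, mem_insert, mem_nbrs]
      refine ⟨u, o, ⟨?_, ho⟩, w, ?_, rfl⟩
      · rcases ho with ho | ho
        · exact Or.inl ho.1
        · exact Or.inr (hDF ho)
      · simp only [targets, mem_filter, mem_univ, true_and]
        refine ⟨h3, hfree, p, ?_, by simpa only [hc u w] using hfree'⟩
        rcases hp with hp | hp
        · exact Or.inl hp
        · rw [hE, mem_filter] at hp
          exact Or.inr hp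
    · intro o ho
      refine card_image_le.trans (le_of_lt ?_)
      rw [mem_filter] at ho
      rcases ho.2 with ⟨rfl, ho⟩ | ho
      · exact card_targets_lt hc hF hmax (T := T) (by omega) htT.le ho
      · rw [hD, mem_sdiff, level, mem_filter] at ho
        have := ho.2
        simp only [ho.1, true_and, not_le] at this
        exact this
    · refine (card_filter_le _ _).trans ((card_insert_le _ _).trans ?_)
      have := hF.deg u
      omega
  · have h1 : ((∑ v, slotCount F D v : ℕ) : ℝ) + F.card = D.card + 2 * n := by
      exact_mod_cast hrs
    have h2 : ((∑ v, slotCount F E v : ℕ) : ℝ) + F.card = E.card + 2 * n := by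
      exact_mod_cast hss
    have h3 : (D.card : ℝ) + (level G c F N (t + 1)).card = F.card := by exact_mod_cast hDcard
    have h4 : (E.card : ℝ) = (level G c F N t).card := by exact_mod_cast hEcard
    have h5 : (T : ℝ) * (level G c F N (t + 1)).card ≤ T * (level G c F N t).card + F.card := by
      exact_mod_cast ht
    have h6 : ((level G c F N (t + 1)).card : ℝ) - (level G c F N t).card ≤ μ * n / 2 := by
      refine le_of_mul_le_mul_left ?_ hT0
      have : 4 < T * μ := by rwa [div_lt_iff₀ hμ] at hT
      nlinarith
    linarith
  all_goals push_cast
  · nlinarith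
  · nlinarith
  · nlinarith

end Linkage

section Cover
open scoped Classical
open Finset

variable {V : Type*} {G : SimpleGraph V} {c : V → V → ℕ} {L : ℕ} {F : Finset (V × V)}

lemma near_of_isChain {a w : V} {l : List V} (h : (a :: l).IsChain fun x y => (x, y) ∈ F)
    (hw : w ∈ a :: l) : Near F l.length a w := by
  induction l generalizing a with
  | nil => exact (List.mem_singleton.1 hw).symm
  | cons b l ih =>
    rw [List.isChain_cons_cons] at h
    rcases List.mem_cons.1 hw with rfl | hw
    · exact Near.refl _ _ _
    · exact Or.inr ⟨b, h.1, ih h.2 hw⟩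

variable [Fintype V]

lemma IsPCLinkage.isPCWalk (hc : ∀ u v, c u v = c v u) (hF : IsPCLinkage G c L F) {l : List V}
    (hn : l.Nodup) (h : l.IsChain fun x y => (x, y) ∈ F) : IsPCWalk G c l := by
  match l, hn, h with
  | [], _, _ => trivial
  | [_], _, _ => trivial
  | [a, b], _, h => exact hF.adj a b (by simpa using h)
  | a :: b :: d :: l, hn, h =>
    rw [List.isChain_cons_cons] at h
    refine ⟨hF.adj a b h.1, fun hab => ?_, hF.isPCWalk hc (List.nodup_cons.1 hn).2 h.2⟩
    have := hF.inj b a d (hF.symm _ _ h.1) (List.isChain_cons_cons.1 h.2).1 (by rw [hc b a, hab])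
    simp [this] at hn

lemma IsPCLinkage.card_nbrs_le_one_of_short (hF : IsPCLinkage G c L F) {a : V} {l : List V}
    (hn : (a :: l).Nodup) (h : (a :: l).IsChain fun x y => (x, y) ∈ F)
    (hcl : ∀ w, (a, w) ∈ F → w ∈ a :: l) (hl : l.length ≤ L) : (nbrs F a).card ≤ 1 := by
  match l, hn, h, hcl, hl with
  | [], _, _, hcl, _ =>
    refine (card_le_card (t := {a}) fun w hw => ?_).trans (by simp)
    simpa using hcl w (by simpa using hw)
  | b :: l, hn, h, hcl, hl =>
    refine (card_le_card (t := {b}) fun w hw => ?_).trans (by simp)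
    rw [mem_nbrs] at hw
    rw [mem_singleton]
    by_contra hwb
    have hwl : w ∈ b :: l := by
      have := hcl w hw
      rw [List.mem_cons] at this
      exact this.resolve_left (hF.ne hw).symm
    rw [List.isChain_cons_cons] at h
    have hchain : (b :: l).IsChain fun x y => (x, y) ∈ F \ {(a, w), (w, a)} := by
      refine h.2.imp_of_mem_imp fun x y hx hy hxy => ?_
      have ha := (List.nodup_cons.1 hn).1
      simp only [mem_sdiff, hxy, mem_insert, mem_singleton, Prod.mk.injEq, true_and]
      rintro (⟨rfl, -⟩ | ⟨-, rfl⟩)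
      · exact ha hx
      · exact ha hy
    refine hF.girth a w hw (Near.mono subset_rfl hl (Or.inr ⟨b, ?_, near_of_isChain hchain hwl⟩))
    simp only [mem_sdiff, h.1, mem_insert, mem_singleton, Prod.mk.injEq, true_and]
    rintro (rfl | ⟨rfl, -⟩)
    · exact hwb rfl
    · exact hF.ne hw rfl

lemma IsPCLinkage.mem_of_maximal (hF : IsPCLinkage G c L F) {S : Finset V}
    (hS : ∀ v ∈ S, ∀ w, (v, w) ∈ F → w ∈ S) {P : List V} (hn : P.Nodup)
    (h : P.IsChain fun x y => (x, y) ∈ F) (hPS : ∀ v ∈ P, v ∈ S)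
    (hmax : ∀ Q : List V, Q.Nodup → (Q.IsChain fun x y => (x, y) ∈ F) → (∀ v ∈ Q, v ∈ S) →
      Q.length ≤ P.length) {v w : V} (hv : v ∈ P) (hvw : (v, w) ∈ F) : w ∈ P := by
  by_contra hw
  have hwS := hS v (hPS v hv) w hvw
  obtain ⟨s, t, rfl⟩ := List.append_of_mem hv
  rcases List.eq_nil_or_concat s with rfl | ⟨s, x, rfl⟩
  · have := hmax (w :: v :: t) (List.nodup_cons.2 ⟨hw, hn⟩)
      (List.isChain_cons_cons.2 ⟨hF.symm _ _ hvw, h⟩) (by simpa [hwS] using hPS)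
    simp at this
  cases t with
  | nil =>
    have := hmax ((s ++ [x]) ++ [v, w]) ?_ ?_ ?_
    · simp at this
    · have := List.nodup_append.2 ⟨hn, List.nodup_singleton w, fun a ha b hb => by
        rintro rfl
        rw [List.mem_singleton] at hb
        exact hw (hb ▸ by simpa using ha)⟩
      simpa using this
    · rw [List.isChain_split]
      exact ⟨by simpa using h, by simpa using hvw⟩
    · intro u hu
      by_cases huw : u = w
      · exact huw ▸ hwS
      · refine hPS u ?_
        simp at hu ⊢
        tauto
  | cons y t =>
    have h1 : (x, v) ∈ F ∧ (v, y) ∈ F := by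
      have : (s ++ x :: v :: (y :: t)).IsChain fun x y => (x, y) ∈ F := by simpa using h
      rw [List.isChain_append_cons_cons] at this
      exact ⟨this.2.1, (List.isChain_cons_cons.1 this.2.2).1⟩
    have h2 : ({x, y, w} : Finset V) ⊆ nbrs F v := by
      intro u hu
      simp only [mem_insert, mem_singleton] at hu
      rw [mem_nbrs]
      rcases hu with rfl | rfl | rfl
      · exact hF.symm _ _ h1.1
      · exact h1.2
      · exact hvw
    have h3 : ({x, y, w} : Finset V).card = 3 := by
      rw [card_eq_three]
      refine ⟨x, y, w, ?_, ?_, ?_, rfl⟩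
      · rintro rfl
        simp [List.nodup_append] at hn
      · rintro rfl
        simp at hw
      · rintro rfl
        simp at hw
    have := card_le_card h2
    have := hF.deg v
    omega

lemma IsPCLinkage.exists_paths (hc : ∀ u v, c u v = c v u) (hF : IsPCLinkage G c L F)
    (S : Finset V) (hS : ∀ v ∈ S, ∀ w, (v, w) ∈ F → w ∈ S) :
    ∃ Ps : List (List V), (∀ P ∈ Ps, P ≠ [] ∧ IsPCPath G c P) ∧ Ps.flatten.Nodup ∧
      (∀ v, v ∈ Ps.flatten ↔ v ∈ S) ∧
      2 * L * Ps.length ≤ L * ∑ v ∈ S, (2 - (nbrs F v).card) + 2 * S.card := by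
  induction S using Finset.strongInduction with
  | H S ih =>
  rcases S.eq_empty_or_nonempty with rfl | ⟨v₀, hv₀⟩
  · exact ⟨[], by simp, by simp, by simp, by simp⟩
  let good : List V → Prop := fun P =>
    P.Nodup ∧ (P.IsChain fun x y => (x, y) ∈ F) ∧ ∀ v ∈ P, v ∈ S
  obtain ⟨P, ⟨hn, hch, hPS⟩, hlen⟩ : ∃ P, good P ∧ P.length =
      Nat.findGreatest (fun k => ∃ P, good P ∧ P.length = k) (Fintype.card V) :=
    Nat.findGreatest_spec (P := fun k => ∃ P, good P ∧ P.length = k) (m := 1)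
      (Fintype.card_pos_iff.2 ⟨v₀⟩) ⟨[v₀], ⟨by simp, by simp, by simpa using hv₀⟩, rfl⟩
  have hmax : ∀ Q : List V, Q.Nodup → (Q.IsChain fun x y => (x, y) ∈ F) → (∀ v ∈ Q, v ∈ S) →
      Q.length ≤ P.length := fun Q h1 h2 h3 => by
    rw [hlen]
    exact Nat.le_findGreatest h1.length_le_card ⟨Q, ⟨h1, h2, h3⟩, rfl⟩
  have hcl : ∀ v ∈ P, ∀ w, (v, w) ∈ F → w ∈ P := fun v hv w hvw =>
    hF.mem_of_maximal hS hn hch hPS hmax hv hvw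
  have hPne : P ≠ [] := by
    rintro rfl
    have := hmax [v₀] (by simp) (by simp) (by simpa using hv₀)
    simp at this
  have hPsub : P.toFinset ⊆ S := fun v hv => hPS v (by simpa using hv)
  have hcharge : 2 * L ≤ L * ∑ v ∈ P.toFinset, (2 - (nbrs F v).card) + 2 * P.toFinset.card := by
    rw [List.toFinset_card_of_nodup hn]
    by_cases hl : P.length ≤ L
    · have : 2 ≤ ∑ v ∈ P.toFinset, (2 - (nbrs F v).card) := by
        obtain ⟨a, l, rfl⟩ := List.exists_cons_of_ne_nil hPne
        have ha := hF.card_nbrs_le_one_of_short hn hch (hcl a (by simp))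
          (by simp at hl; omega)
        rcases List.eq_nil_or_concat l with rfl | ⟨l', b, rfl⟩
        · have : nbrs F a = ∅ := by
            refine eq_empty_of_forall_notMem fun w hw => ?_
            rw [mem_nbrs] at hw
            have := hcl a (by simp) w hw
            simp at this
            exact hF.ne hw this.symm
          simp [this]
        · rw [List.concat_eq_append] at *
          have hrev : (b :: (l'.reverse ++ [a])) = (a :: (l' ++ [b])).reverse := by simp
          have hb := hF.card_nbrs_le_one_of_short (a := b) (l := l'.reverse ++ [a])
            (by rw [hrev]; exact List.nodup_reverse.2 hn)
            (by
              rw [hrev, List.isChain_reverse]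
              exact hch.imp fun x y h => hF.symm _ _ h)
            (fun w hw => by
              rw [hrev, List.mem_reverse]
              exact hcl b (by simp) w hw)
            (by simp at hl ⊢; omega)
          have hab : a ≠ b := by
            rintro rfl
            simp at hn
          have h1 : ∑ v ∈ {a, b}, (2 - (nbrs F v).card) ≤
              ∑ v ∈ (a :: (l' ++ [b])).toFinset, (2 - (nbrs F v).card) :=
            sum_le_sum_of_subset (by
              intro u hu
              simp only [mem_insert, mem_singleton] at hu
              simp
              tauto)
          rw [sum_pair hab] at h1
          omega
      have := Nat.mul_le_mul_left L this
      omega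
    · omega
  obtain ⟨Ps, h1, h2, h3, h4⟩ := ih (S \ P.toFinset) (by
      refine sdiff_ssubset hPsub ?_
      obtain ⟨a, l, rfl⟩ := List.exists_cons_of_ne_nil hPne
      exact ⟨a, by simp⟩) (fun v hv w hvw => by
      simp only [mem_sdiff, List.mem_toFinset] at hv ⊢
      exact ⟨hS v hv.1 w hvw, fun hw => hv.2 (hcl w hw v (hF.symm _ _ hvw))⟩)
  refine ⟨P :: Ps, ?_, ?_, ?_, ?_⟩
  · intro Q hQ
    rcases List.mem_cons.1 hQ with rfl | hQ
    · exact ⟨hPne, hn, hF.isPCWalk hc hn hch⟩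
    · exact h1 Q hQ
  · rw [List.flatten_cons, List.nodup_append]
    refine ⟨hn, h2, fun a ha b hb hab => ?_⟩
    have := (h3 b).1 hb
    rw [mem_sdiff, List.mem_toFinset] at this
    exact this.2 (hab ▸ ha)
  · intro v
    rw [List.flatten_cons, List.mem_append, h3, mem_sdiff, List.mem_toFinset]
    have := hPS v
    tauto
  · have h5 := sum_sdiff (f := fun v => 2 - (nbrs F v).card) hPsub
    have h6 := card_sdiff_add_card_eq_card hPsub
    rw [← h5, List.length_cons]
    linarith

theorem exists_path_cover {ε μ : ℝ} (hε : 0 < ε) (hμ : 0 < μ) :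
    ∃ n₀ : ℕ, ∀ (V : Type) [Fintype V] (G : SimpleGraph V) (c : V → V → ℕ),
      (∀ u v, c u v = c v u) → n₀ ≤ Fintype.card V →
      (∀ u a, (2 / 3 + ε) * (Fintype.card V : ℝ) ≤
        (univ.filter fun w => G.Adj u w ∧ c u w ≠ a).card) →
      ∃ Ps : List (List V), (∀ P ∈ Ps, P ≠ [] ∧ IsPCPath G c P) ∧ Ps.flatten.Nodup ∧
        (∀ v, v ∈ Ps.flatten) ∧ (Ps.length : ℝ) ≤ μ * Fintype.card V := by
  obtain ⟨L, hL⟩ := exists_nat_gt (2 / μ)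
  obtain ⟨n₀, h⟩ := exists_linkage hε hμ L
  refine ⟨n₀, fun V _ G c hc hn hdeg => ?_⟩
  obtain ⟨F, hF, hcard⟩ := h V G c hc hn hdeg
  obtain ⟨Ps, h1, h2, h3, h4⟩ := hF.exists_paths hc univ fun _ _ _ _ => mem_univ _
  refine ⟨Ps, h1, h2, fun v => (h3 v).2 (mem_univ v), ?_⟩
  have h5 := sum_slotCount (D := ∅) hF
  have h6 : ∑ v, slotCount F ∅ v = ∑ v, (2 - (nbrs F v).card) :=
    sum_congr rfl fun v _ => by simp [slotCount, nbrs]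
  rw [h6, card_empty, zero_add] at h5
  have h5' : ((∑ v, (2 - (nbrs F v).card) : ℕ) : ℝ) + F.card = 2 * Fintype.card V := by
    exact_mod_cast h5
  have h4' : 2 * (L : ℝ) * Ps.length ≤ L * ((∑ v, (2 - (nbrs F v).card) : ℕ) : ℝ) +
      2 * Fintype.card V := by exact_mod_cast h4
  have hL0 : 0 < (L : ℝ) := lt_trans (by positivity) hL
  have hLμ : 2 < L * μ := by rwa [div_lt_iff₀ hμ] at hL
  have h7 : ((∑ v, (2 - (nbrs F v).card) : ℕ) : ℝ) ≤ μ * Fintype.card V := by linarith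
  refine le_of_mul_le_mul_left (a := 2 * (L : ℝ)) ?_ (by positivity)
  have h8 := mul_le_mul_of_nonneg_left h7 hL0.le
  have h9 : (0 : ℝ) ≤ Fintype.card V := by positivity
  nlinarith

end Cover

section Connecting
open scoped Classical
open Finset

variable {V : Type*} [Fintype V] {G : SimpleGraph V} {c : V → V → ℕ} {D : ℕ}

/-- The neighbours of `v` outside `U` joined to `v` by an edge with colour outside `K`. -/
noncomputable def allowedNbrs (G : SimpleGraph V) (c : V → V → ℕ) (v : V) (K : Finset ℕ)
    (U : Finset V) : Finset V :=
  univ.filter fun w => G.Adj v w ∧ c v w ∉ K ∧ w ∉ U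

lemma mem_allowedNbrs {v w : V} {K : Finset ℕ} {U : Finset V} :
    w ∈ allowedNbrs G c v K U ↔ G.Adj v w ∧ c v w ∉ K ∧ w ∉ U := by
  simp [allowedNbrs]

lemma colourDeg_eq (v : V) :
    colourDeg G c v = ((univ.filter fun w => G.Adj v w).image (c v)).card := by
  rw [colourDeg, ← Set.ncard_coe_finset]
  congr
  ext
  simp

lemma colourDeg_le_card_allowedNbrs (v : V) (K : Finset ℕ) (U : Finset V) :
    colourDeg G c v ≤ (allowedNbrs G c v K U).card + K.card + U.card := by
  rw [colourDeg_eq]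
  have h1 : (univ.filter fun w => G.Adj v w).image (c v) ⊆
      ((allowedNbrs G c v K U).image (c v) ∪ K) ∪ U.image (c v) := by
    intro a ha
    obtain ⟨w, hw, rfl⟩ := mem_image.1 ha
    simp only [mem_union, mem_image, mem_allowedNbrs]
    by_cases hK : c v w ∈ K
    · exact Or.inl (Or.inr hK)
    by_cases hU : w ∈ U
    · exact Or.inr ⟨w, hU, rfl⟩
    exact Or.inl (Or.inl ⟨w, ⟨(mem_filter.1 hw).2, hK, hU⟩, rfl⟩)
  have h2 := card_le_card h1
  have h3 := card_union_le ((allowedNbrs G c v K U).image (c v) ∪ K) (U.image (c v))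
  have h4 := card_union_le ((allowedNbrs G c v K U).image (c v)) K
  have h5 := card_image_le (s := allowedNbrs G c v K U) (f := c v)
  have h6 := card_image_le (s := U) (f := c v)
  omega

lemma two_card_le_allowedNbrs (hD : ∀ v, 2 * Fintype.card V + 3 * D ≤ 3 * colourDeg G c v) (v : V)
    {K : Finset ℕ} {U : Finset V} (h : K.card + U.card ≤ D) :
    2 * Fintype.card V ≤ 3 * (allowedNbrs G c v K U).card := by
  have := hD v
  have := colourDeg_le_card_allowedNbrs (G := G) (c := c) v K U
  omega

lemma exists_connecting_edge (hD : ∀ v, 2 * Fintype.card V + 3 * D ≤ 3 * colourDeg G c v)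
    (hD2 : 2 ≤ D) (hV : 0 < Fintype.card V) {X Y : Finset V}
    (hX : 2 * Fintype.card V ≤ 3 * X.card) (hY : 2 * Fintype.card V ≤ 3 * Y.card)
    (κ ν : V → ℕ) :
    ∃ z ∈ X, ∃ w ∈ Y, G.Adj z w ∧ c z w ≠ κ z ∧ c w z ≠ ν w := by
  by_contra! h
  set n := Fintype.card V with hn
  obtain ⟨Θ, hΘn, hΘ⟩ : ∃ Θ, 3 * Θ < n ∧
      ∀ u a, (univ.filter fun w => ¬ (G.Adj u w ∧ c u w ≠ a)).card ≤ Θ := by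
    refine ⟨(n - 1) / 3, by omega, fun u a => ?_⟩
    have h1 := colourDeg_le_card_allowedNbrs (G := G) (c := c) u {a} ∅
    have h2 := card_filter_add_card_filter_not (s := univ) (fun w => G.Adj u w ∧ c u w ≠ a)
    have h3 : allowedNbrs G c u {a} ∅ = univ.filter fun w => G.Adj u w ∧ c u w ≠ a := by
      ext w
      simp [mem_allowedNbrs]
    have h4 := hD u
    rw [h3, card_singleton, card_empty] at h1
    rw [card_univ] at h2
    omega
  obtain ⟨p, hp⟩ : ∃ p : V → V → Prop, ∀ u w, p u w ↔ ¬ (G.Adj u w ∧ c u w ≠ κ u) :=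
    ⟨_, fun _ _ => Iff.rfl⟩
  obtain ⟨q, hq⟩ : ∃ q : V → V → Prop, ∀ u w, q u w ↔ ¬ (G.Adj u w ∧ c u w ≠ ν u) :=
    ⟨_, fun _ _ => Iff.rfl⟩
  have left := card_filter_le_mul_left X p (Θ := Θ) fun u _ => by
    simpa only [hp] using hΘ u (κ u)
  have right := card_filter_le_mul_right Y q (Θ := Θ) fun u _ => by
    simpa only [hq] using hΘ u (ν u)
  have hsub : X ×ˢ Y ⊆ (univ.filter fun e : V × V => e.1 ∈ X ∧ p e.1 e.2) ∪
      univ.filter fun e : V × V => e.2 ∈ Y ∧ q e.2 e.1 := by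
    rintro ⟨u, w⟩ he
    rw [mem_product] at he
    simp only [mem_union, mem_filter, mem_univ, true_and, hp, hq]
    have h1 := h u he.1 w he.2
    have h2 := G.adj_comm u w
    simp only at he ⊢
    by_cases h3 : G.Adj u w ∧ c u w ≠ κ u
    · exact Or.inr ⟨he.2, fun h4 => h4.2 (h1 h3.1 h3.2)⟩
    · exact Or.inl ⟨he.1, h3⟩
  have h1 := (card_le_card hsub).trans (card_union_le _ _)
  rw [card_product] at h1
  have h2 : X.card * Y.card ≤ X.card * Θ + Y.card * Θ := by omega
  have hX0 : 0 < X.card := by omega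
  have h3 : X.card * (3 * Θ) < X.card * n := Nat.mul_lt_mul_of_pos_left hΘn hX0
  have h4 : Y.card * (3 * Θ) ≤ Y.card * n := Nat.mul_le_mul_left _ hΘn.le
  have h5 := Nat.mul_le_mul_left Y.card hX
  have h6 := Nat.mul_le_mul_left X.card hY
  nlinarith

lemma exists_connection (hc : ∀ u v, c u v = c v u)
    (hD : ∀ v, 2 * Fintype.card V + 3 * D ≤ 3 * colourDeg G c v)
    (hD2 : 2 ≤ D) {U : Finset V} (hU : U.card + 1 ≤ D) {l m : List V} {p q s t : V}
    (h₁ : IsPCWalk G c (l ++ [p, q])) (h₂ : IsPCWalk G c (s :: t :: m)) :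
    ∃ z w, z ∉ U ∧ w ∉ U ∧ z ≠ w ∧
      IsPCWalk G c (l ++ p :: q :: z :: w :: s :: t :: m) := by
  have hV : 0 < Fintype.card V := Fintype.card_pos_iff.2 ⟨p⟩
  obtain ⟨z, hz, w, hw, hzw, h3, h4⟩ := exists_connecting_edge (G := G) (c := c) hD hD2 hV
    (X := allowedNbrs G c q {c p q} U) (Y := allowedNbrs G c s {c s t} U)
    (two_card_le_allowedNbrs hD q (by rw [card_singleton]; omega))
    (two_card_le_allowedNbrs hD s (by rw [card_singleton]; omega))
    (fun z => c q z) (fun w => c s w)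
  rw [mem_allowedNbrs, mem_singleton] at hz hw
  refine ⟨z, w, hz.2.2, hw.2.2, hzw.ne, h₁.glue ?_⟩
  have hpq : G.Adj p q := h₁.of_append_right
  rw [hc s w] at h4
  rw [hc w z] at h4
  rw [hc s w] at hw
  exact ⟨hpq, Ne.symm hz.2.1, hz.1, h3.symm, hzw, h4, hw.1.symm, hw.2.1, h₂⟩

lemma exists_closing (hc : ∀ u v, c u v = c v u)
    (hD : ∀ v, 2 * Fintype.card V + 3 * D ≤ 3 * colourDeg G c v) (hD2 : 2 ≤ D) {l : List V}
    {p q : V} (h : IsPCPath G c (l ++ [p, q])) (hl : l.length + 3 ≤ D) :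
    ∃ z w, ([p, q] ++ (z :: w :: l)).Nodup ∧
      IsPCWalk G c ([p, q] ++ (z :: w :: l) ++ [p, q]) := by
  obtain ⟨s, t, m, hm⟩ : ∃ s t m, l ++ [p, q] = s :: t :: m := by
    match l with
    | [] => exact ⟨p, q, [], rfl⟩
    | [a] => exact ⟨a, p, [q], rfl⟩
    | a :: b :: l => exact ⟨a, b, l ++ [p, q], rfl⟩
  obtain ⟨z, w, hz, hw, hzw, hwalk⟩ := exists_connection hc hD hD2
    (U := (l ++ [p, q]).toFinset) (by
      have := List.toFinset_card_le (l ++ [p, q])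
      simp only [List.length_append, List.length_cons, List.length_nil] at this
      omega) h.2 (hm ▸ h.2)
  rw [← hm] at hwalk
  refine ⟨z, w, ?_, by simpa using hwalk.of_append_right⟩
  rw [List.mem_toFinset] at hz hw
  have hperm : ([p, q] ++ (z :: w :: l)).Perm (z :: w :: (l ++ [p, q])) :=
    List.perm_append_comm
  rw [hperm.nodup_iff]
  refine List.nodup_cons.2 ⟨?_, List.nodup_cons.2 ⟨hw, h.1⟩⟩
  rw [List.mem_cons, not_or]
  exact ⟨hzw, hz⟩

lemma exists_path_of_length (hD : ∀ v, 2 * Fintype.card V + 3 * D ≤ 3 * colourDeg G c v)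
    (hc : ∀ u v, c u v = c v u) (hV : 0 < Fintype.card V) (k : ℕ) (hk : k + 2 ≤ D) :
    ∃ l p q, l.length = k ∧ IsPCPath G c (l ++ [p, q]) := by
  suffices ∃ a b m, m.length = k ∧ IsPCPath G c (a :: b :: m) by
    obtain ⟨a, b, m, hm, hn, hw⟩ := this
    rcases List.eq_nil_or_concat (a :: b :: m) with h | ⟨l, q, h⟩
    · simp at h
    rcases List.eq_nil_or_concat l with rfl | ⟨l, p, rfl⟩
    · simp at h
    simp only [List.concat_eq_append, List.append_assoc, List.cons_append, List.nil_append] at h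
    refine ⟨l, p, q, ?_, h ▸ hn, h ▸ hw⟩
    have := congrArg List.length h
    simp at this
    omega
  induction k with
  | zero =>
    obtain ⟨v⟩ := Fintype.card_pos_iff.1 hV
    have := two_card_le_allowedNbrs hD v (K := ∅) (U := ∅) (by simp)
    obtain ⟨w, hw⟩ := card_pos.1 (show 0 < (allowedNbrs G c v ∅ ∅).card by omega)
    rw [mem_allowedNbrs] at hw
    exact ⟨v, w, [], rfl, by simpa using hw.1.ne, hw.1⟩
  | succ k ih =>
    obtain ⟨a, b, m, hm, hn, hw⟩ := ih (by omega)
    have := two_card_le_allowedNbrs hD a (K := {c a b}) (U := (a :: b :: m).toFinset) (by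
      rw [List.toFinset_card_of_nodup hn, card_singleton]
      simp
      omega)
    obtain ⟨x, hx⟩ := card_pos.1
      (show 0 < (allowedNbrs G c a {c a b} (a :: b :: m).toFinset).card by omega)
    rw [mem_allowedNbrs, mem_singleton, List.mem_toFinset] at hx
    exact ⟨x, a, b :: m, by simp [hm], List.nodup_cons.2 ⟨hx.2.2, hn⟩, hx.1.symm,
      by rw [hc x a]; exact hx.2.1, hw⟩

lemma exists_triangle (hc : ∀ u v, c u v = c v u)
    (hD : ∀ v, 2 * Fintype.card V + 3 * D ≤ 3 * colourDeg G c v) (hD2 : 2 ≤ D)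
    (hV : 0 < Fintype.card V) : ∃ l, IsPCCycle G c l ∧ l.length = 3 := by
  obtain ⟨x⟩ := Fintype.card_pos_iff.1 hV
  obtain ⟨X, hX, hbij⟩ := Set.exists_subset_bijOn {w | G.Adj x w} (c x)
  have hcard : 2 * Fintype.card V ≤ 3 * X.toFinset.card := by
    have := hD x
    rw [colourDeg, ← hbij.image_eq, hbij.injOn.ncard_image,
      Set.ncard_eq_toFinset_card'] at this
    omega
  obtain ⟨z, hz, w, hw, hzw, h1, h2⟩ := exists_connecting_edge (G := G) (c := c) hD hD2 hV hcard
    hcard (fun z => c x z) (fun w => c x w)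
  rw [Set.mem_toFinset] at hz hw
  have hxz : G.Adj x z := hX hz
  have hxw : G.Adj x w := hX hw
  refine ⟨[x, z, w], ⟨le_rfl, ?_, ?_⟩, rfl⟩
  · simp [hxz.ne, hxw.ne, hzw.ne]
  · refine ⟨hxz, h1.symm, hzw, ?_, hxw.symm, ?_, hxz⟩
    · rw [hc w x, hc z w]
      exact h2
    · rw [hc w x]
      exact fun h => hzw.ne (hbij.injOn hz hw h.symm)

lemma exists_short_cycle (hc : ∀ u v, c u v = c v u)
    (hD : ∀ v, 2 * Fintype.card V + 3 * D ≤ 3 * colourDeg G c v) (hV : 0 < Fintype.card V)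
    {k : ℕ} (hk : 3 ≤ k) (hkD : k ≤ D) : ∃ l, IsPCCycle G c l ∧ l.length = k := by
  rcases hk.eq_or_lt with rfl | hk
  · exact exists_triangle hc hD (by omega) hV
  · obtain ⟨l, p, q, hl, h⟩ := exists_path_of_length hD hc hV (k - 4) (by omega)
    obtain ⟨z, w, hn, hw⟩ := exists_closing hc hD (by omega) h (by omega)
    exact ⟨_, ⟨by simp, hn, hw⟩, by simp; omega⟩

end Connecting

section Absorbers
open scoped Classical
open Finset

lemma mul_le_card_filter_prod {α β : Type*} [Fintype α] [Fintype β] (S : Finset α)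
    (T : α → Finset β) {M N M' N' : ℕ} (hS : M' ≤ N' * S.card)
    (h : ∀ a ∈ S, M ≤ N * (T a).card) :
    M' * M ≤ N' * N * (univ.filter fun e : α × β => e.1 ∈ S ∧ e.2 ∈ T e.1).card := by
  have h1 : (univ.filter fun e : α × β => e.1 ∈ S ∧ e.2 ∈ T e.1).card =
      ∑ a ∈ S, (T a).card := by
    rw [← card_sigma]
    refine card_bij (fun e _ => ⟨e.1, e.2⟩) ?_ ?_ ?_
    · intro e he
      simpa using he
    · rintro ⟨a, b⟩ _ ⟨a', b'⟩ _ h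
      simpa using h
    · rintro ⟨a, b⟩ h
      exact ⟨(a, b), by simpa using h, rfl⟩
  have h2 : S.card * M ≤ N * ∑ a ∈ S, (T a).card := by
    rw [mul_sum, ← smul_eq_mul, ← sum_const]
    exact sum_le_sum h
  rw [h1, mul_assoc]
  calc M' * M ≤ N' * S.card * M := Nat.mul_le_mul_right _ hS
    _ = N' * (S.card * M) := mul_assoc _ _ _
    _ ≤ _ := Nat.mul_le_mul_left _ h2

variable {V : Type*} [Fintype V] {G : SimpleGraph V} {c : V → V → ℕ} {D : ℕ}

/-- The list of vertices of a quadruple. -/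
def quadList (z : V × V × V × V) : List V := [z.1, z.2.1, z.2.2.1, z.2.2.2]

lemma card_absorbers (hc : ∀ u v, c u v = c v u)
    (hD : ∀ v, 2 * Fintype.card V + 3 * D ≤ 3 * colourDeg G c v) {U : Finset V}
    (hU : U.card + 4 ≤ D) (i : V × V × V × V) :
    Fintype.card V ^ 4 ≤ 81 * (univ.filter fun z : V × V × V × V =>
      ((∀ v ∈ quadList z, v ∉ U) ∧ IsFourPath G c z) ∧ IsAbsorber G c i z).card := by
  obtain ⟨x, x', y, y'⟩ := i
  set n := Fintype.card V with hn
  let S₂ := allowedNbrs G c x {c x x'} U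
  let S₃ := fun z₂ => allowedNbrs G c y {c y y', c x z₂} U ∩ allowedNbrs G c z₂ ∅ ∅
  let S₁ := fun z₂ z₃ => allowedNbrs G c z₂ {c x z₂, c z₂ z₃} (insert z₃ U)
  let S₄ := fun z₂ z₃ z₁ => allowedNbrs G c z₃ {c y z₃, c z₂ z₃} (insert z₁ (insert z₂ U))
  have h₄ : ∀ z₂ z₃ z₁, n ≤ 3 * (S₄ z₂ z₃ z₁).card := fun z₂ z₃ z₁ => by
    have h1 := card_le_two (a := c y z₃) (b := c z₂ z₃)
    have h2 := card_insert_le z₁ (insert z₂ U)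
    have h3 := card_insert_le z₂ U
    have := two_card_le_allowedNbrs hD z₃ (K := {c y z₃, c z₂ z₃})
      (U := insert z₁ (insert z₂ U)) (by omega)
    simp only [S₄]
    omega
  have h₁ : ∀ z₂ z₃, n ≤ 3 * (S₁ z₂ z₃).card := fun z₂ z₃ => by
    have h1 := card_le_two (a := c x z₂) (b := c z₂ z₃)
    have h2 := card_insert_le z₃ U
    have := two_card_le_allowedNbrs hD z₂ (K := {c x z₂, c z₂ z₃}) (U := insert z₃ U) (by omega)
    simp only [S₁]
    omega
  have h₃ : ∀ z₂, n ≤ 3 * (S₃ z₂).card := fun z₂ => by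
    have h1 := card_le_two (a := c y y') (b := c x z₂)
    have h2 := two_card_le_allowedNbrs hD y (K := {c y y', c x z₂}) (U := U) (by omega)
    have h3 := two_card_le_allowedNbrs hD z₂ (K := ∅) (U := ∅) (by simp)
    have h4 := card_union_add_card_inter (allowedNbrs G c y {c y y', c x z₂} U)
      (allowedNbrs G c z₂ ∅ ∅)
    have h5 := card_le_univ (allowedNbrs G c y {c y y', c x z₂} U ∪ allowedNbrs G c z₂ ∅ ∅)
    simp only [S₃]
    omega
  have h₂ : n ≤ 3 * S₂.card := by
    have := two_card_le_allowedNbrs hD x (K := {c x x'}) (U := U)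
      (by rw [card_singleton]; omega)
    simp only [S₂]
    omega
  have hcount := mul_le_card_filter_prod S₂ _ h₂ fun z₂ _ =>
    mul_le_card_filter_prod (S₃ z₂) _ (h₃ z₂) fun z₃ _ =>
      mul_le_card_filter_prod (S₁ z₂ z₃) (S₄ z₂ z₃) (h₁ z₂ z₃) fun z₁ _ => h₄ z₂ z₃ z₁
  refine le_trans (by rw [pow_succ', pow_succ', pow_succ', pow_one]; exact hcount)
    (Nat.mul_le_mul_left _ (card_le_card_of_injOn
      (fun e : V × V × V × V => (e.2.2.1, e.1, e.2.1, e.2.2.2)) ?_ ?_))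
  · rintro ⟨z₂, z₃, z₁, z₄⟩ h
    simp only [mem_coe, mem_filter, mem_univ, true_and, S₂, S₃, S₁, S₄, mem_inter,
      mem_allowedNbrs, mem_singleton, mem_insert, not_or] at h
    obtain ⟨⟨a1, a2, a3⟩, ⟨⟨b1, ⟨b2, b3⟩, b4⟩, b5, -⟩, ⟨d1, ⟨d2, d3⟩, d4, d5⟩, e1, ⟨e2, e3⟩,
      e4, e5, e6⟩ := h
    refine mem_coe.2 (mem_filter.2 ⟨mem_univ _, ?_⟩)
    simp only [quadList, IsFourPath, IsAbsorber]
    refine ⟨⟨by simp [*], ?_, d1.symm, ?_, b5, ?_, e1⟩, a1.symm, ?_, ?_, b1, ?_, ?_, ?_⟩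
    · simp [d1.ne', d4, Ne.symm e4, b5.ne, Ne.symm e5, e1.ne]
    · rw [hc z₁ z₂]; exact d3
    · exact Ne.symm e3
    · rw [hc z₁ z₂, hc z₂ x]; exact d2
    · rw [hc z₂ x]; exact a2
    · rw [hc y' y]; exact Ne.symm b2
    · exact Ne.symm e2
    · rintro -
      rw [hc z₂ x]
      exact Ne.symm b3
  · rintro ⟨_, _, _, _⟩ _ ⟨_, _, _, _⟩ _ h
    simp only [Prod.mk.injEq] at h ⊢
    tauto

end Absorbers

section Greedy
open scoped Classical
open Finset

lemma exists_good_candidate {ι κ : Type*} [Fintype ι] [Nonempty ι] (A : Finset κ)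
    (R : ι → κ → Prop) (w : ι → ℝ) (hw : ∀ i, 0 ≤ w i) {B : ℕ} (hB : 0 < B) (hA : A.card ≤ B)
    (hR : ∀ i, B ≤ 81 * (A.filter (R i)).card) :
    ∃ z ∈ A, ∑ i, w i * (if R i z then 1 / 2 else 1) ≤ 161 / 162 * ∑ i, w i := by
  have hne : A.Nonempty := by
    obtain ⟨i⟩ := ‹Nonempty ι›
    have := hR i
    have := card_filter_le A (R i)
    exact card_pos.1 (by omega)
  refine exists_le_of_sum_le hne ?_
  have hB' : (A.card : ℝ) ≤ B := by exact_mod_cast hA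
  rw [sum_comm, sum_const, nsmul_eq_mul, mul_sum, mul_sum]
  refine sum_le_sum fun i _ => ?_
  rw [← mul_sum]
  have h1 : ∑ z ∈ A, (if R i z then (1 / 2 : ℝ) else 1) =
      A.card - 1 / 2 * (A.filter (R i)).card := by
    rw [card_eq_sum_ones A, card_filter, Nat.cast_sum, Nat.cast_sum, mul_sum, ← sum_sub_distrib]
    refine sum_congr rfl fun z _ => ?_
    split_ifs <;> norm_num
  have h2 : (B : ℝ) ≤ 81 * (A.filter (R i)).card := by exact_mod_cast hR i
  rw [h1]
  have : (A.card : ℝ) - 1 / 2 * (A.filter (R i)).card ≤ 161 / 162 * A.card := by linarith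
  nlinarith [mul_le_mul_of_nonneg_left this (hw i)]

variable {V : Type*} [Fintype V] {G : SimpleGraph V} {c : V → V → ℕ} {D : ℕ}

lemma exists_absorbing_path (hc : ∀ u v, c u v = c v u)
    (hD : ∀ v, 2 * Fintype.card V + 3 * D ≤ 3 * colourDeg G c v) (hV : 0 < Fintype.card V)
    (j : ℕ) (hj : 6 * j + 2 ≤ D) :
    ∃ (l : List V) (p q : V) (zs : List (V × V × V × V)), IsPCPath G c (l ++ [p, q]) ∧
      l.length = 6 * j ∧ (∀ z ∈ zs, IsFourPath G c z ∧ quadList z <:+: l) ∧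
      zs.Pairwise (fun z z' => (quadList z).Disjoint (quadList z')) ∧
      ∑ i, (1 / 2 : ℝ) ^ zs.countP (fun z => IsAbsorber G c i z) ≤
        (161 / 162) ^ j * (Fintype.card V : ℝ) ^ 4 := by
  have hcard : Fintype.card (V × V × V × V) = Fintype.card V ^ 4 := by
    simp only [Fintype.card_prod]
    ring
  induction j with
  | zero =>
    obtain ⟨l, p, q, hl, h⟩ := exists_path_of_length hD hc hV 0 (by omega)
    refine ⟨l, p, q, [], h, hl, by simp, by simp, ?_⟩
    simp [hcard]
  | succ j ih =>
    obtain ⟨l, p, q, zs, hP, hl, hzs, hdisj, hsum⟩ := ih (by omega)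
    set U := (l ++ [p, q]).toFinset with hU
    have hUcard : U.card = 6 * j + 2 := by
      rw [hU, List.toFinset_card_of_nodup hP.1]
      simp [hl]
    obtain ⟨v⟩ := Fintype.card_pos_iff.1 hV
    have : Nonempty (V × V × V × V) := ⟨(v, v, v, v)⟩
    obtain ⟨z, hz, hzsum⟩ := exists_good_candidate
      (univ.filter fun z : V × V × V × V => (∀ v ∈ quadList z, v ∉ U) ∧ IsFourPath G c z)
      (IsAbsorber G c)
      (fun i => (1 / 2 : ℝ) ^ zs.countP (fun z => IsAbsorber G c i z)) (fun i => by positivity)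
      (B := Fintype.card V ^ 4) (by positivity) (hcard ▸ card_le_univ _) (fun i => by
        rw [filter_filter]
        exact card_absorbers hc hD (by omega) i)
    rw [mem_filter] at hz
    obtain ⟨-, hzU, hz4⟩ := hz
    obtain ⟨s, t, m, hm⟩ : ∃ s t m, l ++ [p, q] = s :: t :: m := by
      match l with
      | [] => exact ⟨p, q, [], rfl⟩
      | [a] => exact ⟨a, p, [q], rfl⟩
      | a :: b :: l => exact ⟨a, b, l ++ [p, q], rfl⟩
    obtain ⟨a, b, ha, hb, hab, hwalk⟩ := exists_connection hc hD (by omega)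
      (U := U ∪ (quadList z).toFinset) (by
        have h1 := card_union_le U (quadList z).toFinset
        have h2 : (quadList z).toFinset.card ≤ 4 := List.toFinset_card_le _
        omega) (l := [z.1, z.2.1]) hz4.2 (hm ▸ hP.2)
    rw [← hm] at hwalk
    simp only [mem_union, hU, List.mem_toFinset, not_or] at ha hb hzU
    refine ⟨quadList z ++ (a :: b :: l), p, q, z :: zs, ⟨?_, ?_⟩, ?_, ?_, ?_, ?_⟩
    · rw [List.append_assoc, List.nodup_append]
      refine ⟨hz4.1, ?_, ?_⟩
      · rw [List.cons_append, List.cons_append, List.nodup_cons, List.nodup_cons, List.mem_cons,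
          not_or]
        exact ⟨⟨hab, ha.1⟩, hb.1, hP.1⟩
      · rintro u hu w hw rfl
        rw [List.cons_append, List.cons_append, List.mem_cons, List.mem_cons] at hw
        rcases hw with rfl | rfl | hw
        · exact ha.2 hu
        · exact hb.2 hu
        · exact hzU u hu hw
    · simpa [quadList] using hwalk
    · simp [quadList, hl]
      omega
    · intro z' hz'
      rcases List.mem_cons.1 hz' with rfl | hz'
      · exact ⟨hz4, List.prefix_append _ _ |>.isInfix⟩
      · refine ⟨(hzs z' hz').1,
          (hzs z' hz').2.trans (List.IsSuffix.isInfix ⟨quadList z ++ [a, b], ?_⟩)⟩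
        simp
    · refine List.pairwise_cons.2 ⟨fun z' hz' u hu hu' => ?_, hdisj⟩
      exact hzU u hu (List.mem_append_left _ ((hzs z' hz').2.subset hu'))
    · have h1 : ∀ i, (1 / 2 : ℝ) ^ (z :: zs).countP (fun z => IsAbsorber G c i z) =
          (1 / 2 : ℝ) ^ zs.countP (fun z => IsAbsorber G c i z) *
            (if IsAbsorber G c i z then 1 / 2 else 1) := by
        intro i
        rw [List.countP_cons]
        by_cases h : IsAbsorber G c i z <;> simp [h, pow_succ]
      simp only [h1]
      refine hzsum.trans ?_
      rw [pow_succ', mul_assoc]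
      exact mul_le_mul_of_nonneg_left hsum (by norm_num)

lemma exists_absorbing_cycle (hc : ∀ u v, c u v = c v u)
    (hD : ∀ v, 2 * Fintype.card V + 3 * D ≤ 3 * colourDeg G c v) (hV : 0 < Fintype.card V)
    {s m : ℕ} (hs : (161 / 162 : ℝ) ^ s ≤ 1 / 4) (hm : Fintype.card V ^ 4 ≤ 2 ^ m)
    (hmD : 6 * (s * m) + 3 ≤ D) :
    ∃ (p q : V) (B : List V) (zs : List (V × V × V × V)), ([p, q] ++ B).Nodup ∧
      IsPCWalk G c ([p, q] ++ B ++ [p, q]) ∧ B.length = 6 * (s * m) + 2 ∧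
      (∀ z ∈ zs, IsFourPath G c z ∧ quadList z <:+: B) ∧
      zs.Pairwise (fun z z' => (quadList z).Disjoint (quadList z')) ∧
      ∀ i, m ≤ zs.countP (fun z => IsAbsorber G c i z) := by
  obtain ⟨l, p, q, zs, hP, hl, hzs, hdisj, hsum⟩ :=
    exists_absorbing_path hc hD hV (s * m) (by omega)
  obtain ⟨z, w, hn, hw⟩ := exists_closing hc hD (by omega) hP (by omega)
  refine ⟨p, q, z :: w :: l, zs, hn, hw, by simp [hl], fun a ha =>
    ⟨(hzs a ha).1, (hzs a ha).2.trans (List.IsSuffix.isInfix ⟨[z, w], rfl⟩)⟩, hdisj, fun i => ?_⟩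
  have h1 : (1 / 2 : ℝ) ^ zs.countP (fun z => IsAbsorber G c i z) ≤
      (161 / 162) ^ (s * m) * (Fintype.card V : ℝ) ^ 4 :=
    (single_le_sum (f := fun i => (1 / 2 : ℝ) ^ zs.countP (fun z => IsAbsorber G c i z))
      (fun i _ => by positivity) (mem_univ i)).trans hsum
  have h2 : (161 / 162 : ℝ) ^ (s * m) ≤ (1 / 4) ^ m := by
    rw [pow_mul]
    exact pow_le_pow_left₀ (by positivity) hs _
  have h3 : (Fintype.card V : ℝ) ^ 4 ≤ 2 ^ m := by exact_mod_cast hm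
  have h4 : (1 / 2 : ℝ) ^ zs.countP (fun z => IsAbsorber G c i z) ≤ (1 / 2) ^ m := by
    refine h1.trans ((mul_le_mul h2 h3 (by positivity) (by positivity)).trans_eq ?_)
    rw [← mul_pow]
    norm_num
  exact (pow_le_pow_iff_right_of_lt_one₀ (by norm_num) (by norm_num)).1 h4

end Greedy

section Absorbing
open scoped Classical

variable {V : Type*} {G : SimpleGraph V} {c : V → V → ℕ}

lemma exists_absorbed (p q : V) (Ps : List (List V)) (B : List V) (zs : List (V × V × V × V))
    (hw : IsPCWalk G c ([p, q] ++ B ++ [p, q]))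
    (hPs : ∀ P ∈ Ps, P ≠ [] ∧ IsPCPath G c P)
    (hzs : ∀ z ∈ zs, IsFourPath G c z ∧ quadList z <:+: B)
    (hdisj : zs.Pairwise (fun z z' => (quadList z).Disjoint (quadList z')))
    (hcount : ∀ i, Ps.length ≤ zs.countP (fun z => IsAbsorber G c i z)) :
    ∃ B', IsPCWalk G c ([p, q] ++ B' ++ [p, q]) ∧ B'.Perm (B ++ Ps.flatten) := by
  induction Ps generalizing B zs with
  | nil => exact ⟨B, hw, by simp⟩
  | cons P Ps ih =>
    obtain ⟨hPne, hPn, hPw⟩ := hPs P (by simp)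
    obtain ⟨i, hi⟩ := exists_hasEnds hPne hPn
    obtain ⟨z, hz, hiz⟩ : ∃ z ∈ zs, IsAbsorber G c i z := by
      have : 0 < zs.countP (fun z => IsAbsorber G c i z) := by
        have := hcount i
        rw [List.length_cons] at this
        omega
      simpa using List.countP_pos_iff.1 this
    have hperm := List.perm_cons_erase hz
    have hdisj' := (hperm.pairwise_iff fun h => h.symm).1 hdisj
    rw [List.pairwise_cons] at hdisj'
    obtain ⟨hz4, L, R, rfl⟩ := hzs z hz
    have hw' := isPCWalk_absorb (L := [p, q] ++ L) (R := R ++ [p, q])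
      (by simpa [quadList] using hw) hPw hi hz4 hiz
    obtain ⟨B', h1, h2⟩ := ih (L ++ (z.1 :: z.2.1 :: (P ++ [z.2.2.1, z.2.2.2])) ++ R) (zs.erase z)
      (by simpa using hw') (fun Q hQ => hPs Q (by simp [hQ]))
      (fun z' hz' => ⟨(hzs z' (List.mem_of_mem_erase hz')).1, by
        rcases infix_of_disjoint (hzs z' (List.mem_of_mem_erase hz')).2 (by simp [quadList])
          (by simp [quadList]) (hdisj'.1 z' hz').symm with h | h
        · exact h.trans ⟨[], (z.1 :: z.2.1 :: (P ++ [z.2.2.1, z.2.2.2])) ++ R, by simp⟩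
        · exact h.trans ⟨L ++ (z.1 :: z.2.1 :: (P ++ [z.2.2.1, z.2.2.2])), [], by simp⟩⟩)
      hdisj'.2 (fun j => by
        have h3 := hcount j
        rw [hperm.countP_eq, List.countP_cons, List.length_cons] at h3
        split_ifs at h3 <;> omega)
    refine ⟨B', h1, h2.trans ?_⟩
    rw [← Multiset.coe_eq_coe]
    simp only [quadList, List.flatten_cons, ← Multiset.coe_add, ← Multiset.cons_coe,
      Multiset.add_cons, Multiset.cons_add]
    simp only [← Multiset.singleton_add, Multiset.coe_nil]
    abel

end Absorbing

section Pancyclic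
open scoped Classical
open Finset

lemma IsPCWalk.map {V W : Type*} {G : SimpleGraph V} {c : V → V → ℕ} (f : W → V) {l : List W}
    (h : IsPCWalk (G.comap f) (fun u v => c (f u) (f v)) l) : IsPCWalk G c (l.map f) := by
  induction l with
  | nil => trivial
  | cons a l ih =>
    match l, ih, h with
    | [], _, _ => trivial
    | [_], _, h => exact h
    | _ :: _ :: _, ih, h => exact ⟨h.1, h.2.1, ih h.2.2⟩

variable {V : Type*} {G : SimpleGraph V} {c : V → V → ℕ}

lemma exists_paths_flatten_eq_take (Ps : List (List V))
    (hPs : ∀ P ∈ Ps, P ≠ [] ∧ IsPCPath G c P) (k : ℕ) :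
    ∃ Qs : List (List V), (∀ Q ∈ Qs, Q ≠ [] ∧ IsPCPath G c Q) ∧ Qs.length ≤ Ps.length ∧
      Qs.flatten = Ps.flatten.take k := by
  induction Ps generalizing k with
  | nil => exact ⟨[], by simp⟩
  | cons P Ps ih =>
    rcases Nat.eq_zero_or_pos k with rfl | hk
    · exact ⟨[], by simp⟩
    obtain ⟨Qs, h1, h2, h3⟩ := ih (fun Q hQ => hPs Q (by simp [hQ])) (k - P.length)
    obtain ⟨hne, hn, hw⟩ := hPs P (by simp)
    refine ⟨P.take k :: Qs, ?_, by simpa using h2, by simp [h3, List.take_append]⟩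
    intro Q hQ
    rcases List.mem_cons.1 hQ with rfl | hQ
    · refine ⟨by simp [hne, hk.ne'], hn.sublist (List.take_sublist _ _), ?_⟩
      rw [← List.take_append_drop k P] at hw
      exact hw.of_append_left
    · exact h1 Q hQ

lemma exists_cycle_of_absorbing {p q : V} {B : List V} {zs : List (V × V × V × V)}
    {Ps : List (List V)} (hw : IsPCWalk G c ([p, q] ++ B ++ [p, q])) (hB : B ≠ [])
    (hPs : ∀ P ∈ Ps, P ≠ [] ∧ IsPCPath G c P)
    (hn : ([p, q] ++ B ++ Ps.flatten).Nodup)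
    (hzs : ∀ z ∈ zs, IsFourPath G c z ∧ quadList z <:+: B)
    (hdisj : zs.Pairwise (fun z z' => (quadList z).Disjoint (quadList z')))
    (hcount : ∀ i, Ps.length ≤ zs.countP (fun z => IsAbsorber G c i z))
    {k : ℕ} (hk : k ≤ Ps.flatten.length) :
    ∃ l, IsPCCycle G c l ∧ l.length = B.length + 2 + k := by
  obtain ⟨Qs, h1, h2, h3⟩ := exists_paths_flatten_eq_take Ps hPs k
  obtain ⟨B', hw', hB'⟩ := exists_absorbed p q Qs B zs hw h1 hzs hdisj
    fun i => h2.trans (hcount i)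
  have hlen : ([p, q] ++ B').length = B.length + 2 + k := by
    have := hB'.length_eq
    simp only [List.length_append, h3, List.length_take, List.length_cons, List.length_nil]
      at this ⊢
    omega
  have hpos := List.length_pos_of_ne_nil hB
  refine ⟨[p, q] ++ B', ⟨by omega, ?_, hw'⟩, hlen⟩
  refine (hB'.append_left [p, q]).nodup_iff.2 (hn.sublist ?_)
  rw [h3, List.append_assoc]
  exact (List.Sublist.refl _).append ((List.Sublist.refl _).append (List.take_sublist _ _))

lemma exists_path_cover_compl {ε μ : ℝ} (hε : 0 < ε) (hμ : 0 < μ) :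
    ∃ n₀ : ℕ, ∀ (V : Type) [Fintype V] (G : SimpleGraph V) (c : V → V → ℕ) (U : Finset V),
      (∀ u v, c u v = c v u) → n₀ + U.card ≤ Fintype.card V →
      (∀ v, (2 / 3 + ε) * (Fintype.card V : ℝ) + U.card + 1 ≤ colourDeg G c v) →
      ∃ Ps : List (List V), (∀ P ∈ Ps, P ≠ [] ∧ IsPCPath G c P) ∧ Ps.flatten.Nodup ∧
        (∀ v, v ∈ Ps.flatten ↔ v ∉ U) ∧ (Ps.length : ℝ) ≤ μ * Fintype.card V := by
  obtain ⟨n₀, h⟩ := exists_path_cover hε hμ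
  refine ⟨n₀, fun V _ G c U hc hn hdeg => ?_⟩
  have hcard : Fintype.card {v // v ∉ U} = Fintype.card V - U.card := by
    rw [Fintype.card_subtype_compl, Fintype.card_coe]
  have hcard' : (Fintype.card {v // v ∉ U} : ℝ) ≤ Fintype.card V := by
    exact_mod_cast hcard ▸ Nat.sub_le _ _
  obtain ⟨Ps, h1, h2, h3, h4⟩ := h {v // v ∉ U} (G.comap Subtype.val) (fun u v => c u v)
    (fun u v => hc u v) (by omega) (fun u a => by
      have h1 := colourDeg_le_card_allowedNbrs (G := G) (c := c) u {a} U
      have h2 : (allowedNbrs G c u {a} U).card ≤ (univ.filter fun w : {v // v ∉ U} =>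
          (G.comap Subtype.val).Adj u w ∧ c u w ≠ a).card := by
        rw [← card_map (Function.Embedding.subtype fun v => v ∉ U)]
        refine card_le_card fun w hw => ?_
        obtain ⟨ha, hb, hd⟩ : G.Adj u w ∧ c u w ≠ a ∧ w ∉ U := by
          simpa [mem_allowedNbrs, and_assoc] using hw
        exact mem_map.2 ⟨⟨w, hd⟩, by simp [ha, hb], rfl⟩
      rw [card_singleton] at h1
      have h3 := h1.trans (Nat.add_le_add_right (Nat.add_le_add_right h2 1) U.card)
      have h4 := (hdeg u).trans (Nat.cast_le.2 h3)
      push_cast at h4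
      refine (mul_le_mul_of_nonneg_left hcard' (show 0 ≤ 2 / 3 + ε by linarith)).trans ?_
      rw [add_right_comm] at h4
      exact (le_of_add_le_add_right (le_of_add_le_add_right h4)).trans_eq (by congr!))
  refine ⟨Ps.map (List.map Subtype.val), ?_, ?_, fun v => ?_, ?_⟩
  · intro P hP
    obtain ⟨Q, hQ, rfl⟩ := List.mem_map.1 hP
    obtain ⟨hne, hn, hw⟩ := h1 Q hQ
    exact ⟨fun h => hne (List.map_eq_nil_iff.1 h), hn.map Subtype.val_injective, hw.map⟩
  · rw [← List.map_flatten]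
    exact h2.map Subtype.val_injective
  · rw [← List.map_flatten, List.mem_map]
    exact ⟨by rintro ⟨w, -, rfl⟩; exact w.2, fun hv => ⟨⟨v, hv⟩, h3 _, rfl⟩⟩
  · rw [List.length_map]
    exact h4.trans (mul_le_mul_of_nonneg_left hcard' hμ.le)

lemma eventually_pow_le_two_pow_floor {γ : ℝ} (hγ : 0 < γ) (k : ℕ) :
    ∀ᶠ n : ℕ in Filter.atTop, n ^ k ≤ 2 ^ ⌊γ * n⌋₊ := by
  have hr : (1 : ℝ) < 2 ^ γ := Real.one_lt_rpow (by norm_num) hγ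
  have h := (tendsto_pow_const_div_const_pow_of_one_lt k hr).eventually
    (gt_mem_nhds (show (0 : ℝ) < 1 / 2 by norm_num))
  filter_upwards [h] with n hn
  rw [div_lt_iff₀ (by positivity), ← Real.rpow_mul_natCast (by norm_num)] at hn
  have h1 : (2 : ℝ) ^ (γ * n) ≤ 2 ^ ((⌊γ * n⌋₊ : ℝ) + 1) :=
    Real.rpow_le_rpow_of_exponent_le (by norm_num) (Nat.lt_floor_add_one _).le
  rw [Real.rpow_add_one (by norm_num), Real.rpow_natCast] at h1
  have h2 : (n : ℝ) ^ k ≤ 2 ^ ⌊γ * n⌋₊ := by linarith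
  exact_mod_cast h2

end Pancyclic

/-- For every `ε > 0` there is `n₀` such that every edge-coloured graph on
`n ≥ n₀` vertices with `δ^c(G) ≥ (2/3 + ε) n` contains a properly coloured cycle of
length `ℓ` for every `3 ≤ ℓ ≤ n`. -/
theorem stmt1 (ε : ℝ) (hε : 0 < ε) :
    ∃ n₀ : ℕ, ∀ (V : Type) [Fintype V] (G : SimpleGraph V) (c : V → V → ℕ),
      (∀ u v, c u v = c v u) →
      n₀ ≤ Fintype.card V →
      (∀ v : V, (2 / 3 + ε) * (Fintype.card V : ℝ) ≤ colourDeg G c v) →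
      ∀ ℓ : ℕ, 3 ≤ ℓ → ℓ ≤ Fintype.card V →
        ∃ l : List V, IsPCCycle G c l ∧ l.length = ℓ := by
  classical
  obtain ⟨s, hs⟩ := exists_pow_lt_of_lt_one (show (0 : ℝ) < 1 / 4 by norm_num)
    (show (161 / 162 : ℝ) < 1 by norm_num)
  set γ : ℝ := min ε 1 / (48 * (s + 1)) with hγdef
  have hγ : 0 < γ := div_pos (lt_min hε one_pos) (by positivity)
  have hγs : 6 * (s * γ) ≤ min ε 1 / 8 := by
    have h1 : γ * (48 * (s + 1)) = min ε 1 := div_mul_cancel₀ _ (by positivity)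
    nlinarith
  obtain ⟨n₁, hn₁⟩ := exists_path_cover_compl (half_pos hε) (half_pos hγ)
  obtain ⟨n₂, hn₂⟩ := Filter.eventually_atTop.1 (eventually_pow_le_two_pow_floor hγ 4)
  refine ⟨2 * n₁ + n₂ + ⌈40 / ε⌉₊ + ⌈2 / γ⌉₊ + 16, fun V _ G c hc hn hdeg ℓ h3 hℓ => ?_⟩
  set n := Fintype.card V with hndef
  have hn40 : 40 ≤ ε * n := by
    rw [← div_le_iff₀' hε]
    exact (Nat.le_ceil _).trans (Nat.cast_le.2 (by omega))
  have hn2 : 2 ≤ γ * n := by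
    rw [← div_le_iff₀' hγ]
    exact (Nat.le_ceil _).trans (Nat.cast_le.2 (by omega))
  have hD : ∀ v, 2 * n + 3 * ⌊ε * n⌋₊ ≤ 3 * colourDeg G c v := fun v => by
    have h1 := Nat.floor_le (show 0 ≤ ε * n by positivity)
    have h2 := hdeg v
    have : (2 * n + 3 * ⌊ε * n⌋₊ : ℝ) ≤ 3 * colourDeg G c v := by linarith
    exact_mod_cast this
  set m := ⌊γ * n⌋₊ with hm
  have hmγ : (m : ℝ) ≤ γ * n := Nat.floor_le (by positivity)
  have hsm : 6 * (s * m : ℝ) ≤ min ε 1 / 8 * n := by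
    calc 6 * (s * m : ℝ) ≤ 6 * (s * (γ * n)) := by gcongr
      _ = 6 * (s * γ) * n := by ring
      _ ≤ _ := by gcongr
  have hsm1 : 6 * (s * m : ℝ) ≤ ε * n / 8 := by
    refine hsm.trans ?_
    rw [mul_div_right_comm]
    gcongr
    exact min_le_left _ _
  have hsm2 : 48 * (s * m) ≤ n := by
    have : min ε 1 / 8 * (n : ℝ) ≤ 1 / 8 * n := by
      gcongr
      exact min_le_right _ _
    have h2 : (48 * (s * m) : ℝ) ≤ n := by linarith
    exact_mod_cast h2
  have hsmD : 6 * (s * m) + 4 ≤ ⌊ε * n⌋₊ := Nat.le_floor (by push_cast; linarith)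
  rcases le_or_gt ℓ ⌊ε * n⌋₊ with hl | hl
  · exact exists_short_cycle hc hD (by omega) h3 hl
  obtain ⟨p, q, B, zs, hnd, hw, hB, hzs, hdisj, hcount⟩ :=
    exists_absorbing_cycle (m := m) hc hD (by omega) hs.le (hn₂ n (by omega)) (by omega)
  have hU : ([p, q] ++ B).toFinset.card = 6 * (s * m) + 4 := by
    rw [List.toFinset_card_of_nodup hnd]
    simp [hB]
  obtain ⟨Ps, hPs, hPn, hmem, hlen⟩ := hn₁ V G c ([p, q] ++ B).toFinset hc (by omega) fun v => by
    refine le_trans ?_ (hdeg v)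
    rw [hU]
    push_cast
    linarith
  have hPm : Ps.length ≤ m := by
    have h1 := Nat.lt_floor_add_one (γ * n)
    have : (Ps.length : ℝ) ≤ m := by linarith
    exact_mod_cast this
  have hdj : ([p, q] ++ B).Disjoint Ps.flatten := fun v hv hv' =>
    (hmem v).1 hv' (List.mem_toFinset.2 hv)
  have hfl : Ps.flatten.length + (6 * (s * m) + 4) = n := by
    rw [← hU, ← List.toFinset_card_of_nodup hPn, hndef, ← Finset.card_compl_add_card]
    congr 2
    ext v
    rw [List.mem_toFinset, Finset.mem_compl, hmem]
  obtain ⟨l, h1, h2⟩ := exists_cycle_of_absorbing hw (by rintro rfl; simp at hB) hPs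
    (hnd.append hPn hdj) hzs hdisj (fun i => hPm.trans (hcount i))
    (k := ℓ - (6 * (s * m) + 4)) (by omega)
  exact ⟨l, h1, by omega⟩
end
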